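/- For every real critical exponent α > 1, every integer n ≥ 1, and every sequence of integers k_0, ..., k_{n-1} with each k_i ≥ 2, the renormalization operator has a periodic orbit realizing this sequence of renormalization periods: there exist unimodal maps f_0, ..., f_{n-1} with critical exponent α, numbers s_0, ..., s_{n-1} ∈ (0,1), and signs ε_0, ..., ε_{n-1} ∈ {-1,+1} such that for each i the intervals f_i^j([-s_i, s_i]), 0 ≤ j ≤ k_i - 1, have pairwise disjoint interiors, f_i^{k_i}([-s_i,s_i]) ⊆ [-s_i,s_i], and ε_i·f_i^{k_i}(ε_i·s_i·x)/s_i = f_{(i+1) mod n}(x) for all x ∈ [-1,1]. -/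

import Mathlib

/-- The canonical folding map with critical exponent `α` and peak-value `t`:
`q_t(x) = -2t|x|^α + 2t - 1` (here `^` is the real power). -/
noncomputable def foldMap (α t x : ℝ) : ℝ := -2 * t * |x| ^ α + 2 * t - 1

/-- `IsDiffeo φ d1 d2` : `φ` is an orientation-preserving C² diffeomorphism of `[-1,1]`
onto itself fixing the endpoints, with first derivative `d1 > 0` and continuous second
derivative `d2`. -/
def IsDiffeo (φ d1 d2 : ℝ → ℝ) : Prop :=
  Set.BijOn φ (Set.Icc (-1 : ℝ) 1) (Set.Icc (-1 : ℝ) 1) ∧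
  φ (-1) = -1 ∧ φ 1 = 1 ∧
  (∀ x ∈ Set.Icc (-1 : ℝ) 1, HasDerivWithinAt φ (d1 x) (Set.Icc (-1 : ℝ) 1) x) ∧
  (∀ x ∈ Set.Icc (-1 : ℝ) 1, HasDerivWithinAt d1 (d2 x) (Set.Icc (-1 : ℝ) 1) x) ∧
  ContinuousOn d2 (Set.Icc (-1 : ℝ) 1) ∧
  (∀ x ∈ Set.Icc (-1 : ℝ) 1, 0 < d1 x)

/-- `f` is a unimodal map with critical exponent `α`: `f = φ ∘ q_t` with `φ` an
orientation-preserving C² diffeomorphism of `[-1,1]` fixing the endpoints and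
`t ∈ [0,1]` a peak-value. -/
def IsUnimodal (α : ℝ) (f : ℝ → ℝ) : Prop :=
  ∃ φ d1 d2 : ℝ → ℝ, ∃ t ∈ Set.Icc (0 : ℝ) 1,
    IsDiffeo φ d1 d2 ∧ ∀ x, f x = φ (foldMap α t x)

lemma det_one_add_pos {E : Type*} [NormedAddCommGroup E] [NormedSpace ℝ E]
    [FiniteDimensional ℝ E] (A : E →L[ℝ] E) (hA : ‖A‖ < 1) :
    0 < (ContinuousLinearMap.id ℝ E + A).det := by
  have hc : Continuous fun τ : ℝ => (ContinuousLinearMap.id ℝ E + τ • A).det :=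
    ContinuousLinearMap.continuous_det.comp (by fun_prop)
  have hne : ∀ τ ∈ Set.Icc (0 : ℝ) 1, (ContinuousLinearMap.id ℝ E + τ • A).det ≠ 0 := by
    intro τ hτ h0
    have hk : LinearMap.ker ((ContinuousLinearMap.id ℝ E + τ • A : E →L[ℝ] E) : E →ₗ[ℝ] E) ≠ ⊥ := by
      have := LinearMap.bot_lt_ker_of_det_eq_zero (f :=
        ((ContinuousLinearMap.id ℝ E + τ • A : E →L[ℝ] E) : E →ₗ[ℝ] E)) h0
      exact this.ne'
    obtain ⟨v, hv, hv0⟩ := Submodule.exists_mem_ne_zero_of_ne_bot hk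
    have h1 : v + τ • A v = 0 := by simpa using hv
    have h2 : ‖v‖ = ‖τ • A v‖ := by
      rw [← norm_neg (τ • A v), ← eq_neg_of_add_eq_zero_left h1]
    have hvp : 0 < ‖v‖ := norm_pos_iff.2 hv0
    have h3 : ‖τ • A v‖ ≤ 1 * (‖A‖ * ‖v‖) := by
      rw [norm_smul]
      refine mul_le_mul ?_ (A.le_opNorm v) (norm_nonneg _) zero_le_one
      rw [Real.norm_eq_abs, abs_of_nonneg hτ.1]; exact hτ.2
    nlinarith
  by_contra hneg
  push Not at hneg
  have h01 : (0 : ℝ) ∈ Set.Icc ((fun τ : ℝ => (ContinuousLinearMap.id ℝ E + τ • A).det) 1)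
      ((fun τ : ℝ => (ContinuousLinearMap.id ℝ E + τ • A).det) 0) := by
    refine ⟨by simpa using hneg, ?_⟩
    have : (ContinuousLinearMap.id ℝ E).det = 1 := LinearMap.det_id
    simp [this]
  obtain ⟨τ, hτ, h⟩ := intermediate_value_Icc' zero_le_one hc.continuousOn h01
  exact hne τ hτ h

lemma det_one_add_smul_eq_sum {n : ℕ} (M : Matrix (Fin n) (Fin n) ℝ) (v : ℕ → ℝ)
    (hv : Function.Injective v) (t : ℝ) :
    (1 + t • M).det = ∑ k ∈ Finset.range (n + 1),
      (Lagrange.basis (Finset.range (n + 1)) v k).eval t * (1 + v k • M).det := by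
  set P : Polynomial ℝ := ((Polynomial.X : Polynomial ℝ) • M.map Polynomial.C
    + (1 : Matrix (Fin n) (Fin n) ℝ).map Polynomial.C).det with hP
  have he : ∀ x, P.eval x = (1 + x • M).det := by
    intro x
    rw [hP, ← Polynomial.coe_evalRingHom, RingHom.map_det]
    congr 1
    ext i j
    by_cases hij : i = j <;> simp [hij] <;> ring
  have hd : P.degree < (Finset.range (n + 1)).card := by
    have := Polynomial.natDegree_det_X_add_C_le M (1 : Matrix (Fin n) (Fin n) ℝ)
    rw [Finset.card_range]
    refine lt_of_le_of_lt Polynomial.degree_le_natDegree ?_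
    simp only [Fintype.card_fin] at this
    exact_mod_cast Nat.lt_succ_of_le this
  have hi := Lagrange.eq_interpolate_of_eval_eq (s := Finset.range (n + 1)) (v := v)
    (f := P) (fun k => (1 + v k • M).det) hv.injOn hd (fun i _ => he _)
  rw [← he t, hi, Lagrange.interpolate_apply, Polynomial.eval_finsetSum]
  refine Finset.sum_congr rfl fun k _ => ?_
  rw [Polynomial.eval_mul, Polynomial.eval_C, mul_comm]

section NoRetraction

variable {E : Type*} [NormedAddCommGroup E] [InnerProductSpace ℝ E] [FiniteDimensional ℝ E]

lemma exists_lipschitzWith_displacement {f : E → E}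
    (hf : ∀ x ∈ Metric.closedBall (0 : E) 1, ContDiffAt ℝ 1 f x)
    (hid : ∀ x ∈ Metric.sphere (0 : E) 1, f x = x) :
    ∃ G : E → E, ∃ K : NNReal, LipschitzWith K G ∧
      (∀ x ∈ Metric.closedBall (0 : E) 1, ‖fderiv ℝ (fun x => f x - x) x‖ ≤ K) ∧
      (∀ x ∈ Metric.closedBall (0 : E) 1, G x = f x - x) ∧
      (∀ x ∉ Metric.closedBall (0 : E) 1, G x = 0) := by
  classical
  have hgd : ∀ x ∈ Metric.closedBall (0 : E) 1, ContDiffAt ℝ 1 (fun x => f x - x) x :=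
    fun x hx => (hf x hx).sub contDiffAt_id
  have hcont : ContinuousOn (fun x => ‖fderiv ℝ (fun x => f x - x) x‖₊)
      (Metric.closedBall (0 : E) 1) := fun x hx =>
    (((hgd x hx).fderiv_right (m := 0) (by norm_num)).continuousAt.nnnorm).continuousWithinAt
  obtain ⟨K, hK⟩ := (isCompact_closedBall (0 : E) 1).bddAbove_image hcont
  have hlip : LipschitzOnWith K (fun x => f x - x) (Metric.closedBall (0 : E) 1) :=
    (convex_closedBall (0 : E) 1).lipschitzOnWith_of_nnnorm_fderiv_le
      (fun x hx => (hgd x hx).differentiableAt (by norm_num))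
      (fun x hx => hK ⟨x, hx, rfl⟩)
  refine ⟨fun x => if x ∈ Metric.closedBall (0 : E) 1 then f x - x else 0, K, ?_,
    fun x hx => by exact_mod_cast hK ⟨x, hx, rfl⟩, fun x hx => by simp only [if_pos hx], fun x hx => by simp only [if_neg hx]⟩
  have key : ∀ x ∈ Metric.closedBall (0 : E) 1, ∀ y ∉ Metric.closedBall (0 : E) 1,
      ‖f x - x‖ ≤ K * ‖x - y‖ := by
    intro x hx y hy
    have h1 : (1 : ℝ) ∈ Set.Icc ‖AffineMap.lineMap x y (0 : ℝ)‖ ‖AffineMap.lineMap x y (1 : ℝ)‖ := by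
      simp only [Metric.mem_closedBall, dist_zero_right, not_le] at hx hy
      simpa using ⟨hx, hy.le⟩
    have hc : Continuous fun τ : ℝ => ‖AffineMap.lineMap x y τ‖ :=
      (AffineMap.lineMap_continuous (p := x) (q := y)).norm
    obtain ⟨τ, hτ, h⟩ := intermediate_value_Icc zero_le_one hc.continuousOn h1
    set z := AffineMap.lineMap x y τ with hz
    have hzs : z ∈ Metric.sphere (0 : E) 1 := by simpa using h
    have h2 := hlip.norm_sub_le hx (Metric.sphere_subset_closedBall hzs)
    simp only [hid z hzs, sub_self, sub_zero] at h2
    refine h2.trans (mul_le_mul_of_nonneg_left ?_ K.2)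
    have : x - z = τ • (x - y) := by
      rw [hz, AffineMap.lineMap_apply_module]; module
    rw [this, norm_smul, Real.norm_eq_abs, abs_of_nonneg hτ.1]
    exact mul_le_of_le_one_left (norm_nonneg _) hτ.2
  refine LipschitzWith.of_dist_le_mul fun x y => ?_
  rw [dist_eq_norm, dist_eq_norm]
  by_cases hx : x ∈ Metric.closedBall (0 : E) 1 <;> by_cases hy : y ∈ Metric.closedBall (0 : E) 1
  · simp only [if_pos hx, if_pos hy]; exact hlip.norm_sub_le hx hy
  · simp only [if_pos hx, if_neg hy, sub_zero]; exact key x hx y hy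
  · rw [norm_sub_rev, norm_sub_rev x y]
    simp only [if_neg hx, if_pos hy, sub_zero]
    exact key y hy x hx
  · simp only [if_neg hx, if_neg hy, sub_zero, norm_zero]; positivity

lemma image_closedBall_of_small {f G : E → E} {K : NNReal} (hG : LipschitzWith K G)
    (hin : ∀ x ∈ Metric.closedBall (0 : E) 1, G x = f x - x)
    (hout : ∀ x ∉ Metric.closedBall (0 : E) 1, G x = 0)
    {t : ℝ} (ht : 0 ≤ t) (htK : t * K < 1) :
    Set.InjOn (fun x => x + t • (f x - x)) (Metric.closedBall (0 : E) 1) ∧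
    (fun x => x + t • (f x - x)) '' Metric.closedBall (0 : E) 1 = Metric.closedBall (0 : E) 1 := by
  set F : E → E := fun x => x + t • G x with hF
  have hFa : ApproximatesLinearOn F ((ContinuousLinearEquiv.refl ℝ E : E ≃L[ℝ] E) : E →L[ℝ] E)
      Set.univ (Real.toNNReal t * K) := by
    intro x _ y _
    have : F x - F y - ((ContinuousLinearEquiv.refl ℝ E : E ≃L[ℝ] E) : E →L[ℝ] E) (x - y)
        = t • (G x - G y) := by
      simp only [hF, ContinuousLinearEquiv.coe_refl, ContinuousLinearMap.id_apply]; module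
    rw [this, norm_smul, Real.norm_eq_abs, abs_of_nonneg ht]
    have := hG.norm_sub_le x y
    rw [NNReal.coe_mul, Real.coe_toNNReal t ht, mul_assoc]
    exact mul_le_mul_of_nonneg_left this ht
  have hc : Subsingleton E ∨ (Real.toNNReal t * K : NNReal) <
      ‖((ContinuousLinearEquiv.refl ℝ E : E ≃L[ℝ] E).symm : E →L[ℝ] E)‖₊⁻¹ := by
    rcases subsingleton_or_nontrivial E with h | h
    · exact Or.inl h
    · right
      simp only [ContinuousLinearEquiv.refl_symm, ContinuousLinearEquiv.coe_refl]
      have : ‖ContinuousLinearMap.id ℝ E‖₊ = 1 := by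
        ext; simp
      rw [this, inv_one]
      rw [← NNReal.coe_lt_coe, NNReal.coe_mul, Real.coe_toNNReal t ht]
      exact_mod_cast htK
  have hinj : Function.Injective F := Set.injOn_univ.1 (hFa.injOn hc)
  have hsurj : Function.Surjective F := hFa.surjective hc
  have hFo : ∀ x ∉ Metric.closedBall (0 : E) 1, F x = x := fun x hx => by simp [hF, hout x hx]
  have hFe : Set.EqOn (fun x => x + t • (f x - x)) F (Metric.closedBall (0 : E) 1) :=
    fun x hx => by simp [hF, hin x hx]
  refine ⟨(hinj.injOn).congr hFe.symm, ?_⟩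
  rw [hFe.image_eq]
  apply Set.Subset.antisymm
  · rintro _ ⟨x, hx, rfl⟩
    by_contra h
    have := hinj (hFo _ h)
    exact h (by rwa [this])
  · intro y hy
    obtain ⟨x, rfl⟩ := hsurj y
    refine ⟨x, ?_, rfl⟩
    by_contra h
    rw [hFo x h] at hy
    exact h hy

lemma integral_det_add_smul_eq [MeasurableSpace E] [BorelSpace E] {f : E → E}
    (hf : ∀ x ∈ Metric.closedBall (0 : E) 1, ContDiffAt ℝ 1 f x)
    {G : E → E} {K : NNReal} (hG : LipschitzWith K G)
    (hK : ∀ x ∈ Metric.closedBall (0 : E) 1, ‖fderiv ℝ (fun x => f x - x) x‖ ≤ K)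
    (hin : ∀ x ∈ Metric.closedBall (0 : E) 1, G x = f x - x)
    (hout : ∀ x ∉ Metric.closedBall (0 : E) 1, G x = 0)
    {t : ℝ} (ht : 0 ≤ t) (htK : t * K < 1) :
    ∫ x in Metric.closedBall (0 : E) 1,
      (ContinuousLinearMap.id ℝ E + t • fderiv ℝ (fun x => f x - x) x).det =
      MeasureTheory.volume.real (Metric.closedBall (0 : E) 1) := by
  obtain ⟨hinj, himg⟩ := image_closedBall_of_small hG hin hout ht htK
  have hd : ∀ x ∈ Metric.closedBall (0 : E) 1, HasFDerivWithinAt (fun x => x + t • (f x - x))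
      (ContinuousLinearMap.id ℝ E + t • fderiv ℝ (fun x => f x - x) x)
      (Metric.closedBall (0 : E) 1) x := by
    intro x hx
    have h1 : DifferentiableAt ℝ (fun x => f x - x) x :=
      ((hf x hx).sub contDiffAt_id).differentiableAt (by norm_num)
    exact ((hasFDerivAt_id x).add (h1.hasFDerivAt.const_smul t)).hasFDerivWithinAt
  have := MeasureTheory.integral_image_eq_integral_abs_det_fderiv_smul MeasureTheory.volume
    (measurableSet_closedBall (x := (0 : E)) (ε := 1)) hd hinj (fun _ => (1 : ℝ))
  rw [himg] at this
  simp only [MeasureTheory.integral_const, MeasureTheory.measureReal_restrict_apply_univ,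
    smul_eq_mul, mul_one] at this
  rw [this]
  refine MeasureTheory.setIntegral_congr_fun measurableSet_closedBall fun x hx => ?_
  refine (abs_of_pos (det_one_add_pos _ ?_)).symm
  rw [norm_smul, Real.norm_eq_abs, abs_of_nonneg ht]
  exact (mul_le_mul_of_nonneg_left (hK x hx) ht).trans_lt htK

lemma det_id_add_smul_eq_sum (A : E →L[ℝ] E) (v : ℕ → ℝ) (hv : Function.Injective v) (t : ℝ) :
    (ContinuousLinearMap.id ℝ E + t • A).det =
      ∑ k ∈ Finset.range (Module.finrank ℝ E + 1),
      (Lagrange.basis (Finset.range (Module.finrank ℝ E + 1)) v k).eval t *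
        (ContinuousLinearMap.id ℝ E + v k • A).det := by
  have key : ∀ τ : ℝ, (ContinuousLinearMap.id ℝ E + τ • A).det =
      (1 + τ • LinearMap.toMatrix (Module.finBasis ℝ E) (Module.finBasis ℝ E)
        (A : E →ₗ[ℝ] E)).det := by
    intro τ
    rw [ContinuousLinearMap.det, ← LinearMap.det_toMatrix (Module.finBasis ℝ E)]
    congr 1
    rw [ContinuousLinearMap.toLinearMap_add, ContinuousLinearMap.toLinearMap_smul, map_add, map_smul]
    congr 1
    exact LinearMap.toMatrix_id _
  simp only [key]
  exact det_one_add_smul_eq_sum _ v hv t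

theorem no_retraction {f : E → E}
    (hf : ∀ x ∈ Metric.closedBall (0 : E) 1, ContDiffAt ℝ 1 f x)
    (hid : ∀ x ∈ Metric.sphere (0 : E) 1, f x = x)
    (hnorm : ∀ x ∈ Metric.closedBall (0 : E) 1, ‖f x‖ = 1) : False := by
  let _ : MeasurableSpace E := borel E
  have _ : BorelSpace E := ⟨rfl⟩
  obtain ⟨G, K, hG, hK, hin, hout⟩ := exists_lipschitzWith_displacement hf hid
  set D := fun x => fderiv ℝ (fun x => f x - x) x with hD
  have hdet0 : ∀ x ∈ Metric.ball (0 : E) 1, (ContinuousLinearMap.id ℝ E + (1 : ℝ) • D x).det = 0 := by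
    intro x hx
    have hx' := Metric.ball_subset_closedBall hx
    have h1 : DifferentiableAt ℝ f x := (hf x hx').differentiableAt (by norm_num)
    have hDx : ContinuousLinearMap.id ℝ E + (1 : ℝ) • D x = fderiv ℝ f x := by
      have : D x = fderiv ℝ f x - ContinuousLinearMap.id ℝ E :=
        (h1.hasFDerivAt.sub (hasFDerivAt_id x)).fderiv
      rw [this]; simp
    rw [hDx]
    by_contra hne
    have hsq : HasFDerivAt (fun y => ‖f y‖ ^ 2) (0 : E →L[ℝ] ℝ) x := by
      refine (hasFDerivAt_const (1 : ℝ) x).congr_of_eventuallyEq ?_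
      filter_upwards [Metric.isOpen_ball.mem_nhds hx] with y hy
      rw [hnorm y (Metric.ball_subset_closedBall hy), one_pow]
    have hsq' := (h1.hasFDerivAt).norm_sq
    have heq := hsq.unique hsq'
    have hu : IsUnit (LinearMap.det (fderiv ℝ f x : E →ₗ[ℝ] E)) := (Ne.isUnit hne)
    have hsurj : Function.Surjective (fderiv ℝ f x) := by
      intro w
      obtain ⟨u, hu'⟩ := (LinearMap.equivOfIsUnitDet hu).surjective w
      exact ⟨u, by rwa [LinearMap.equivOfIsUnitDet_apply] at hu'⟩
    obtain ⟨w, hw⟩ := hsurj (f x)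
    have := congrArg (fun L : E →L[ℝ] ℝ => L w) heq
    simp [hw, hnorm x hx'] at this
  have h_int : ∀ t : ℝ, MeasureTheory.IntegrableOn
      (fun x => (ContinuousLinearMap.id ℝ E + t • D x).det) (Metric.closedBall (0 : E) 1) := by
    intro t
    refine ContinuousOn.integrableOn_compact (isCompact_closedBall _ _) fun x hx => ?_
    have h1 : ContinuousAt D x :=
      (((hf x hx).sub contDiffAt_id).fderiv_right (m := 0) (by norm_num)).continuousAt
    refine ContinuousAt.continuousWithinAt ?_
    exact ContinuousLinearMap.continuous_det.continuousAt.comp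
      (continuousAt_const.add (h1.const_smul t))
  set v : ℕ → ℝ := fun k => 1 / ((K + 1) * (k + 1)) with hv
  have hK1 : (0 : ℝ) < K + 1 := by positivity
  have hvinj : Function.Injective v := by
    intro a b hab
    simp only [hv, one_div, inv_inj, mul_eq_mul_left_iff, hK1.ne', or_false] at hab
    exact_mod_cast add_right_cancel hab
  have hvol : ∀ k, ∫ x in Metric.closedBall (0 : E) 1, (ContinuousLinearMap.id ℝ E + v k • D x).det
      = MeasureTheory.volume.real (Metric.closedBall (0 : E) 1) := by
    intro k
    refine integral_det_add_smul_eq hf hG hK hin hout (by positivity) ?_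
    simp only [hv]
    rw [one_div_mul_eq_div, div_lt_one (by positivity)]
    have : (0 : ℝ) ≤ k := by positivity
    have : (0 : ℝ) ≤ K := K.2
    nlinarith
  have hI0 : ∫ x in Metric.closedBall (0 : E) 1, (ContinuousLinearMap.id ℝ E + (1 : ℝ) • D x).det
      = 0 := by
    refine MeasureTheory.integral_eq_zero_of_ae ?_
    refine (MeasureTheory.ae_restrict_iff' measurableSet_closedBall).2 ?_
    have hs := MeasureTheory.Measure.addHaar_sphere_of_ne_zero
      (MeasureTheory.volume : MeasureTheory.Measure E) 0 one_ne_zero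
    filter_upwards [MeasureTheory.compl_mem_ae_iff.2 hs] with x hx hx'
    refine hdet0 x ?_
    rw [← Metric.ball_union_sphere] at hx'
    exact hx'.resolve_right hx
  have hI1 : ∫ x in Metric.closedBall (0 : E) 1, (ContinuousLinearMap.id ℝ E + (1 : ℝ) • D x).det
      = MeasureTheory.volume.real (Metric.closedBall (0 : E) 1) := by
    simp only [det_id_add_smul_eq_sum _ v hvinj 1]
    rw [MeasureTheory.integral_finsetSum _ (fun k _ => (h_int (v k)).const_mul _)]
    simp only [MeasureTheory.integral_const_mul, hvol]
    rw [← Finset.sum_mul, ← Polynomial.eval_finsetSum, Lagrange.sum_basis hvinj.injOn (by simp)]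
    simp
  have hpos : 0 < MeasureTheory.volume.real (Metric.closedBall (0 : E) 1) :=
    ENNReal.toReal_pos (Metric.measure_closedBall_pos _ _ one_pos).ne'
      MeasureTheory.measure_closedBall_lt_top.ne
  linarith

end NoRetraction

section Brouwer

variable {E : Type*} [NormedAddCommGroup E] [InnerProductSpace ℝ E] [FiniteDimensional ℝ E]

theorem brouwer_of_contDiff {T : E → E} (hT : ContDiff ℝ 1 T)
    (hm : Set.MapsTo T (Metric.closedBall 0 1) (Metric.closedBall 0 1)) :
    ∃ x ∈ Metric.closedBall (0 : E) 1, T x = x := by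
  by_contra! hne
  set u : E → E := fun x => x - T x with hu
  have huc : ContDiff ℝ 1 u := contDiff_id.sub hT
  set d : E → ℝ := fun x => inner ℝ x (u x) ^ 2 + ‖u x‖ ^ 2 * (1 - ‖x‖ ^ 2) with hd
  set l : E → ℝ := fun x => (-inner ℝ x (u x) + √(d x)) / ‖u x‖ ^ 2 with hl
  have hun : ∀ x ∈ Metric.closedBall (0 : E) 1, 0 < ‖u x‖ ^ 2 := fun x hx => by
    have : u x ≠ 0 := sub_ne_zero.2 (hne x hx).symm
    positivity
  have hxu : ∀ x ∈ Metric.closedBall (0 : E) 1, ‖x‖ = 1 → 0 < inner ℝ x (u x) := by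
    intro x hx h1
    have h2 := hun x hx
    have h3 : ‖T x‖ ≤ 1 := by simpa using hm hx
    have h4 : ‖T x‖ ^ 2 = ‖x - u x‖ ^ 2 := by simp [hu]
    rw [norm_sub_sq_real, h1] at h4
    nlinarith [norm_nonneg (T x)]
  have hdpos : ∀ x ∈ Metric.closedBall (0 : E) 1, 0 < d x := by
    intro x hx
    have hx1 : ‖x‖ ≤ 1 := by simpa using hx
    rcases hx1.lt_or_eq with h | h
    · have : 0 < 1 - ‖x‖ ^ 2 := by nlinarith [norm_nonneg x]
      have := mul_pos (hun x hx) this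
      simp only [hd]; positivity
    · have := hxu x hx h
      simp only [hd, h]; norm_num; positivity
  refine no_retraction (f := fun x => x + l x • u x) ?_ ?_ ?_
  · intro x hx
    have hnsq : ContDiff ℝ 1 fun x => ‖u x‖ ^ 2 := huc.norm_sq ℝ
    have hin : ContDiff ℝ 1 fun x => inner ℝ x (u x) := contDiff_id.inner ℝ huc
    have hdc : ContDiff ℝ 1 d :=
      (hin.pow 2).add (hnsq.mul (contDiff_const.sub (contDiff_id.norm_sq ℝ)))
    have hlc : ContDiffAt ℝ 1 l x :=
      (hin.contDiffAt.neg.add (hdc.contDiffAt.sqrt (hdpos x hx).ne')).div hnsq.contDiffAt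
        (hun x hx).ne'
    exact contDiffAt_id.add (hlc.smul huc.contDiffAt)
  · intro x hx
    have hx' := Metric.sphere_subset_closedBall hx
    have h1 : ‖x‖ = 1 := by simpa using hx
    have h2 := hxu x hx' h1
    have : l x = 0 := by
      simp only [hl, hd, h1]
      norm_num
      left
      rw [Real.sqrt_sq h2.le]; ring
    simp [this]
  · intro x hx
    have h1 := Real.sq_sqrt (hdpos x hx).le
    have h2 := hun x hx
    have h3 : l x * ‖u x‖ ^ 2 = -inner ℝ x (u x) + √(d x) := div_mul_cancel₀ _ h2.ne'
    have h4 : ‖x + l x • u x‖ ^ 2 = ‖x‖ ^ 2 + 2 * (l x * inner ℝ x (u x)) + l x ^ 2 * ‖u x‖ ^ 2 := by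
      rw [norm_add_sq_real, inner_smul_right, norm_smul, mul_pow, Real.norm_eq_abs, sq_abs]
    have h5 : ‖x + l x • u x‖ ^ 2 = 1 := by
      rw [h4]
      have h6 : (l x * ‖u x‖ ^ 2 + inner ℝ x (u x)) ^ 2 = d x := by
        rw [h3, show -inner ℝ x (u x) + √(d x) + inner ℝ x (u x) = √(d x) by ring, h1]
      have h7 : ‖u x‖ ^ 2 * (‖x‖ ^ 2 + 2 * (l x * inner ℝ x (u x)) + l x ^ 2 * ‖u x‖ ^ 2 - 1) = 0 := by
        have : d x = inner ℝ x (u x) ^ 2 + ‖u x‖ ^ 2 * (1 - ‖x‖ ^ 2) := rfl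
        rw [this] at h6
        linear_combination h6
      have := (mul_eq_zero.1 h7).resolve_left h2.ne'
      linarith
    exact (pow_eq_one_iff_of_nonneg (norm_nonneg _) two_ne_zero).1 h5

/-- **Brouwer's fixed point theorem** on the closed unit ball. -/
theorem brouwer_closedBall {T : E → E} (hT : ContinuousOn T (Metric.closedBall 0 1))
    (hm : Set.MapsTo T (Metric.closedBall 0 1) (Metric.closedBall 0 1)) :
    ∃ x ∈ Metric.closedBall (0 : E) 1, T x = x := by
  by_contra! hne
  have hc : ContinuousOn (fun x => ‖T x - x‖) (Metric.closedBall 0 1) :=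
    (hT.sub continuousOn_id).norm
  obtain ⟨x₀, hx₀, hmin⟩ := (isCompact_closedBall (0 : E) 1).exists_isMinOn ⟨0, by simp⟩ hc
  set δ := ‖T x₀ - x₀‖ with hδ
  have hδ0 : 0 < δ := norm_pos_iff.2 (sub_ne_zero.2 (hne x₀ hx₀))
  set ρ : E → E := fun x => (max 1 ‖x‖)⁻¹ • x with hρ
  have hρc : Continuous ρ := by
    refine Continuous.smul (Continuous.inv₀ (by fun_prop) fun x => ?_) continuous_id
    exact (lt_of_lt_of_le one_pos (le_max_left _ _)).ne'
  have hρm : ∀ x, ρ x ∈ Metric.closedBall (0 : E) 1 := by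
    intro x
    have h1 : 0 < max 1 ‖x‖ := lt_of_lt_of_le one_pos (le_max_left _ _)
    rw [mem_closedBall_zero_iff, hρ, norm_smul, norm_inv, Real.norm_eq_abs, abs_of_pos h1,
      inv_mul_le_one₀ h1]
    exact le_max_right _ _
  have hρi : ∀ x ∈ Metric.closedBall (0 : E) 1, ρ x = x := by
    intro x hx
    have : ‖x‖ ≤ 1 := by simpa using hx
    simp [hρ, max_eq_left this]
  have hTc : Continuous fun x => T (ρ x) := hT.comp_continuous hρc hρm
  obtain ⟨g, hg, hgd, -⟩ := hTc.exists_contDiff_approx (ε := fun _ => δ / 4) 1 continuous_const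
    (fun _ => by positivity)
  have hgn : ∀ x ∈ Metric.closedBall (0 : E) 1, ‖g x - T x‖ < δ / 4 := by
    intro x hx
    have := hgd x
    rwa [hρi x hx, dist_eq_norm] at this
  have hTn : ∀ x ∈ Metric.closedBall (0 : E) 1, ‖T x‖ ≤ 1 := fun x hx => by simpa using hm hx
  have hgb : ∀ x ∈ Metric.closedBall (0 : E) 1, ‖g x‖ ≤ 1 + δ / 4 := fun x hx => by
    have h1 := norm_sub_norm_le (g x) (T x)
    linarith [hgn x hx, hTn x hx]
  have hp : (0 : ℝ) < 1 + δ / 4 := by positivity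
  obtain ⟨x, hx, hfix⟩ := brouwer_of_contDiff (T := fun x => (1 + δ / 4)⁻¹ • g x)
    ((hg.of_le (by norm_num)).const_smul _) (fun x hx => by
      rw [mem_closedBall_zero_iff, norm_smul, norm_inv, Real.norm_eq_abs, abs_of_pos hp,
        inv_mul_le_one₀ hp]
      exact hgb x hx)
  have h1 : g x = (1 + δ / 4) • x := by
    have : g x = (1 + δ / 4) • ((1 + δ / 4)⁻¹ • g x) := by rw [smul_inv_smul₀ hp.ne']
    rw [this, hfix]
  have hxn : ‖x‖ ≤ 1 := by simpa using hx
  have h2 : T x - x = -(g x - T x) + (δ / 4) • x := by rw [h1]; module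
  have h3 : ‖T x - x‖ ≤ ‖g x - T x‖ + δ / 4 * ‖x‖ := by
    rw [h2]
    refine (norm_add_le _ _).trans ?_
    rw [norm_neg, norm_smul, Real.norm_eq_abs, abs_of_pos (by positivity : 0 < δ / 4)]
  have h4 : δ ≤ ‖T x - x‖ := hmin hx
  nlinarith [hgn x hx]

end Brouwer

theorem brouwer_stdSimplex {ι : Type*} [Fintype ι] [Nonempty ι] {T : (ι → ℝ) → ι → ℝ}
    (hT : ContinuousOn T (stdSimplex ℝ ι)) (hm : Set.MapsTo T (stdSimplex ℝ ι) (stdSimplex ℝ ι)) :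
    ∃ w ∈ stdSimplex ℝ ι, T w = w := by
  classical
  set r : (ι → ℝ) → ι → ℝ := fun x i =>
    max (x i) 0 / max (∑ j, max (x j) 0) 1 +
      (1 - (∑ j, max (x j) 0) / max (∑ j, max (x j) 0) 1) / Fintype.card ι with hr
  have hpos : ∀ x : ι → ℝ, 0 < max (∑ j, max (x j) 0) 1 := fun x =>
    lt_of_lt_of_le one_pos (le_max_right _ _)
  have hrc : Continuous r := by
    refine continuous_pi fun i => ?_
    simp only [hr]
    refine Continuous.add (Continuous.div (by fun_prop) (by fun_prop) fun x => (hpos x).ne') ?_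
    refine Continuous.div_const (Continuous.sub continuous_const ?_) _
    exact Continuous.div (by fun_prop) (by fun_prop) fun x => (hpos x).ne'
  have hcard : (0 : ℝ) < Fintype.card ι := by exact_mod_cast Fintype.card_pos
  have hrm : ∀ x, r x ∈ stdSimplex ℝ ι := by
    intro x
    refine ⟨fun i => ?_, ?_⟩
    · have h1 : (∑ j, max (x j) 0) / max (∑ j, max (x j) 0) 1 ≤ 1 :=
        (div_le_one (hpos x)).2 (le_max_left _ _)
      have h2 := hpos x
      have h3 : 0 ≤ max (x i) 0 := le_max_right _ _
      simp only [hr]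
      have h4 := sub_nonneg.2 h1
      positivity
    · simp only [hr, Finset.sum_add_distrib, ← Finset.sum_div, Finset.sum_const, Finset.card_univ,
        nsmul_eq_mul]
      field_simp
      ring
  have hri : ∀ x ∈ stdSimplex ℝ ι, r x = x := by
    intro x hx
    have h1 : ∀ i, max (x i) 0 = x i := fun i => max_eq_left (hx.1 i)
    ext i
    simp [hr, h1, hx.2]
  set e := (EuclideanSpace.equiv ι ℝ) with he
  obtain ⟨x, hx, hfix⟩ := brouwer_closedBall (E := EuclideanSpace ℝ ι)
    (T := fun x => e.symm (T (r (e x)))) (by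
      refine Continuous.continuousOn ?_
      exact e.symm.continuous.comp (hT.comp_continuous (hrc.comp e.continuous) fun x => hrm _))
    (by
      intro x _
      have h := hm (hrm (e x))
      rw [mem_closedBall_zero_iff, EuclideanSpace.norm_eq, Real.sqrt_le_one, ← h.2]
      refine Finset.sum_le_sum fun i _ => ?_
      have h1 : (e.symm (T (r (e x)))) i = T (r (e x)) i := rfl
      rw [h1, Real.norm_eq_abs, sq_abs]
      have h2 := h.1 i
      have h3 : T (r (e x)) i ≤ 1 := by
        rw [← h.2]
        exact Finset.single_le_sum (f := T (r (e x))) (fun j _ => h.1 j) (Finset.mem_univ i)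
      nlinarith)
  have h1 : T (r (e x)) = e x := by
    have := congrArg e hfix
    simpa only [ContinuousLinearEquiv.apply_symm_apply] using this
  have h2 : e x ∈ stdSimplex ℝ ι := h1 ▸ hm (hrm _)
  exact ⟨e x, h2, by rw [← hri _ h2, h1, hri _ h2]⟩

/-- **Schauder's fixed point theorem.** -/
theorem schauder {E : Type*} [NormedAddCommGroup E] [NormedSpace ℝ E] {K : Set E}
    (hK : IsCompact K) (hconv : Convex ℝ K) (hne : K.Nonempty) {T : E → E}
    (hT : ContinuousOn T K) (hm : Set.MapsTo T K K) : ∃ x ∈ K, T x = x := by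
  classical
  by_contra! hfix
  have hc : ContinuousOn (fun x => ‖T x - x‖) K := (hT.sub continuousOn_id).norm
  obtain ⟨x₀, hx₀, hmin⟩ := hK.exists_isMinOn hne hc
  set δ := ‖T x₀ - x₀‖ with hδ
  have hδ0 : 0 < δ := norm_pos_iff.2 (sub_ne_zero.2 (hfix x₀ hx₀))
  obtain ⟨t, htK, htfin, hcov⟩ := hK.finite_cover_balls hδ0
  have := htfin.fintype
  have hcov' : ∀ z ∈ K, ∃ y : t, ‖z - y‖ < δ := by
    intro z hz
    obtain ⟨y, hy, hzy⟩ := Set.mem_iUnion₂.1 (hcov hz)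
    exact ⟨⟨y, hy⟩, by simpa [dist_eq_norm] using hzy⟩
  have : Nonempty t := ⟨(hcov' _ hne.some_mem).choose⟩
  set p : E → t → ℝ := fun z y => max (δ - ‖z - y‖) 0 with hp
  have hp0 : ∀ z y, 0 ≤ p z y := fun z y => le_max_right _ _
  have hS : ∀ z ∈ K, 0 < ∑ y, p z y := by
    intro z hz
    obtain ⟨y, hy⟩ := hcov' z hz
    refine Finset.sum_pos' (fun y _ => hp0 z y) ⟨y, Finset.mem_univ _, ?_⟩
    exact lt_max_of_lt_left (by linarith)
  set P : E → t → ℝ := fun z y => p z y / ∑ y', p z y' with hP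
  have hPm : ∀ z ∈ K, P z ∈ stdSimplex ℝ t := fun z hz =>
    ⟨fun y => div_nonneg (hp0 z y) (hS z hz).le, by
      simp only [hP, ← Finset.sum_div]; exact div_self (hS z hz).ne'⟩
  have hPc : ContinuousOn P K := by
    refine continuousOn_pi.2 fun y => ContinuousOn.div ?_ ?_ fun z hz => (hS z hz).ne'
    · simp only [hp]; fun_prop
    · simp only [hp]; fun_prop
  set ψ : (t → ℝ) → E := fun w => ∑ y, w y • (y : E) with hψ
  have hψc : Continuous ψ := by simp only [hψ]; fun_prop
  have hψm : Set.MapsTo ψ (stdSimplex ℝ t) K := fun w hw =>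
    hconv.sum_mem (fun y _ => hw.1 y) hw.2 (fun y _ => htK y.2)
  obtain ⟨w, hw, hwfix⟩ := brouwer_stdSimplex (T := fun w => P (T (ψ w)))
    (hPc.comp (hT.comp hψc.continuousOn hψm) (hm.comp hψm))
    (fun w hw => hPm _ (hm (hψm hw)))
  set x := ψ w with hx
  have hxK : x ∈ K := hψm hw
  have hPx := hPm _ (hm hxK)
  have hψx : ψ (P (T x)) = x := by rw [hx]; exact congrArg ψ hwfix
  have hlt : ‖T x - x‖ < δ := by
    have h1 : T x - x = ∑ y, P (T x) y • (T x - (y : E)) := by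
      simp only [smul_sub, Finset.sum_sub_distrib, ← Finset.sum_smul, hPx.2, one_smul]
      congr 1
      exact hψx.symm
    rw [h1]
    refine (norm_sum_le _ _).trans_lt ?_
    have h2 : δ = ∑ y, P (T x) y * δ := by rw [← Finset.sum_mul, hPx.2, one_mul]
    rw [h2]
    have h3 : ∀ y : t, ‖P (T x) y • (T x - (y : E))‖ ≤ P (T x) y * δ ∧
        (0 < P (T x) y → ‖P (T x) y • (T x - (y : E))‖ < P (T x) y * δ) := by
      intro y
      rw [norm_smul, Real.norm_eq_abs, abs_of_nonneg (hPx.1 y)]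
      have h4 : 0 < P (T x) y → P (T x) y * ‖T x - y‖ < P (T x) y * δ := by
        intro h
        refine mul_lt_mul_of_pos_left ?_ h
        by_contra! hge
        have : p (T x) y = 0 := max_eq_right (by linarith)
        simp [hP, this] at h
      refine ⟨?_, h4⟩
      rcases (hPx.1 y).lt_or_eq with h | h
      · exact (h4 h).le
      · simp [← h]
    obtain ⟨y, hy⟩ : ∃ y, 0 < P (T x) y := by
      by_contra! hall
      have := Finset.sum_nonpos (fun y (_ : y ∈ Finset.univ) => hall y)
      rw [hPx.2] at this
      linarith
    exact Finset.sum_lt_sum (fun y _ => (h3 y).1) ⟨y, Finset.mem_univ _, (h3 y).2 hy⟩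
  exact absurd (hmin hxK) (not_le.2 hlt)

/-- The Loewner kernel of a function `g` with (generalized) derivative `v`. -/
noncomputable def loewner (g v : ℝ → ℝ) (x y : ℝ) : ℝ :=
  if x = y then v x else (g x - g y) / (x - y)

/-- All Loewner matrices of order three of `g` with nodes in `S` are positive semidefinite. -/
def PickOn (S : Set ℝ) (g v : ℝ → ℝ) : Prop :=
  ∀ x c : Fin 3 → ℝ, (∀ i, x i ∈ S) → 0 ≤ ∑ i, ∑ j, c i * c j * loewner g v (x i) (x j)

lemma loewner_comm (g v : ℝ → ℝ) (x y : ℝ) : loewner g v x y = loewner g v y x := by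
  unfold loewner
  by_cases h : x = y
  · simp [h]
  · rw [if_neg h, if_neg (Ne.symm h), ← neg_sub (g y), ← neg_sub y, neg_div_neg_eq]

namespace PickOn

variable {S T : Set ℝ} {g v h w : ℝ → ℝ}

lemma posSemidef (hg : PickOn S g v) {x : Fin 3 → ℝ} (hx : ∀ i, x i ∈ S) :
    (Matrix.of fun i j => loewner g v (x i) (x j)).PosSemidef := by
  refine Matrix.PosSemidef.of_dotProduct_mulVec_nonneg ?_ fun c => ?_
  · ext i j
    simp [loewner_comm g v (x i)]
  · refine (hg x c hx).trans_eq ?_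
    simp only [dotProduct, Matrix.mulVec, Finset.mul_sum, Matrix.of_apply, star_trivial]
    exact Finset.sum_congr rfl fun i _ => Finset.sum_congr rfl fun j _ => by ring

lemma of_posSemidef (H : ∀ x : Fin 3 → ℝ, (∀ i, x i ∈ S) →
    (Matrix.of fun i j => loewner g v (x i) (x j)).PosSemidef) : PickOn S g v := by
  intro x c hx
  refine ((H x hx).dotProduct_mulVec_nonneg c).trans_eq ?_
  simp only [dotProduct, Matrix.mulVec, Finset.mul_sum, Matrix.of_apply, star_trivial]
  exact Finset.sum_congr rfl fun i _ => Finset.sum_congr rfl fun j _ => by ring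

lemma mono (hg : PickOn S g v) (hT : T ⊆ S) : PickOn T g v :=
  fun x c hx => hg x c fun i => hT (hx i)

lemma congr (hg : PickOn S g v) (h1 : Set.EqOn h g S) (h2 : Set.EqOn w v S) : PickOn S h w := by
  intro x c hx
  refine (hg x c hx).trans_eq ?_
  refine Finset.sum_congr rfl fun i _ => Finset.sum_congr rfl fun j _ => ?_
  simp only [loewner, h1 (hx i), h1 (hx j), h2 (hx i)]

lemma comp (hh : PickOn T h w) (hg : PickOn S g v) (hm : Set.MapsTo g S T) :
    PickOn S (fun x => h (g x)) (fun x => w (g x) * v x) := by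
  refine of_posSemidef fun x hx => ?_
  have h1 := (hh.posSemidef (fun i => hm (hx i))).hadamard (hg.posSemidef hx)
  have h2 : (Matrix.of fun i j => loewner (fun x => h (g x)) (fun x => w (g x) * v x) (x i) (x j)) =
    (Matrix.of fun i j => loewner h w (g (x i)) (g (x j))).hadamard
      (Matrix.of fun i j => loewner g v (x i) (x j)) := ?_
  · rw [h2]; exact h1
  ext i j
  simp only [Matrix.hadamard, Matrix.of_apply, loewner]
  by_cases e : x i = x j
  · simp [e]
  · rw [if_neg e, if_neg e]
    by_cases e' : g (x i) = g (x j)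
    · simp [e']
    · rw [if_neg e', div_mul_div_cancel₀ (sub_ne_zero.2 e')]

lemma affine (hg : PickOn S g v) {a c : ℝ} (b d : ℝ) (hca : 0 ≤ c * a) :
    PickOn {x | a * x + b ∈ S} (fun x => c * g (a * x + b) + d)
      (fun x => c * a * v (a * x + b)) := by
  intro x e hx
  have h1 := mul_nonneg hca (hg (fun i => a * x i + b) e hx)
  refine h1.trans_eq ?_
  rw [Finset.mul_sum]
  refine Finset.sum_congr rfl fun i _ => ?_
  rw [Finset.mul_sum]
  refine Finset.sum_congr rfl fun j _ => ?_
  have : c * a * loewner g v (a * x i + b) (a * x j + b) =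
      loewner (fun x => c * g (a * x + b) + d) (fun x => c * a * v (a * x + b)) (x i) (x j) := by
    unfold loewner
    by_cases e : x i = x j
    · simp [e]
    · rw [if_neg e]
      rcases eq_or_ne a 0 with rfl | ha
      · simp
      · have e' : a * x i + b ≠ a * x j + b := fun h => e (mul_left_cancel₀ ha (add_right_cancel h))
        rw [if_neg e']
        have e1 := sub_ne_zero.2 e
        have e2 : a * x i + b - (a * x j + b) ≠ 0 := sub_ne_zero.2 e'
        have e3 : a * x i + b - (a * x j + b) = a * (x i - x j) := by ring
        rw [e3]
        field_simp
        ring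
  rw [← this]; ring

lemma add (hg : PickOn S g v) (hh : PickOn S h w) :
    PickOn S (fun x => g x + h x) (fun x => v x + w x) := by
  intro x c hx
  refine (add_nonneg (hg x c hx) (hh x c hx)).trans_eq ?_
  simp only [← Finset.sum_add_distrib]
  refine Finset.sum_congr rfl fun i _ => Finset.sum_congr rfl fun j _ => ?_
  unfold loewner
  split_ifs <;> ring

lemma id (S : Set ℝ) : PickOn S (fun x => x) (fun _ => 1) := by
  intro x c _
  have : ∀ i j, loewner (fun x => x) (fun _ => 1) (x i) (x j) = 1 := by
    intro i j
    unfold loewner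
    split_ifs with h
    · rfl
    · exact div_self (sub_ne_zero.2 h)
  simp only [this, mul_one, ← Finset.mul_sum, ← Finset.sum_mul]
  exact mul_self_nonneg _

lemma of_tendsto {ι : Type*} {l : Filter ι} [l.NeBot] {G V : ι → ℝ → ℝ}
    (H : ∀ᶠ n in l, PickOn S (G n) (V n))
    (hG : ∀ x ∈ S, Filter.Tendsto (fun n => G n x) l (nhds (g x)))
    (hV : ∀ x ∈ S, Filter.Tendsto (fun n => V n x) l (nhds (v x))) : PickOn S g v := by
  intro x c hx
  refine ge_of_tendsto ?_ (H.mono fun n hn => hn x c hx)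
  refine tendsto_finsetSum _ fun i _ => tendsto_finsetSum _ fun j _ => ?_
  refine Filter.Tendsto.const_mul _ ?_
  unfold loewner
  by_cases e : x i = x j
  · simp only [if_pos e]; exact hV _ (hx i)
  · simp only [if_neg e]; exact ((hG _ (hx i)).sub (hG _ (hx j))).div_const _

lemma nonneg (hg : PickOn S g v) {x : ℝ} (hx : x ∈ S) : 0 ≤ v x := by
  have := hg ![x, x, x] ![1, 0, 0] (by intro i; fin_cases i <;> exact hx)
  simpa [Fin.sum_univ_three, loewner] using this

lemma sq_slope_le (hg : PickOn S g v) {x y : ℝ} (hx : x ∈ S) (hy : y ∈ S) (hxy : x ≠ y) :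
    ((g x - g y) / (x - y)) ^ 2 ≤ v x * v y := by
  set q := (g x - g y) / (x - y) with hq
  have key : ∀ a b : ℝ, 0 ≤ a ^ 2 * v x + 2 * a * b * q + b ^ 2 * v y := by
    intro a b
    have h1 := hg ![x, y, y] ![a, b, 0] (by intro i; fin_cases i <;> first | exact hx | exact hy)
    refine h1.trans_eq ?_
    have h2 : loewner g v x y = q := if_neg hxy
    have h3 : loewner g v y x = q := by rw [loewner_comm, h2]
    have h4 : ∀ z, loewner g v z z = v z := fun z => if_pos rfl
    simp [Fin.sum_univ_three, h2, h3, h4]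
    ring
  have hx0 := hg.nonneg hx
  have hy0 := hg.nonneg hy
  rcases hx0.lt_or_eq with h | h
  · have := key q (-v x)
    nlinarith
  · rcases eq_or_ne q 0 with h0 | h0
    · rw [h0, ← h]; simp
    · have h1 := key (-(v y + 1) / q) 1
      rw [← h] at h1
      have h2 : 2 * (-(v y + 1) / q) * 1 * q = -2 * (v y + 1) := by field_simp
      nlinarith

/-- Comparison of an increment with the geometric mean of the derivatives. -/
lemma sub_le_mul_sqrt (hg : PickOn S g v) {x y : ℝ} (hx : x ∈ S) (hy : y ∈ S) (hxy : x < y) :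
    g y - g x ≤ (y - x) * √(v x * v y) := by
  have h := hg.sq_slope_le hy hx hxy.ne'
  have h2 := Real.abs_le_sqrt h
  have h3 := (le_abs_self _).trans h2
  rw [div_le_iff₀ (sub_pos.2 hxy), mul_comm (v y)] at h3
  linarith

lemma simpson (hg : PickOn S g v) {z t : ℝ} (ht : 0 < t) (h1 : z + t ∈ S) (h2 : z ∈ S)
    (h3 : z - t ∈ S) : 3 * (g (z + t) - g (z - t)) / t ≤ v (z + t) + 4 * v z + v (z - t) := by
  have h := hg ![z + t, z, z - t] ![1, -2, 1]
    (by intro i; fin_cases i <;> first | exact h1 | exact h2 | exact h3)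
  have e1 : loewner g v (z + t) z = (g (z + t) - g z) / t := by
    rw [loewner, if_neg (by linarith)]; congr 1; ring
  have e2 : loewner g v z (z - t) = (g z - g (z - t)) / t := by
    rw [loewner, if_neg (by linarith)]; congr 1; ring
  have e3 : loewner g v (z + t) (z - t) = (g (z + t) - g (z - t)) / (2 * t) := by
    rw [loewner, if_neg (by linarith)]; congr 1; ring
  have h4 : ∀ z, loewner g v z z = v z := fun z => if_pos rfl
  simp only [Fin.sum_univ_three, Matrix.cons_val_zero, Matrix.cons_val_one, Matrix.cons_val,
    loewner_comm g v z (z + t), loewner_comm g v (z - t), e1, e2, e3, h4] at h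
  rw [div_le_iff₀ ht]
  field_simp at h
  linarith

end PickOn

lemma rpow_slope_eq {p : ℝ} (hp : p ∈ Set.Ioo (0 : ℝ) 1) {x y : ℝ} (hx : 0 < x) (hy : 0 < y)
    (hxy : x ≠ y) :
    MeasureTheory.IntegrableOn (fun t : ℝ => t ^ p / ((t + x) * (t + y))) (Set.Ioi 0) ∧
    (x ^ p - y ^ p) / (x - y) = (∫ t in Set.Ioi 0, Real.rpowIntegrand₀₁ p t 1)⁻¹ *
      ∫ t in Set.Ioi 0, t ^ p / ((t + x) * (t + y)) := by
  have e : Set.EqOn (fun t => (Real.rpowIntegrand₀₁ p t x - Real.rpowIntegrand₀₁ p t y) / (x - y))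
      (fun t : ℝ => t ^ p / ((t + x) * (t + y))) (Set.Ioi 0) := by
    intro t ht
    have ht' : (0 : ℝ) < t := ht
    have h1 : t + x ≠ 0 := by positivity
    have h2 : t + y ≠ 0 := by positivity
    have h3 := sub_ne_zero.2 hxy
    simp only [Real.rpowIntegrand₀₁]
    field_simp
    ring
  have ix := Real.integrableOn_rpowIntegrand₀₁_Ioi hp hx.le
  have iy := Real.integrableOn_rpowIntegrand₀₁_Ioi hp hy.le
  have hi : MeasureTheory.IntegrableOn (fun t =>
      (Real.rpowIntegrand₀₁ p t x - Real.rpowIntegrand₀₁ p t y) / (x - y)) (Set.Ioi 0) :=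
    (ix.sub iy).div_const _
  refine ⟨hi.congr_fun e measurableSet_Ioi, ?_⟩
  rw [← MeasureTheory.setIntegral_congr_fun measurableSet_Ioi e, MeasureTheory.integral_div,
    MeasureTheory.integral_sub ix iy, Real.rpow_eq_const_mul_integral hp hx.le,
    Real.rpow_eq_const_mul_integral hp hy.le]
  ring

lemma rpow_deriv_eq {p : ℝ} (hp : p ∈ Set.Ioo (0 : ℝ) 1) {x : ℝ} (hx : 0 < x) :
    MeasureTheory.IntegrableOn (fun t : ℝ => t ^ p / ((t + x) * (t + x))) (Set.Ioi 0) ∧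
    p * x ^ (p - 1) = (∫ t in Set.Ioi 0, Real.rpowIntegrand₀₁ p t 1)⁻¹ *
      ∫ t in Set.Ioi 0, t ^ p / ((t + x) * (t + x)) := by
  have hC := inv_pos.2 (Real.integral_rpowIntegrand₀₁_one_pos hp)
  have hle : ∀ y z : ℝ, 0 < y → y ≤ z → ∀ t ∈ Set.Ioi (0 : ℝ),
      t ^ p / ((t + x) * (t + z)) ≤ t ^ p / ((t + x) * (t + y)) := by
    intro y z hy hyz t ht
    have ht' : (0 : ℝ) < t := ht
    gcongr
  have h_int : MeasureTheory.IntegrableOn (fun t : ℝ => t ^ p / ((t + x) * (t + x))) (Set.Ioi 0) := by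
    refine (rpow_slope_eq hp hx (half_pos hx) (by linarith)).1.mono' ?_ ?_
    · refine ContinuousOn.aestronglyMeasurable ?_ measurableSet_Ioi
      refine ContinuousOn.div (fun t ht => ?_) (by fun_prop) fun t ht => ?_
      · exact (Real.continuousAt_rpow_const _ _ (Or.inr hp.1.le)).continuousWithinAt
      · have ht' : (0 : ℝ) < t := ht
        positivity
    · refine (MeasureTheory.ae_restrict_iff' measurableSet_Ioi).2 (Filter.Eventually.of_forall ?_)
      intro t ht
      have ht' : (0 : ℝ) < t := ht
      rw [Real.norm_eq_abs, abs_of_nonneg (by positivity)]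
      exact hle _ _ (half_pos hx) (by linarith) t ht
  refine ⟨h_int, ?_⟩
  have hder := (Real.hasDerivAt_rpow_const (x := x) (p := p) (Or.inl hx.ne'))
  have ht := hasDerivAt_iff_tendsto_slope.1 hder
  apply le_antisymm
  · refine le_of_tendsto (ht.mono_left (nhdsWithin_mono x (fun y (hy : y ∈ Set.Ioi x) => ne_of_gt hy))) ?_
    filter_upwards [self_mem_nhdsWithin] with y hy
    have hy' : x < y := hy
    obtain ⟨i1, i2⟩ := rpow_slope_eq hp hx (hx.trans hy') hy'.ne
    have i3 : slope (fun x : ℝ => x ^ p) x y = (x ^ p - y ^ p) / (x - y) := by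
      rw [slope_def_field, ← neg_sub (x ^ p), ← neg_sub x, neg_div_neg_eq]
    rw [i3, i2]
    exact mul_le_mul_of_nonneg_left (MeasureTheory.setIntegral_mono_on i1 h_int measurableSet_Ioi
      (hle _ _ hx hy'.le)) hC.le
  · refine ge_of_tendsto (ht.mono_left (nhdsWithin_mono x (fun y (hy : y ∈ Set.Iio x) => ne_of_lt hy))) ?_
    filter_upwards [self_mem_nhdsWithin, mem_nhdsWithin_of_mem_nhds (Ioi_mem_nhds hx)] with y hy hy0
    have hy' : y < x := hy
    obtain ⟨i1, i2⟩ := rpow_slope_eq hp hx hy0 hy'.ne'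
    have i3 : slope (fun x : ℝ => x ^ p) x y = (x ^ p - y ^ p) / (x - y) := by
      rw [slope_def_field, ← neg_sub (x ^ p), ← neg_sub x, neg_div_neg_eq]
    rw [i3, i2]
    exact mul_le_mul_of_nonneg_left (MeasureTheory.setIntegral_mono_on h_int i1 measurableSet_Ioi
      (hle _ _ hy0 hy'.le)) hC.le

/-- Loewner's theorem for fractional powers. -/
lemma pickOn_rpow {p : ℝ} (hp : p ∈ Set.Ioo (0 : ℝ) 1) :
    PickOn (Set.Ioi 0) (fun x => x ^ p) (fun x => p * x ^ (p - 1)) := by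
  intro x c hx
  have hC := inv_pos.2 (Real.integral_rpowIntegrand₀₁_one_pos hp)
  have key : ∀ i j, MeasureTheory.IntegrableOn
      (fun t : ℝ => t ^ p / ((t + x i) * (t + x j))) (Set.Ioi 0) ∧
      loewner (fun x => x ^ p) (fun x => p * x ^ (p - 1)) (x i) (x j) =
      (∫ t in Set.Ioi 0, Real.rpowIntegrand₀₁ p t 1)⁻¹ *
      ∫ t in Set.Ioi 0, t ^ p / ((t + x i) * (t + x j)) := by
    intro i j
    unfold loewner
    split_ifs with e
    · rw [← e]; exact rpow_deriv_eq hp (hx i)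
    · exact rpow_slope_eq hp (hx i) (hx j) e
  have h1 : ∑ i, ∑ j, c i * c j *
      loewner (fun x => x ^ p) (fun x => p * x ^ (p - 1)) (x i) (x j) =
      (∫ t in Set.Ioi 0, Real.rpowIntegrand₀₁ p t 1)⁻¹ *
      ∫ t in Set.Ioi 0, ∑ i, ∑ j, c i * c j * (t ^ p / ((t + x i) * (t + x j))) := by
    rw [MeasureTheory.integral_finsetSum _ fun i _ => MeasureTheory.integrable_finsetSum _
      fun j _ => (key i j).1.const_mul _, Finset.mul_sum]
    refine Finset.sum_congr rfl fun i _ => ?_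
    rw [MeasureTheory.integral_finsetSum _ fun j _ => (key i j).1.const_mul _, Finset.mul_sum]
    refine Finset.sum_congr rfl fun j _ => ?_
    rw [(key i j).2, MeasureTheory.integral_const_mul]
    ring
  rw [h1]
  refine mul_nonneg hC.le (MeasureTheory.setIntegral_nonneg measurableSet_Ioi fun t ht => ?_)
  have ht' : (0 : ℝ) < t := ht
  have h2 : ∑ i, ∑ j, c i * c j * (t ^ p / ((t + x i) * (t + x j))) =
      t ^ p * ((∑ i, c i / (t + x i)) * (∑ i, c i / (t + x i))) := by
    rw [Finset.sum_mul_sum, Finset.mul_sum]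
    refine Finset.sum_congr rfl fun i _ => ?_
    rw [Finset.mul_sum]
    refine Finset.sum_congr rfl fun j _ => ?_
    rw [div_mul_div_comm]; ring
  rw [h2]
  exact mul_nonneg (by positivity) (mul_self_nonneg _)

lemma integral_inv_sq_affine {x y p q : ℝ} (hxy : x ≤ y) (hpos : ∀ t ∈ Set.Icc x y, 0 < p + q * t) :
    ∫ t in x..y, ((p + q * t) ^ 2)⁻¹ = (y - x) * ((p + q * x)⁻¹ * (p + q * y)⁻¹) := by
  have hx := hpos x ⟨le_rfl, hxy⟩
  have hder : ∀ t ∈ Set.uIcc x y, HasDerivAt (fun t => (t - x) / ((p + q * x) * (p + q * t)))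
      (((p + q * t) ^ 2)⁻¹) t := by
    intro t ht
    rw [Set.uIcc_of_le hxy] at ht
    have h := hpos t ht
    have h1 : HasDerivAt (fun t => (p + q * x) * (p + q * t)) ((p + q * x) * q) t := by
      simpa using (((hasDerivAt_id t).const_mul q).const_add p).const_mul (p + q * x)
    have h2 := ((hasDerivAt_id t).sub_const x).div h1 (by positivity)
    refine h2.congr_deriv ?_
    rw [id_eq, inv_eq_one_div, div_eq_div_iff (by positivity) (by positivity)]
    ring
  have hc : ContinuousOn (fun t => ((p + q * t) ^ 2)⁻¹) (Set.uIcc x y) := by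
    rw [Set.uIcc_of_le hxy]
    exact ContinuousOn.inv₀ (by fun_prop) fun t ht => by have := hpos t ht; positivity
  rw [intervalIntegral.integral_eq_sub_of_hasDerivAt hder hc.intervalIntegrable]
  have hy := hpos y ⟨hxy, le_rfl⟩
  rw [sub_self, zero_div, sub_zero, div_eq_mul_inv, mul_inv]

lemma concaveOn_inv_sqrt {a b : ℝ} {v : ℝ → ℝ} (hv : ContinuousOn v (Set.Icc a b))
    (hpos : ∀ x ∈ Set.Icc a b, 0 < v x)
    (H : ∀ x ∈ Set.Icc a b, ∀ y ∈ Set.Icc a b, x < y →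
      ∫ t in x..y, v t ≤ (y - x) * √(v x * v y)) :
    ConcaveOn ℝ (Set.Icc a b) fun x => (√(v x))⁻¹ := by
  set u : ℝ → ℝ := fun x => (√(v x))⁻¹ with hu
  have hup : ∀ x ∈ Set.Icc a b, 0 < u x := fun x hx => by
    have := Real.sqrt_pos.2 (hpos x hx); positivity
  have hvu : ∀ x ∈ Set.Icc a b, v x = (u x ^ 2)⁻¹ := fun x hx => by
    simp only [hu, inv_pow, inv_inv, Real.sq_sqrt (hpos x hx).le]
  have huc : ContinuousOn u (Set.Icc a b) :=
    hv.sqrt.inv₀ fun x hx => (Real.sqrt_pos.2 (hpos x hx)).ne'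
  refine LinearOrder.concaveOn_of_lt (convex_Icc a b) ?_
  intro x hx y hy hxy r s hr hs hrs
  by_contra! hlt
  simp only [smul_eq_mul] at hlt
  set z := r * x + s * y with hz
  have hyx : 0 < y - x := sub_pos.2 hxy
  set q := (u y - u x) / (y - x) with hq
  set p := u x - q * x with hp
  have hlx : p + q * x = u x := by rw [hp]; ring
  have hly : p + q * y = u y := by rw [hp, hq]; field_simp; ring
  have hlz : p + q * z = r * u x + s * u y := by
    rw [← hlx, ← hly, hz]; linear_combination (- p) * hrs
  have hsub : Set.Icc x y ⊆ Set.Icc a b := Set.Icc_subset_Icc hx.1 hy.2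
  have hxz : x < z := by
    have : z - x = s * (y - x) := by rw [hz]; linear_combination x * hrs
    have := mul_pos hs hyx
    linarith
  have hzy : z < y := by
    have : y - z = r * (y - x) := by rw [hz]; linear_combination -y * hrs
    have := mul_pos hr hyx
    linarith
  set h : ℝ → ℝ := fun t => u t - (p + q * t) with hh
  have hhc : ContinuousOn h (Set.Icc x y) := (huc.mono hsub).sub (by fun_prop)
  have hhz : h z < 0 := by simp only [hh, hlz]; linarith
  have hclosed1 : IsCompact (Set.Icc x z ∩ h ⁻¹' Set.Ici 0) :=
    isCompact_Icc.of_isClosed_subset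
      ((hhc.mono (Set.Icc_subset_Icc_right hzy.le)).preimage_isClosed_of_isClosed isClosed_Icc
        isClosed_Ici) Set.inter_subset_left
  have hclosed2 : IsCompact (Set.Icc z y ∩ h ⁻¹' Set.Ici 0) :=
    isCompact_Icc.of_isClosed_subset
      ((hhc.mono (Set.Icc_subset_Icc_left hxz.le)).preimage_isClosed_of_isClosed isClosed_Icc
        isClosed_Ici) Set.inter_subset_left
  obtain ⟨x', ⟨hx'1, hx'2⟩, hx'm⟩ := hclosed1.exists_isGreatest
    ⟨x, ⟨le_rfl, hxz.le⟩, by simp [hh, hlx]⟩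
  obtain ⟨y', ⟨hy'1, hy'2⟩, hy'm⟩ := hclosed2.exists_isLeast
    ⟨y, ⟨hzy.le, le_rfl⟩, by simp [hh, hly]⟩
  have hx'z : x' < z := lt_of_le_of_ne hx'1.2 fun e => by
    rw [e] at hx'2; exact absurd hx'2 (not_le.2 hhz)
  have hzy' : z < y' := lt_of_le_of_ne hy'1.1 fun e => by
    rw [← e] at hy'2; exact absurd hy'2 (not_le.2 hhz)
  have hneg : ∀ t ∈ Set.Ioo x' y', h t < 0 := by
    intro t ht
    by_contra! hge
    rcases le_total t z with h1 | h1
    · exact absurd (hx'm ⟨⟨hx'1.1.trans ht.1.le, h1⟩, hge⟩) (not_le.2 ht.1)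
    · exact absurd (hy'm ⟨⟨h1, ht.2.le.trans hy'1.2⟩, hge⟩) (not_le.2 ht.2)
  have hsub' : Set.Icc x' y' ⊆ Set.Icc x y := Set.Icc_subset_Icc hx'1.1 hy'1.2
  have hlpos : ∀ t ∈ Set.Icc x y, 0 < p + q * t := by
    intro t ht
    have h1 := hup x hx
    have h2 := hup y hy
    have h3 : (y - x) * (p + q * t) = (y - t) * u x + (t - x) * u y := by
      rw [← hlx, ← hly]; ring
    have h4 : 0 < (y - t) * u x + (t - x) * u y := by
      rcases ht.1.lt_or_eq with e | e
      · have := mul_pos (sub_pos.2 e) h2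
        have := mul_nonneg (sub_nonneg.2 ht.2) h1.le
        linarith
      · rw [← e]; have := mul_pos hyx h1; simpa using this
    rw [← h3] at h4
    exact pos_of_mul_pos_right h4 hyx.le
  have hxy' : x' < y' := hx'z.trans hzy'
  have hx'I : x' ∈ Set.Icc x' y' := ⟨le_rfl, hxy'.le⟩
  have hy'I : y' ∈ Set.Icc x' y' := ⟨hxy'.le, le_rfl⟩
  have hI := integral_inv_sq_affine hxy'.le fun t ht => hlpos t (hsub' ht)
  have hstrict : ∫ t in x'..y', ((p + q * t) ^ 2)⁻¹ < ∫ t in x'..y', v t := by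
    have hzz : z ∈ Set.Ioo x' y' := ⟨hx'z, hzy'⟩
    have hstr : ∀ t ∈ Set.Ioo x' y', ((p + q * t) ^ 2)⁻¹ < v t := by
      intro t ht
      have ht' := hsub' (Set.Ioo_subset_Icc_self ht)
      have h1 := hneg t ht
      simp only [hh] at h1
      have h2 := hup t (hsub ht')
      rw [hvu t (hsub ht')]
      have h3 : u t < p + q * t := by linarith
      gcongr
    have hcl : ContinuousOn (fun t => ((p + q * t) ^ 2)⁻¹) (Set.Icc x' y') :=
      ContinuousOn.inv₀ (by fun_prop) fun t ht => by have := hlpos t (hsub' ht); positivity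
    refine intervalIntegral.integral_lt_integral_of_continuousOn_of_le_of_exists_lt hxy' hcl
      (hv.mono (hsub'.trans hsub)) ?_ ⟨z, Set.Ioo_subset_Icc_self hzz, hstr z hzz⟩
    have hcv := hv.mono (hsub'.trans hsub)
    intro t ht
    have ht' : t ∈ Set.Icc x' y' := Set.Ioc_subset_Icc_self ht
    refine ContinuousWithinAt.closure_le (by rwa [closure_Ioo hxy'.ne])
      ((hcl t ht').mono Set.Ioo_subset_Icc_self) ((hcv t ht').mono Set.Ioo_subset_Icc_self)
      fun t ht => (hstr t ht).le
  have hH := H x' (hsub (hsub' hx'I)) y' (hsub (hsub' hy'I)) hxy'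
  have h1 : √(v x' * v y') ≤ (p + q * x')⁻¹ * (p + q * y')⁻¹ := by
    rw [Real.sqrt_mul (hpos _ (hsub (hsub' hx'I))).le]
    have e : ∀ t ∈ Set.Icc x' y', h t ∈ Set.Ici (0 : ℝ) → √(v t) ≤ (p + q * t)⁻¹ := by
      intro t ht h0
      have h2 : p + q * t ≤ u t := by simpa [hh] using h0
      have h3 := hlpos t (hsub' ht)
      have h4 : √(v t) = (u t)⁻¹ := by simp [hu]
      rw [h4]; gcongr
    exact mul_le_mul (e _ hx'I hx'2) (e _ hy'I hy'2) (Real.sqrt_nonneg _)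
      (inv_nonneg.2 (hlpos _ (hsub' hx'I)).le)
  have h2 := mul_le_mul_of_nonneg_left h1 (sub_pos.2 hxy').le
  rw [hI] at hstrict
  linarith

lemma concave_ratio_right {a b : ℝ} {u : ℝ → ℝ} (hu : ConcaveOn ℝ (Set.Icc a b) u)
    (h0 : ∀ x ∈ Set.Icc a b, 0 ≤ u x) {x y : ℝ} (hx : a ≤ x) (hxy : x ≤ y) (hy : y ≤ b) :
    u x * (b - y) ≤ u y * (b - x) := by
  rcases hxy.eq_or_lt with rfl | hlt
  · exact le_rfl
  have hbx : 0 < b - x := by linarith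
  have hne := hbx.ne'
  have h := hu.2 (⟨hx, by linarith⟩ : x ∈ Set.Icc a b) (⟨by linarith, le_rfl⟩ : b ∈ Set.Icc a b)
    (div_nonneg (by linarith) hbx.le : 0 ≤ (b - y) / (b - x))
    (div_nonneg (by linarith) hbx.le : 0 ≤ (y - x) / (b - x))
    (by rw [← add_div, sub_add_sub_cancel, div_self hne])
  have e : (b - y) / (b - x) * x + (y - x) / (b - x) * b = y := by field_simp; ring
  simp only [smul_eq_mul, e] at h
  have h1 : 0 ≤ (y - x) / (b - x) * u b :=
    mul_nonneg (div_nonneg (by linarith) hbx.le) (h0 b ⟨by linarith, le_rfl⟩)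
  have h2 : (b - y) / (b - x) * u x ≤ u y := by linarith
  rw [div_mul_eq_mul_div, div_le_iff₀ hbx] at h2
  linarith

lemma concave_ratio_left {a b : ℝ} {u : ℝ → ℝ} (hu : ConcaveOn ℝ (Set.Icc a b) u)
    (h0 : ∀ x ∈ Set.Icc a b, 0 ≤ u x) {x y : ℝ} (hx : a ≤ x) (hxy : x ≤ y) (hy : y ≤ b) :
    u y * (x - a) ≤ u x * (y - a) := by
  rcases hxy.eq_or_lt with rfl | hlt
  · exact le_rfl
  have hya : 0 < y - a := by linarith
  have hne := hya.ne'
  have h := hu.2 (⟨le_rfl, by linarith⟩ : a ∈ Set.Icc a b) (⟨by linarith, hy⟩ : y ∈ Set.Icc a b)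
    (div_nonneg (by linarith) hya.le : 0 ≤ (y - x) / (y - a))
    (div_nonneg (by linarith) hya.le : 0 ≤ (x - a) / (y - a))
    (by rw [← add_div, sub_add_sub_cancel, div_self hne])
  have e : (y - x) / (y - a) * a + (x - a) / (y - a) * y = x := by field_simp; ring
  simp only [smul_eq_mul, e] at h
  have h1 : 0 ≤ (y - x) / (y - a) * u a :=
    mul_nonneg (div_nonneg (by linarith) hya.le) (h0 a ⟨le_rfl, by linarith⟩)
  have h2 : (x - a) / (y - a) * u y ≤ u x := by linarith
  rw [div_mul_eq_mul_div, div_le_iff₀ hya] at h2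
  linarith

lemma ConcaveOn.abs_sub_le {a b ε M : ℝ} {u : ℝ → ℝ} (hε : 0 < ε)
    (hu : ConcaveOn ℝ (Set.Icc (a - ε) (b + ε)) u)
    (h0 : ∀ x ∈ Set.Icc (a - ε) (b + ε), 0 ≤ u x ∧ u x ≤ M) {x y : ℝ} (hx : x ∈ Set.Icc a b)
    (hy : y ∈ Set.Icc a b) : |u x - u y| ≤ M / ε * |x - y| := by
  wlog hxy : x ≤ y generalizing x y
  · rw [abs_sub_comm, abs_sub_comm x]; exact this hy hx (le_of_not_ge hxy)
  have h0' : ∀ x ∈ Set.Icc (a - ε) (b + ε), 0 ≤ u x := fun x hx => (h0 x hx).1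
  obtain ⟨hx1, hx2⟩ := hx
  obtain ⟨hy1, hy2⟩ := hy
  have h1 := concave_ratio_right hu h0' (x := x) (y := y) (by linarith) hxy (by linarith)
  have h2 := concave_ratio_left hu h0' (x := x) (y := y) (by linarith) hxy (by linarith)
  have mx := (h0 x ⟨by linarith, by linarith⟩)
  have my := (h0 y ⟨by linarith, by linarith⟩)
  rw [abs_of_nonpos (by linarith : x - y ≤ 0), abs_le, div_mul_eq_mul_div]
  have hM : 0 ≤ M := mx.1.trans mx.2
  constructor
  · rw [neg_le, le_div_iff₀ hε]
    have e1 : (u y - u x) * (x - (a - ε)) ≤ u x * (y - x) := by linarith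
    have e2 : u x * (y - x) ≤ M * (y - x) := mul_le_mul_of_nonneg_right mx.2 (by linarith)
    rcases le_total (u y - u x) 0 with hn | hn
    · have := mul_nonneg hM (by linarith : 0 ≤ y - x)
      nlinarith
    · have := mul_le_mul_of_nonneg_left (by linarith : ε ≤ x - (a - ε)) hn
      linarith
  · rw [le_div_iff₀ hε]
    have e1 : (u x - u y) * (b + ε - y) ≤ u y * (y - x) := by linarith
    have e2 : u y * (y - x) ≤ M * (y - x) := mul_le_mul_of_nonneg_right my.2 (by linarith)
    rcases le_total (u x - u y) 0 with hn | hn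
    · have := mul_nonneg hM (by linarith : 0 ≤ y - x)
      nlinarith
    · have := mul_le_mul_of_nonneg_left (by linarith : ε ≤ b + ε - y) hn
      linarith

lemma HasDerivWithinAt.exists_affine_bounds_right {v : ℝ → ℝ} {R z δ : ℝ} (hδ : 0 < δ)
    (h : HasDerivWithinAt v R (Set.Ioi z) z) :
    ∃ η > 0, ∀ t, 0 ≤ t → t < η →
      v z + (R - δ) * t ≤ v (z + t) ∧ v (z + t) ≤ v z + (R + δ) * t := by
  rw [hasDerivWithinAt_iff_tendsto_slope' (by simp)] at h
  have h1 := h.eventually (Ioo_mem_nhds (by linarith : R - δ < R) (by linarith : R < R + δ))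
  obtain ⟨u, hu, hsub⟩ := mem_nhdsGT_iff_exists_Ioo_subset.1 h1
  refine ⟨u - z, sub_pos.2 hu, fun t ht htu => ?_⟩
  rcases ht.eq_or_lt with rfl | ht
  · simp
  have h2 := hsub (⟨by linarith, by linarith⟩ : z + t ∈ Set.Ioo z u)
  simp only [Set.mem_ofPred_eq, slope_def_field, add_sub_cancel_left, lt_div_iff₀ ht,
    div_lt_iff₀ ht] at h2
  constructor <;> linarith [h2.1, h2.2]

lemma HasDerivWithinAt.exists_affine_bounds_left {v : ℝ → ℝ} {L z δ : ℝ} (hδ : 0 < δ)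
    (h : HasDerivWithinAt v L (Set.Iio z) z) :
    ∃ η > 0, ∀ t, 0 ≤ t → t < η →
      v z - (L + δ) * t ≤ v (z - t) ∧ v (z - t) ≤ v z - (L - δ) * t := by
  have h1 : HasDerivWithinAt (fun t => v (-t)) (-L) (Set.Ioi (-z)) (-z) := by
    have h2 : HasDerivWithinAt v L (Set.Iio z) (-(-z)) := by rwa [neg_neg]
    have h3 := h2.scomp (-z) ((hasDerivAt_neg (-z)).hasDerivWithinAt (s := Set.Ioi (-z)))
      (fun t ht => by simp at ht ⊢; linarith)
    simpa [Function.comp_def] using h3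
  obtain ⟨η, hη, H⟩ := h1.exists_affine_bounds_right hδ
  refine ⟨η, hη, fun t ht htη => ?_⟩
  have h2 := H t ht htη
  have e : -(-z + t) = z - t := by ring
  rw [neg_neg, e] at h2
  constructor <;> linarith [h2.1, h2.2]

lemma integral_affine_shift (z t p q : ℝ) :
    ∫ s in z..(z + t), (p + q * (s - z)) = p * t + q * t ^ 2 / 2 := by
  have h : ∀ s ∈ Set.uIcc z (z + t),
      HasDerivAt (fun s => p * (s - z) + q * (s - z) ^ 2 / 2) (p + q * (s - z)) s := by
    intro s _
    have h1 := (hasDerivAt_id s).sub_const z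
    refine ((h1.const_mul p).add (((h1.pow 2).const_mul q).div_const 2)).congr_deriv ?_
    simp
    ring
  rw [intervalIntegral.integral_eq_sub_of_hasDerivAt h
    (by fun_prop : Continuous _).continuousOn.intervalIntegrable]
  simp

namespace PickOn

variable {a b : ℝ} {g v : ℝ → ℝ}

lemma right_deriv_le_left_deriv (hg : PickOn (Set.Icc a b) g v)
    (hv : ContinuousOn v (Set.Icc a b))
    (h_int : ∀ x ∈ Set.Icc a b, ∀ y ∈ Set.Icc a b, ∫ t in x..y, v t = g y - g x)
    {z L R : ℝ} (hz : z ∈ Set.Ioo a b) (hR : HasDerivWithinAt v R (Set.Ioi z) z)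
    (hL : HasDerivWithinAt v L (Set.Iio z) z) : R ≤ L := by
  refine le_of_forall_pos_le_add fun ε hε => ?_
  have hδ : 0 < ε / 10 := by positivity
  obtain ⟨η₁, hη₁, H₁⟩ := hR.exists_affine_bounds_right hδ
  obtain ⟨η₂, hη₂, H₂⟩ := hL.exists_affine_bounds_left hδ
  obtain ⟨t, ht0, ht⟩ := exists_between
    (lt_min (lt_min hη₁ hη₂) (lt_min (sub_pos.2 hz.1) (sub_pos.2 hz.2)))
  simp only [lt_min_iff] at ht
  obtain ⟨⟨ht1, ht2⟩, ht3, ht4⟩ := ht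
  have m1 : z + t ∈ Set.Icc a b := ⟨by linarith [hz.1], by linarith⟩
  have m2 : z ∈ Set.Icc a b := ⟨hz.1.le, hz.2.le⟩
  have m3 : z - t ∈ Set.Icc a b := ⟨by linarith, by linarith [hz.2]⟩
  have hS := hg.simpson ht0 m1 m2 m3
  have ii : ∀ x ∈ Set.Icc a b, ∀ y ∈ Set.Icc a b,
      IntervalIntegrable v MeasureTheory.volume x y := fun x hx y hy =>
    (hv.mono (Set.uIcc_subset_Icc hx hy)).intervalIntegrable
  have i1 : v z * t + (R - ε / 10) * t ^ 2 / 2 ≤ g (z + t) - g z := by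
    rw [← h_int z m2 _ m1, ← integral_affine_shift]
    refine intervalIntegral.integral_mono_on (by linarith)
      (by fun_prop : Continuous _).continuousOn.intervalIntegrable (ii _ m2 _ m1) fun s hs => ?_
    have := (H₁ (s - z) (by linarith [hs.1]) (by linarith [hs.2])).1
    simpa using this
  have i2 : v z * t - (L + ε / 10) * t ^ 2 / 2 ≤ g z - g (z - t) := by
    rw [← h_int _ m3 _ m2]
    have e := integral_affine_shift (z - t) t (v z - (L + ε / 10) * t) (L + ε / 10)
    rw [sub_add_cancel] at e
    have e' : v z * t - (L + ε / 10) * t ^ 2 / 2 =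
      (v z - (L + ε / 10) * t) * t + (L + ε / 10) * t ^ 2 / 2 := by ring
    rw [e', ← e]
    refine intervalIntegral.integral_mono_on (by linarith)
      (by fun_prop : Continuous _).continuousOn.intervalIntegrable (ii _ m3 _ m2) fun s hs => ?_
    have := (H₂ (z - s) (by linarith [hs.2]) (by linarith [hs.1])).1
    rw [sub_sub_cancel] at this
    linarith
  have b1 := (H₁ t ht0.le ht1).2
  have b2 := (H₂ t ht0.le ht2).2
  rw [div_le_iff₀ ht0] at hS
  have hfin : (R - L) * t ^ 2 ≤ ε * t ^ 2 := by nlinarith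
  have := le_of_mul_le_mul_right hfin (by positivity)
  linarith

end PickOn

lemma ConcaveOn.continuousOn_of_hasDerivAt {a b : ℝ} {u u' : ℝ → ℝ}
    (hu : ConcaveOn ℝ (Set.Icc a b) u) (h : ∀ x ∈ Set.Ioo a b, HasDerivAt u (u' x) x) :
    ContinuousOn u' (Set.Ioo a b) := by
  intro x hx
  refine ContinuousAt.continuousWithinAt ?_
  have hs := hasDerivAt_iff_tendsto_slope_left_right.1 (h x hx)
  have huc := (h x hx).continuousAt
  have hnear : ∀ᶠ y in nhds x, y ∈ Set.Ioo a b := Ioo_mem_nhds hx.1 hx.2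
  refine tendsto_order.2 ⟨fun m hm => ?_, fun m hm => ?_⟩
  · obtain ⟨w, hw1, hw2, hw3⟩ :=
      ((hs.2.eventually (lt_mem_nhds hm)).and (Ioo_mem_nhdsGT hx.2)).exists
    have hc : ContinuousAt (fun y => slope u y w) x := by
      simp only [slope_def_field]
      exact (continuousAt_const.sub huc).div (by fun_prop) (sub_pos.2 hw2).ne'
    filter_upwards [hc.eventually (lt_mem_nhds hw1), hnear, Iio_mem_nhds hw2] with y h1 h2 h3
    exact h1.trans_le (hu.slope_le_of_hasDerivAt ⟨h2.1.le, h2.2.le⟩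
      ⟨hx.1.le.trans hw2.le, hw3.le⟩ h3 (h y h2))
  · obtain ⟨w, hw1, hw3, hw2⟩ :=
      ((hs.1.eventually (gt_mem_nhds hm)).and (Ioo_mem_nhdsLT hx.1)).exists
    rw [slope_comm] at hw1
    have hc : ContinuousAt (fun y => slope u w y) x := by
      simp only [slope_def_field]
      exact (huc.sub continuousAt_const).div (by fun_prop) (sub_pos.2 hw2).ne'
    filter_upwards [hc.eventually (gt_mem_nhds hw1), hnear, Ioi_mem_nhds hw2] with y h1 h2 h3
    exact (hu.le_slope_of_hasDerivAt ⟨hw3.le, hw2.le.trans hx.2.le⟩ ⟨h2.1.le, h2.2.le⟩ h3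
      (h y h2)).trans_lt h1

namespace PickOn

variable {a b : ℝ} {g v : ℝ → ℝ}

lemma concaveOn_inv_sqrt (hg : PickOn (Set.Icc a b) g v) (hv : ContinuousOn v (Set.Icc a b))
    (hpos : ∀ x ∈ Set.Icc a b, 0 < v x)
    (h_int : ∀ x ∈ Set.Icc a b, ∀ y ∈ Set.Icc a b, ∫ t in x..y, v t = g y - g x) :
    ConcaveOn ℝ (Set.Icc a b) fun x => (√(v x))⁻¹ :=
  _root_.concaveOn_inv_sqrt hv hpos fun x hx y hy hxy => by
    rw [h_int x hx y hy]
    exact hg.sub_le_mul_sqrt hx hy hxy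

lemma exists_continuousOn_hasDerivAt (hg : PickOn (Set.Icc a b) g v)
    (hv : ContinuousOn v (Set.Icc a b)) (hpos : ∀ x ∈ Set.Icc a b, 0 < v x)
    (h_int : ∀ x ∈ Set.Icc a b, ∀ y ∈ Set.Icc a b, ∫ t in x..y, v t = g y - g x) :
    ∃ w, ContinuousOn w (Set.Ioo a b) ∧ ∀ x ∈ Set.Ioo a b, HasDerivAt v (w x) x := by
  set u : ℝ → ℝ := fun x => (√(v x))⁻¹ with hu
  have hup : ∀ x ∈ Set.Icc a b, 0 < u x := fun x hx => by
    have := Real.sqrt_pos.2 (hpos x hx); positivity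
  have hvu : ∀ x ∈ Set.Icc a b, v x = (u x ^ 2)⁻¹ := fun x hx => by
    simp only [hu, inv_pow, inv_inv, Real.sq_sqrt (hpos x hx).le]
  have hconc : ConcaveOn ℝ (Set.Icc a b) u := hg.concaveOn_inv_sqrt hv hpos h_int
  have hnear : ∀ x ∈ Set.Ioo a b, ∀ᶠ y in nhds x, v y = (u y ^ 2)⁻¹ := fun x hx => by
    filter_upwards [Ioo_mem_nhds hx.1 hx.2] with y hy using hvu y (Set.Ioo_subset_Icc_self hy)
  have hder : ∀ x ∈ Set.Ioo a b, ∀ (s : Set ℝ) (d : ℝ), HasDerivWithinAt u d s x →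
      HasDerivWithinAt v (-(2 * d) / u x ^ 3) s x := by
    intro x hx s d hd
    have hx' := Set.Ioo_subset_Icc_self hx
    have hp := hup x hx'
    have h1 := (hd.pow 2).inv (pow_pos hp 2).ne'
    refine (h1.congr_of_eventuallyEq ((hnear x hx).filter_mono nhdsWithin_le_nhds)
      (hvu x hx')).congr_deriv ?_
    simp only [Pi.pow_apply]
    field_simp
    push_cast
    ring
  have key : ∀ x ∈ Set.Ioo a b, ∃ d, HasDerivAt u d x := by
    intro x hx
    have hxi : x ∈ interior (Set.Icc a b) := by rwa [interior_Icc]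
    have hx' := Set.Ioo_subset_Icc_self hx
    have hp := hup x hx'
    have hcv := hconc.neg
    have hr : HasDerivWithinAt u (-derivWithin (-u) (Set.Ioi x) x) (Set.Ioi x) x := by
      simpa using (hcv.hasDerivWithinAt_rightDeriv_of_mem_interior hxi).neg
    have hl : HasDerivWithinAt u (-derivWithin (-u) (Set.Iio x) x) (Set.Iio x) x := by
      simpa using (hcv.hasDerivWithinAt_leftDeriv_of_mem_interior hxi).neg
    have hle := hcv.leftDeriv_le_rightDeriv_of_mem_interior hxi
    set r := -derivWithin (-u) (Set.Ioi x) x with hrdef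
    set l := -derivWithin (-u) (Set.Iio x) x with hldef
    have h1 := hg.right_deriv_le_left_deriv hv h_int hx (hder x hx _ _ hr) (hder x hx _ _ hl)
    rw [div_le_div_iff_of_pos_right (by positivity)] at h1
    have h2 : l = r := by linarith
    rw [h2] at hl
    refine ⟨r, ?_⟩
    have := hr.Ici_of_Ioi.union hl.Iic_of_Iio
    rwa [Set.union_comm, Set.Iic_union_Ici, hasDerivWithinAt_univ] at this
  have hu' : ∀ x ∈ Set.Ioo a b, HasDerivAt u (deriv u x) x := fun x hx => by
    obtain ⟨d, hd⟩ := key x hx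
    exact hd.differentiableAt.hasDerivAt
  refine ⟨fun x => -(2 * deriv u x) / u x ^ 3, ?_, fun x hx => ?_⟩
  · have h1 := hconc.continuousOn_of_hasDerivAt hu'
    have h2 : ContinuousOn u (Set.Ioo a b) := fun x hx =>
      (hu' x hx).continuousAt.continuousWithinAt
    exact (continuousOn_const.mul h1).neg.div (h2.pow 3) fun x hx =>
      (pow_pos (hup x (Set.Ioo_subset_Icc_self hx)) 3).ne'
  · have := hder x hx Set.univ _ (hu' x hx).hasDerivWithinAt
    rwa [hasDerivWithinAt_univ] at this

end PickOn

/-- A function `g` with continuous positive derivative `v` on `S`, all of whose Loewner matrices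
of order three with nodes in `S` are positive semidefinite. -/
structure SmoothPick (S : Set ℝ) (g v : ℝ → ℝ) : Prop where
  pick : PickOn S g v
  cont : ContinuousOn v S
  deriv : ∀ x ∈ S, HasDerivAt g (v x) x
  pos : ∀ x ∈ S, 0 < v x

namespace SmoothPick

variable {S T : Set ℝ} {g v h w : ℝ → ℝ}

lemma mono (hg : SmoothPick S g v) (hT : T ⊆ S) : SmoothPick T g v :=
  ⟨hg.pick.mono hT, hg.cont.mono hT, fun x hx => hg.deriv x (hT hx), fun x hx => hg.pos x (hT hx)⟩

lemma continuousOn (hg : SmoothPick S g v) : ContinuousOn g S := fun x hx =>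
  (hg.deriv x hx).continuousAt.continuousWithinAt

lemma congr (hg : SmoothPick S g v) {U : Set ℝ} (hU : IsOpen U) (hSU : S ⊆ U)
    (h1 : Set.EqOn h g U) (h2 : Set.EqOn w v S) : SmoothPick S h w := by
  refine ⟨hg.pick.congr (h1.mono hSU) h2, hg.cont.congr h2, fun x hx => ?_, fun x hx => ?_⟩
  · rw [h2 hx]
    exact (hg.deriv x hx).congr_of_eventuallyEq
      (Filter.mem_of_superset (hU.mem_nhds (hSU hx)) h1)
  · rw [h2 hx]; exact hg.pos x hx

lemma comp (hh : SmoothPick T h w) (hg : SmoothPick S g v) (hm : Set.MapsTo g S T) :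
    SmoothPick S (fun x => h (g x)) (fun x => w (g x) * v x) :=
  ⟨hh.pick.comp hg.pick hm, (hh.cont.comp hg.continuousOn hm).mul hg.cont,
    fun x hx => (hh.deriv _ (hm hx)).comp x (hg.deriv x hx),
    fun x hx => mul_pos (hh.pos _ (hm hx)) (hg.pos x hx)⟩

lemma affine (hg : SmoothPick S g v) {a c : ℝ} (b d : ℝ) (hca : 0 < c * a) :
    SmoothPick {x | a * x + b ∈ S} (fun x => c * g (a * x + b) + d)
      (fun x => c * a * v (a * x + b)) := by
  refine ⟨hg.pick.affine b d hca.le, ?_, fun x hx => ?_, fun x hx => mul_pos hca (hg.pos _ hx)⟩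
  · exact continuousOn_const.mul (hg.cont.comp (by fun_prop) fun x hx => hx)
  · have h1 : HasDerivAt (fun x => a * x + b) a x := by
      simpa using ((hasDerivAt_id x).const_mul a).add_const b
    have h2 : HasDerivAt (fun x => g (a * x + b)) _ x := (hg.deriv _ hx).comp x h1
    exact ((h2.const_mul c).add_const d).congr_deriv (by ring)

protected lemma id (S : Set ℝ) : SmoothPick S (fun x => x) (fun _ => 1) :=
  ⟨PickOn.id S, continuousOn_const, fun x _ => hasDerivAt_id x, fun _ _ => one_pos⟩

lemma iterate (hg : SmoothPick S g v) (hm : Set.MapsTo g S S) (n : ℕ) :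
    SmoothPick S (g^[n]) (fun x => ∏ j ∈ Finset.range n, v (g^[j] x)) := by
  induction n with
  | zero =>
    simp only [Function.iterate_zero, Finset.range_zero, Finset.prod_empty]
    exact SmoothPick.id S
  | succ n ih =>
    have h1 := hg.comp ih (hm.iterate n)
    simp only [Finset.prod_range_succ, Function.iterate_succ', Function.comp_def, mul_comm _ (v _)]
    exact h1

lemma integral_eq {a b : ℝ} (hg : SmoothPick (Set.Icc a b) g v) {x y : ℝ}
    (hx : x ∈ Set.Icc a b) (hy : y ∈ Set.Icc a b) : ∫ t in x..y, v t = g y - g x := by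
  have hsub := Set.uIcc_subset_Icc hx hy
  exact intervalIntegral.integral_eq_sub_of_hasDerivAt (fun t ht => hg.deriv t (hsub ht))
    (hg.cont.mono hsub).intervalIntegrable

lemma concaveOn_inv_sqrt {a b : ℝ} (hg : SmoothPick (Set.Icc a b) g v) :
    ConcaveOn ℝ (Set.Icc a b) fun x => (√(v x))⁻¹ :=
  hg.pick.concaveOn_inv_sqrt hg.cont hg.pos fun _ hx _ hy => hg.integral_eq hx hy

lemma strictMonoOn {a b : ℝ} (hg : SmoothPick (Set.Icc a b) g v) :
    StrictMonoOn g (Set.Icc a b) :=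
  strictMonoOn_of_deriv_pos (convex_Icc a b) hg.continuousOn fun x hx => by
    rw [interior_Icc] at hx
    have hx' := Set.Ioo_subset_Icc_self hx
    rw [(hg.deriv x hx').deriv]; exact hg.pos x hx'

/-- A smooth Pick function expands cross ratios at most as much as the identity does. -/
lemma cross_ratio_le {x y z : ℝ} (hg : SmoothPick (Set.Icc x z) g v) (hxy : x < y) (hyz : y < z) :
    v y * ((z - y) * (y - x) * (g z - g x)) ≤ (g z - g y) * (g y - g x) * (z - x) := by
  obtain ⟨w, -, hw⟩ := hg.pick.exists_continuousOn_hasDerivAt hg.cont hg.pos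
    fun _ hx _ hy => hg.integral_eq hx hy
  have hxz := hxy.trans hyz
  have mx : x ∈ Set.Icc x z := ⟨le_rfl, hxz.le⟩
  have my : y ∈ Set.Icc x z := ⟨hxy.le, hyz.le⟩
  have mz : z ∈ Set.Icc x z := ⟨hxz.le, le_rfl⟩
  have hvy := hg.pos y my
  have hsy := Real.sqrt_pos.2 hvy
  have hconc := hg.concaveOn_inv_sqrt
  obtain ⟨q, hq⟩ : ∃ q, HasDerivAt (fun x => (√(v x))⁻¹) q y :=
    ⟨_, ((hw y ⟨hxy, hyz⟩).sqrt hvy.ne').inv hsy.ne'⟩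
  set u : ℝ → ℝ := fun x => (√(v x))⁻¹ with hu
  have hup : ∀ t ∈ Set.Icc x z, 0 < u t := fun t ht => by
    have := Real.sqrt_pos.2 (hg.pos t ht); positivity
  have hvu : ∀ t ∈ Set.Icc x z, v t = (u t ^ 2)⁻¹ := fun t ht => by
    simp only [hu, inv_pow, inv_inv, Real.sq_sqrt (hg.pos t ht).le]
  set p := u y - q * y with hp
  have hle : ∀ t ∈ Set.Icc x z, u t ≤ p + q * t := by
    intro t ht
    rcases lt_trichotomy t y with h | rfl | h
    · have := hconc.le_slope_of_hasDerivAt ht my h hq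
      rw [slope_def_field, le_div_iff₀ (by linarith)] at this
      linarith
    · rw [hp]; linarith
    · have := hconc.slope_le_of_hasDerivAt my ht h hq
      rw [slope_def_field, div_le_iff₀ (by linarith)] at this
      linarith
  have hlpos : ∀ t ∈ Set.Icc x z, 0 < p + q * t := fun t ht => (hup t ht).trans_le (hle t ht)
  have h_int : ∀ s ∈ Set.Icc x z, ∀ t ∈ Set.Icc x z, s ≤ t →
      (t - s) * ((p + q * s)⁻¹ * (p + q * t)⁻¹) ≤ g t - g s := by
    intro s hs t ht hst
    have hsub : Set.Icc s t ⊆ Set.Icc x z := Set.Icc_subset_Icc hs.1 ht.2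
    rw [← integral_inv_sq_affine hst fun r hr => hlpos r (hsub hr), ← hg.integral_eq hs ht]
    refine intervalIntegral.integral_mono_on hst ?_ ?_ fun r hr => ?_
    · refine ContinuousOn.intervalIntegrable ?_
      rw [Set.uIcc_of_le hst]
      exact ContinuousOn.inv₀ (by fun_prop) fun r hr => (pow_pos (hlpos r (hsub hr)) 2).ne'
    · exact (hg.cont.mono (Set.uIcc_subset_Icc hs ht)).intervalIntegrable
    · rw [hvu r (hsub hr)]
      have h1 := hup r (hsub hr)
      have h2 := hle r (hsub hr)
      gcongr
  have h1 := h_int x mx y my hxy.le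
  have h2 := h_int y my z mz hyz.le
  have ly : p + q * y = u y := by rw [hp]; ring
  rw [ly] at h1 h2
  have px := hlpos x mx
  have pz := hlpos z mz
  have py := hup y my
  have ex : p + q * x = u y - q * (y - x) := by rw [hp]; ring
  have ez : p + q * z = u y + q * (z - y) := by rw [hp]; ring
  rw [ex] at px h1
  rw [ez] at pz h2
  rw [← mul_inv, ← div_eq_mul_inv, div_le_iff₀ (by positivity)] at h1 h2
  rw [hvu y my]
  have hA : 0 < g y - g x := sub_pos.2 (hg.strictMonoOn mx my hxy)
  have hB : 0 < g z - g y := sub_pos.2 (hg.strictMonoOn my mz hyz)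
  rw [inv_mul_le_iff₀ (by positivity)]
  have k1 := mul_le_mul_of_nonneg_left h1 (mul_pos (sub_pos.2 hyz) hB).le
  have k2 := mul_le_mul_of_nonneg_left h2 (mul_pos (sub_pos.2 hxy) hA).le
  linarith

lemma mul_sq_right {a b : ℝ} (hg : SmoothPick (Set.Icc a b) g v) {x y : ℝ} (hx : a ≤ x)
    (hxy : x ≤ y) (hy : y ≤ b) : v y * (b - y) ^ 2 ≤ v x * (b - x) ^ 2 := by
  have h := concave_ratio_right hg.concaveOn_inv_sqrt (fun x _ => by positivity) hx hxy hy
  have px := hg.pos x ⟨hx, hxy.trans hy⟩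
  have py := hg.pos y ⟨hx.trans hxy, hy⟩
  have sx := Real.sqrt_pos.2 px
  have sy := Real.sqrt_pos.2 py
  rw [inv_mul_eq_div, inv_mul_eq_div, div_le_div_iff₀ sx sy] at h
  have h2 := pow_le_pow_left₀ (mul_nonneg (by linarith) sy.le) h 2
  rw [mul_pow, mul_pow, Real.sq_sqrt px.le, Real.sq_sqrt py.le] at h2
  linarith

lemma mul_sq_left {a b : ℝ} (hg : SmoothPick (Set.Icc a b) g v) {x y : ℝ} (hx : a ≤ x)
    (hxy : x ≤ y) (hy : y ≤ b) : v x * (x - a) ^ 2 ≤ v y * (y - a) ^ 2 := by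
  have h := concave_ratio_left hg.concaveOn_inv_sqrt (fun x _ => by positivity) hx hxy hy
  have px := hg.pos x ⟨hx, hxy.trans hy⟩
  have py := hg.pos y ⟨hx.trans hxy, hy⟩
  have sx := Real.sqrt_pos.2 px
  have sy := Real.sqrt_pos.2 py
  rw [inv_mul_eq_div, inv_mul_eq_div, div_le_div_iff₀ sy sx] at h
  have h2 := pow_le_pow_left₀ (mul_nonneg (by linarith) sx.le) h 2
  rw [mul_pow, mul_pow, Real.sq_sqrt px.le, Real.sq_sqrt py.le] at h2
  linarith

lemma abs_sub_le {a b ε lo hi : ℝ} (hε : 0 < ε) (hlo : 0 < lo)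
    (hg : SmoothPick (Set.Icc (a - ε) (b + ε)) g v)
    (hb : ∀ x ∈ Set.Icc (a - ε) (b + ε), lo ≤ v x ∧ v x ≤ hi) {x y : ℝ} (hx : x ∈ Set.Icc a b)
    (hy : y ∈ Set.Icc a b) : |v x - v y| ≤ 2 * hi ^ 2 / (lo * ε) * |x - y| := by
  have hsub : Set.Icc a b ⊆ Set.Icc (a - ε) (b + ε) :=
    Set.Icc_subset_Icc (by linarith) (by linarith)
  have hslo := Real.sqrt_pos.2 hlo
  have hu : ∀ x ∈ Set.Icc (a - ε) (b + ε), 0 ≤ (√(v x))⁻¹ ∧ (√(v x))⁻¹ ≤ (√lo)⁻¹ := fun x hx =>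
    ⟨by positivity, by gcongr; exact (hb x hx).1⟩
  have h := hg.concaveOn_inv_sqrt.abs_sub_le hε hu hx hy
  obtain ⟨lx, hx'⟩ := hb x (hsub hx)
  obtain ⟨ly, hy'⟩ := hb y (hsub hy)
  have px := hg.pos x (hsub hx)
  have py := hg.pos y (hsub hy)
  obtain ⟨ux0, ux⟩ := hu x (hsub hx)
  obtain ⟨uy0, uy⟩ := hu y (hsub hy)
  have e : v x - v y = v x * v y * (((√(v y))⁻¹ + (√(v x))⁻¹) * ((√(v y))⁻¹ - (√(v x))⁻¹)) := by
    have e1 : ((√(v y))⁻¹ + (√(v x))⁻¹) * ((√(v y))⁻¹ - (√(v x))⁻¹) = (v y)⁻¹ - (v x)⁻¹ := by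
      rw [← sq_sub_sq, inv_pow, inv_pow, Real.sq_sqrt px.le, Real.sq_sqrt py.le]
    rw [e1]; field_simp
  rw [e, abs_mul, abs_mul (_ + _), abs_of_pos (mul_pos px py), abs_of_nonneg (by positivity : 0 ≤
    (√(v y))⁻¹ + (√(v x))⁻¹), abs_sub_comm (√(v y))⁻¹]
  have e2 : 2 * hi ^ 2 / (lo * ε) * |x - y| =
      (hi * hi) * ((2 * (√lo)⁻¹) * ((√lo)⁻¹ / ε * |x - y|)) := by
    have : (√lo)⁻¹ * (√lo)⁻¹ = lo⁻¹ := by rw [← mul_inv, Real.mul_self_sqrt hlo.le]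
    have e3 : (hi * hi) * ((2 * (√lo)⁻¹) * ((√lo)⁻¹ / ε * |x - y|)) =
      2 * hi ^ 2 * ((√lo)⁻¹ * (√lo)⁻¹) / ε * |x - y| := by ring
    rw [e3, this]; field_simp
  rw [e2]
  have hhi : 0 ≤ hi := px.le.trans hx'
  gcongr
  linarith

end SmoothPick

/-- The primitive of `v` vanishing at `-1`. -/
noncomputable def prim (v : ℝ → ℝ) (x : ℝ) : ℝ := ∫ t in (-1)..x, v t

/-- The primitive of `v`, normalized affinely to be `-1` at `-1` and `0` at `c`. -/
noncomputable def nrm (v : ℝ → ℝ) (c z : ℝ) : ℝ := prim v z / prim v c - 1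

/-- The orientation-preserving inverse branch determined by `v` and `c`. -/
noncomputable def lmap (p : ℝ) (v : ℝ → ℝ) (c z : ℝ) : ℝ := -(max (-nrm v c z) 0) ^ p

/-- The derivative of `lmap`, cut off near its singularity. -/
noncomputable def ldens (p r : ℝ) (v : ℝ → ℝ) (c z : ℝ) : ℝ :=
  p * max (-nrm v c z) r ^ (p - 1) * (v z / prim v c)

/-- Admissible densities: positive, normalized at `-1`, bounded below at `0` and with a Pick
primitive on `[-1, b]`. -/
structure Adm (b m : ℝ) (v : ℝ → ℝ) : Prop where
  cont : Continuous v
  pos : ∀ x, 0 < v x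
  left : v (-1) = 1
  zero : m ≤ v 0
  pick : PickOn (Set.Icc (-1) b) (prim v) v

/-- Upper bound for admissible densities. -/
noncomputable def vmax (b : ℝ) : ℝ := ((b + 1) / (b - 1)) ^ 2

/-- Lower bound for admissible densities. -/
noncomputable def vmin (b m : ℝ) : ℝ := min (m * b ^ 2 / (b + 1) ^ 2) (m / 4)

/-- Lower bound for the slopes of `nrm`. -/
noncomputable def slo (b m : ℝ) : ℝ := vmin b m / (2 * vmax b)

/-- Upper bound for the slopes of `nrm`. -/
noncomputable def shi (b m : ℝ) : ℝ := vmax b / vmin b m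

lemma vmax_pos {b : ℝ} (hb : 1 < b) : 0 < vmax b := by
  have : 0 < b - 1 := by linarith
  have : 0 < b + 1 := by linarith
  unfold vmax; positivity

lemma vmin_pos {b m : ℝ} (hb : 1 < b) (hm : 0 < m) : 0 < vmin b m := by
  have : 0 < b + 1 := by linarith
  have : 0 < b := by linarith
  unfold vmin; positivity

lemma slo_pos {b m : ℝ} (hb : 1 < b) (hm : 0 < m) : 0 < slo b m :=
  div_pos (vmin_pos hb hm) (mul_pos two_pos (vmax_pos hb))

lemma shi_pos {b m : ℝ} (hb : 1 < b) (hm : 0 < m) : 0 < shi b m :=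
  div_pos (vmax_pos hb) (vmin_pos hb hm)

lemma one_sub_rpow_le {p x y : ℝ} (hp : p ∈ Set.Ioo (0 : ℝ) 1) (hy : 0 ≤ y) (hyx : y ≤ x)
    (hx : x ≤ 1) : p * (x - y) ≤ x ^ p - y ^ p := by
  rcases (hy.trans hyx).eq_or_lt with h | h
  · have : y = x := le_antisymm hyx (by rwa [← h])
    simp [this]
  have h1 := rpow_one_add_le_one_add_mul_self (s := y / x - 1)
    (by have : 0 ≤ y / x := by positivity
        linarith) hp.1.le hp.2.le
  rw [add_sub_cancel, Real.div_rpow hy h.le, div_le_iff₀ (Real.rpow_pos_of_pos h p)] at h1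
  have h2 : 1 ≤ x ^ p / x := by
    rw [le_div_iff₀ h, one_mul]
    simpa using Real.rpow_le_rpow_of_exponent_ge h hx hp.2.le
  have h3 : x ^ p - (1 + p * (y / x - 1)) * x ^ p = p * (x - y) * (x ^ p / x) := by
    field_simp; ring
  have h4 : p * (x - y) * 1 ≤ p * (x - y) * (x ^ p / x) :=
    mul_le_mul_of_nonneg_left h2 (mul_nonneg hp.1.le (by linarith))
  linarith

lemma smoothPick_neg_rpow {p : ℝ} (hp : p ∈ Set.Ioo (0 : ℝ) 1) :
    SmoothPick (Set.Iio 0) (fun w => -(-w) ^ p) (fun w => p * (-w) ^ (p - 1)) := by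
  have h : SmoothPick (Set.Ioi 0) (fun x => x ^ p) (fun x => p * x ^ (p - 1)) := by
    refine ⟨pickOn_rpow hp, ?_, fun x hx => ?_, fun x hx => ?_⟩
    · exact continuousOn_const.mul (continuousOn_id.rpow_const fun x hx => Or.inl (ne_of_gt hx))
    · exact Real.hasDerivAt_rpow_const (Or.inl (ne_of_gt hx))
    · exact mul_pos hp.1 (Real.rpow_pos_of_pos hx _)
  have h2 := h.affine (a := -1) (c := -1) 0 0 (by norm_num)
  simpa [Set.Iio, Set.Ioi] using h2

namespace Adm

variable {b m c p : ℝ} {v : ℝ → ℝ}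

lemma hasDerivAt_prim (hv : Adm b m v) (x : ℝ) : HasDerivAt (prim v) (v x) x :=
  intervalIntegral.integral_hasDerivAt_right (hv.cont.intervalIntegrable _ _)
    hv.cont.stronglyMeasurable.stronglyMeasurableAtFilter hv.cont.continuousAt

lemma strictMono_prim (hv : Adm b m v) : StrictMono (prim v) :=
  strictMono_of_deriv_pos fun x => by rw [(hv.hasDerivAt_prim x).deriv]; exact hv.pos x

lemma prim_neg_one (v : ℝ → ℝ) : prim v (-1) = 0 := by simp [prim]

lemma prim_pos (hv : Adm b m v) (hc : 0 < c) : 0 < prim v c := by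
  rw [← prim_neg_one v]; exact hv.strictMono_prim (by linarith)

lemma smooth_prim (hv : Adm b m v) : SmoothPick (Set.Icc (-1) b) (prim v) v :=
  ⟨hv.pick, hv.cont.continuousOn, fun x _ => hv.hasDerivAt_prim x, fun x _ => hv.pos x⟩

lemma le_vmax (hv : Adm b m v) (hb : 1 < b) {x : ℝ} (hx : x ∈ Set.Icc (-1) 1) : v x ≤ vmax b := by
  have h := hv.smooth_prim.mul_sq_right le_rfl hx.1 (hx.2.trans hb.le)
  rw [hv.left, one_mul, sub_neg_eq_add] at h
  have h1 : 0 < b - 1 := by linarith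
  rw [vmax, div_pow, le_div_iff₀ (by positivity)]
  refine le_trans ?_ h
  have := hx.2
  have := (hv.pos x).le
  gcongr

lemma vmin_le (hv : Adm b m v) (hb : 1 < b) {x : ℝ} (hx : x ∈ Set.Icc (-1) 1) :
    vmin b m ≤ v x := by
  have hb1 : 0 < b + 1 := by linarith
  rcases le_total x 0 with h0 | h0
  · refine (min_le_left _ _).trans ?_
    have h := hv.smooth_prim.mul_sq_right hx.1 h0 (by linarith)
    rw [div_le_iff₀ (by positivity)]
    calc m * b ^ 2 ≤ v 0 * b ^ 2 := by gcongr; exact hv.zero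
      _ ≤ v x * (b - x) ^ 2 := by simpa using h
      _ ≤ v x * (b + 1) ^ 2 := by
        have := (hv.pos x).le
        have h2 := hx.1
        have : 0 ≤ b - x := by linarith
        gcongr
        linarith
  · refine (min_le_right _ _).trans ?_
    have h := hv.smooth_prim.mul_sq_left (by norm_num) h0 (hx.2.trans hb.le)
    have h2 : v x * (x - -1) ^ 2 ≤ v x * 2 ^ 2 := by
      have := (hv.pos x).le
      have := hx.2
      have : 0 ≤ x - -1 := by linarith
      gcongr
      linarith
    have := hv.zero
    linarith

lemma prim_sub (hv : Adm b m v) (x y : ℝ) : ∫ t in x..y, v t = prim v y - prim v x :=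
  (intervalIntegral.integral_interval_sub_left (hv.cont.intervalIntegrable _ _)
    (hv.cont.intervalIntegrable _ _)).symm

lemma prim_sub_bounds (hv : Adm b m v) (hb : 1 < b) {x y : ℝ} (hx : -1 ≤ x) (hxy : x ≤ y)
    (hy : y ≤ 1) :
    vmin b m * (y - x) ≤ prim v y - prim v x ∧ prim v y - prim v x ≤ vmax b * (y - x) := by
  rw [← hv.prim_sub]
  constructor
  · have := intervalIntegral.integral_mono_on (μ := MeasureTheory.volume) (f := fun _ => vmin b m) hxy intervalIntegrable_const
      (hv.cont.intervalIntegrable x y)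
      fun t ht => hv.vmin_le hb ⟨hx.trans ht.1, ht.2.trans hy⟩
    simpa [mul_comm] using this
  · have := intervalIntegral.integral_mono_on (μ := MeasureTheory.volume) (g := fun _ => vmax b) hxy
      (hv.cont.intervalIntegrable x y) intervalIntegrable_const
      fun t ht => hv.le_vmax hb ⟨hx.trans ht.1, ht.2.trans hy⟩
    simpa [mul_comm] using this

lemma prim_bounds (hv : Adm b m v) (hb : 1 < b) (hm : 0 < m) (hc : c ∈ Set.Ioc (0 : ℝ) 1) :
    vmin b m ≤ prim v c ∧ prim v c ≤ 2 * vmax b := by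
  have h := hv.prim_sub_bounds hb le_rfl (by linarith [hc.1] : -1 ≤ c) hc.2
  rw [prim_neg_one, sub_zero, sub_neg_eq_add] at h
  have h1 := vmin_pos hb hm
  have h2 := vmax_pos hb
  constructor
  · nlinarith [h.1, hc.1]
  · nlinarith [h.2, hc.2]

lemma density_bounds (hv : Adm b m v) (hb : 1 < b) (hm : 0 < m) (hc : c ∈ Set.Ioc (0 : ℝ) 1)
    {x : ℝ} (hx : x ∈ Set.Icc (-1) 1) :
    slo b m ≤ v x / prim v c ∧ v x / prim v c ≤ shi b m := by
  have h := hv.prim_bounds hb hm hc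
  have h1 := hv.vmin_le hb hx
  have h2 := hv.le_vmax hb hx
  have h3 := vmin_pos hb hm
  have h4 := vmax_pos hb
  have h5 := hv.prim_pos hc.1
  exact ⟨div_le_div₀ (hv.pos x).le h1 h5 h.2, div_le_div₀ h4.le h2 h3 h.1⟩

lemma nrm_sub_bounds (hv : Adm b m v) (hb : 1 < b) (hm : 0 < m) (hc : c ∈ Set.Ioc (0 : ℝ) 1)
    {x y : ℝ} (hx : -1 ≤ x) (hxy : x ≤ y) (hy : y ≤ 1) :
    slo b m * (y - x) ≤ nrm v c y - nrm v c x ∧ nrm v c y - nrm v c x ≤ shi b m * (y - x) := by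
  have h := hv.prim_bounds hb hm hc
  have h1 := hv.prim_sub_bounds hb hx hxy hy
  have h3 := vmin_pos hb hm
  have h4 := vmax_pos hb
  have h5 := hv.prim_pos hc.1
  have e : nrm v c y - nrm v c x = (prim v y - prim v x) / prim v c := by
    unfold nrm; rw [sub_div]; ring
  have hyx : 0 ≤ y - x := sub_nonneg.2 hxy
  rw [e, slo, shi, div_mul_eq_mul_div, div_mul_eq_mul_div]
  exact ⟨div_le_div₀ ((mul_nonneg h3.le hyx).trans h1.1) h1.1 h5 h.2,
    div_le_div₀ (mul_nonneg h4.le hyx) h1.2 h3 h.1⟩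

lemma nrm_neg_one (v : ℝ → ℝ) (c : ℝ) : nrm v c (-1) = -1 := by simp [nrm, prim_neg_one]

lemma nrm_self (hv : Adm b m v) (hc : 0 < c) : nrm v c c = 0 := by
  rw [nrm, div_self (hv.prim_pos hc).ne', sub_self]

lemma hasDerivAt_nrm (hv : Adm b m v) (x : ℝ) : HasDerivAt (nrm v c) (v x / prim v c) x :=
  ((hv.hasDerivAt_prim x).div_const _).sub_const 1

lemma continuous_nrm (hv : Adm b m v) : Continuous (nrm v c) :=
  continuous_iff_continuousAt.2 fun x => (hv.hasDerivAt_nrm x).continuousAt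

lemma strictMono_nrm (hv : Adm b m v) (hc : 0 < c) : StrictMono (nrm v c) := fun _ _ h =>
  sub_lt_sub_right (div_lt_div_of_pos_right (hv.strictMono_prim h) (hv.prim_pos hc)) 1

lemma smooth_nrm (hv : Adm b m v) (hc : 0 < c) :
    SmoothPick (Set.Icc (-1) b) (nrm v c) (fun x => v x / prim v c) := by
  have h := hv.smooth_prim.affine (a := 1) (c := (prim v c)⁻¹) 0 (-1)
    (by have := hv.prim_pos hc; positivity)
  simp only [one_mul, add_zero, mul_one, Set.ofPred_mem_eq] at h
  have e1 : (nrm v c) = fun x => (prim v c)⁻¹ * prim v x + -1 := by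
    funext x; rw [nrm, div_eq_inv_mul]; ring
  have e2 : (fun x => v x / prim v c) = fun x => (prim v c)⁻¹ * v x := by
    funext x; rw [div_eq_inv_mul]
  rw [e1, e2]
  exact h

section lmap

lemma lmap_nonpos (p : ℝ) (v : ℝ → ℝ) (c z : ℝ) : lmap p v c z ≤ 0 :=
  neg_nonpos.2 (Real.rpow_nonneg (le_max_right _ _) _)

lemma lmap_neg_one (p : ℝ) (v : ℝ → ℝ) (c : ℝ) : lmap p v c (-1) = -1 := by
  simp [lmap, nrm_neg_one]

lemma monotone_lmap (hv : Adm b m v) (hc : 0 < c) (hp : 0 < p) : Monotone (lmap p v c) := by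
  intro x y h
  have h1 := (hv.strictMono_nrm hc).monotone h
  refine neg_le_neg (Real.rpow_le_rpow (le_max_right _ _) ?_ hp.le)
  gcongr

lemma neg_one_le_lmap (hv : Adm b m v) (hc : 0 < c) (hp : 0 < p) {z : ℝ} (hz : -1 ≤ z) :
    -1 ≤ lmap p v c z := by
  rw [← lmap_neg_one p v c]; exact hv.monotone_lmap hc hp hz

lemma lmap_sub_ge (hv : Adm b m v) (hb : 1 < b) (hm : 0 < m) (hc : c ∈ Set.Ioc (0 : ℝ) 1)
    (hp : p ∈ Set.Ioo (0 : ℝ) 1) {x y : ℝ} (hx : -1 ≤ x) (hxy : x ≤ y) (hy : y ≤ c) :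
    p * slo b m * (y - x) ≤ lmap p v c y - lmap p v c x := by
  have h1 := (hv.nrm_sub_bounds hb hm hc hx hxy (hy.trans hc.2)).1
  have hmono := (hv.strictMono_nrm hc.1).monotone
  have hy0 : nrm v c y ≤ 0 := by rw [← hv.nrm_self hc.1]; exact hmono hy
  have hx0 : nrm v c x ≤ 0 := (hmono hxy).trans hy0
  have hx1 : -1 ≤ nrm v c x := by rw [← nrm_neg_one v c]; exact hmono hx
  have h2 := one_sub_rpow_le hp (neg_nonneg.2 hy0) (neg_le_neg (hmono hxy)) (by linarith)
  rw [lmap, lmap, max_eq_left (by linarith), max_eq_left (by linarith)]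
  have := mul_le_mul_of_nonneg_left h1 hp.1.le
  linarith

lemma lmap_iterate_sub_ge (hv : Adm b m v) (hb : 1 < b) (hm : 0 < m)
    (hc : c ∈ Set.Ioc (0 : ℝ) 1) (hp : p ∈ Set.Ioo (0 : ℝ) 1) (n : ℕ) {x y : ℝ} (hx : -1 ≤ x)
    (hxy : x ≤ y) (hy : y ≤ c) :
    (p * slo b m) ^ n * (y - x) ≤ (lmap p v c)^[n] y - (lmap p v c)^[n] x := by
  induction n generalizing x y with
  | zero => simp
  | succ n ih =>
    have h1 := hv.lmap_sub_ge hb hm hc hp hx hxy hy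
    have h2 := ih (hv.neg_one_le_lmap hc.1 hp.1 hx) (hv.monotone_lmap hc.1 hp.1 hxy)
      ((lmap_nonpos p v c y).trans hc.1.le)
    rw [Function.iterate_succ_apply, Function.iterate_succ_apply]
    refine le_trans ?_ h2
    rw [pow_succ, mul_assoc]
    have := mul_pos hp.1 (slo_pos hb hm)
    gcongr

lemma mapsTo_lmap (hv : Adm b m v) (hc : 0 < c) (hp : 0 < p) {d : ℝ} (hd : 0 ≤ d) :
    Set.MapsTo (lmap p v c) (Set.Icc (-1) d) (Set.Icc (-1) d) := fun z hz =>
  ⟨hv.neg_one_le_lmap hc hp hz.1, (lmap_nonpos p v c z).trans hd⟩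

lemma smooth_lmap (hv : Adm b m v) (hb : 1 < b) (hc : 0 < c) (hp : p ∈ Set.Ioo (0 : ℝ) 1)
    {d r : ℝ} (hd : d ≤ 1) (hr : 0 < r) (hdr : r ≤ -nrm v c d) :
    SmoothPick (Set.Icc (-1) d) (lmap p v c) (ldens p r v c) := by
  have hle : ∀ z ∈ Set.Icc (-1) d, r ≤ -nrm v c z := fun z hz =>
    hdr.trans (neg_le_neg ((hv.strictMono_nrm hc).monotone hz.2))
  have h := (smoothPick_neg_rpow hp).comp
    ((hv.smooth_nrm hc).mono (Set.Icc_subset_Icc_right (hd.trans hb.le)) : SmoothPick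
      (Set.Icc (-1) d) (nrm v c) _)
    (fun z hz => by have := hle z hz; simp only [Set.mem_Iio]; linarith)
  refine h.congr (U := {z | nrm v c z < 0}) (isOpen_lt hv.continuous_nrm continuous_const)
    (fun z hz => ?_) (fun z hz => ?_) fun z hz => ?_
  · have := hle z hz
    simp only [Set.mem_ofPred_eq]; linarith
  · simp only [Set.mem_ofPred_eq] at hz
    simp only [lmap]
    rw [max_eq_left (by linarith)]
  · simp only [ldens]
    rw [max_eq_left (hle z hz)]

end lmap

end Adm

/-- The density of the renormalized map, up to a constant factor. -/
noncomputable def wdens (p r : ℝ) (k : ℕ) (v : ℝ → ℝ) (c s y : ℝ) : ℝ :=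
  v (-(lmap p v c)^[k - 1] (-s * y)) *
    ∏ j ∈ Finset.range (k - 1), ldens p r v c ((lmap p v c)^[j] (-s * y))

namespace Adm

variable {α b m c p : ℝ} {v : ℝ → ℝ}

lemma iterate_lmap_nonpos {k : ℕ} (hk : 2 ≤ k) (p : ℝ) (v : ℝ → ℝ) (c z : ℝ) :
    (lmap p v c)^[k - 1] z ≤ 0 := by
  obtain ⟨n, rfl⟩ := Nat.exists_eq_add_of_le hk
  have : 2 + n - 1 = n + 1 := by omega
  rw [this, Function.iterate_succ_apply']
  exact lmap_nonpos p v c _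

lemma neg_one_le_iterate_lmap (hv : Adm b m v) (hc : 0 < c) (hp : 0 < p) (n : ℕ) {z : ℝ}
    (hz : -1 ≤ z) : -1 ≤ (lmap p v c)^[n] z :=
  Set.MapsTo.iterate (f := lmap p v c) (s := Set.Ici (-1))
    (fun _ hz => hv.neg_one_le_lmap hc hp hz) n hz

lemma monotone_iterate_lmap (hv : Adm b m v) (hc : 0 < c) (hp : 0 < p) (n : ℕ) :
    Monotone (lmap p v c)^[n] := (hv.monotone_lmap hc hp).iterate n

lemma lmap_lt {k : ℕ} (hv : Adm b m v) (hb : 1 < b) (hm : 0 < m) (hc : c ∈ Set.Ioc (0 : ℝ) 1)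
    (hp : p ∈ Set.Ioo (0 : ℝ) 1) {x y : ℝ} (hx : -1 ≤ x) (hxy : x < y) (hy : y ≤ c) :
    (lmap p v c)^[k] x < (lmap p v c)^[k] y := by
  have h := hv.lmap_iterate_sub_ge hb hm hc hp k hx hxy.le hy
  have h1 : 0 < (p * slo b m) ^ k * (y - x) :=
    mul_pos (pow_pos (mul_pos hp.1 (slo_pos hb hm)) k) (sub_pos.2 hxy)
  linarith

lemma smooth_iterate_lmap (hv : Adm b m v) (hb : 1 < b) (hc : 0 < c)
    (hp : p ∈ Set.Ioo (0 : ℝ) 1) {d r : ℝ} (hd0 : 0 ≤ d) (hd : d ≤ 1) (hr : 0 < r)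
    (hdr : r ≤ -nrm v c d) (n : ℕ) :
    SmoothPick (Set.Icc (-1) d) (lmap p v c)^[n]
      (fun x => ∏ j ∈ Finset.range n, ldens p r v c ((lmap p v c)^[j] x)) :=
  (hv.smooth_lmap hb hc hp hd hr hdr).iterate (hv.mapsTo_lmap hc hp.1 hd0) n

lemma smooth_wdens {k : ℕ} (hk : 2 ≤ k) (hv : Adm b m v) (hb : 1 < b) (hc : 0 < c)
    (hp : p ∈ Set.Ioo (0 : ℝ) 1) {d r s : ℝ} (hd0 : 0 ≤ d) (hd : d ≤ 1) (hr : 0 < r)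
    (hdr : r ≤ -nrm v c d) (hs : 0 < s) {S : Set ℝ} (hS : ∀ y ∈ S, -s * y ∈ Set.Icc (-1) d) :
    SmoothPick S (fun y => nrm v c (-(lmap p v c)^[k - 1] (-s * y)))
      (fun y => s / prim v c * wdens p r k v c s y) := by
  have h1 := ((hv.smooth_iterate_lmap hb hc hp hd0 hd hr hdr (k - 1)).affine (a := -s) (c := -1)
    0 0 (by linarith))
  have h2 := (hv.smooth_nrm hc).comp (h1.mono (T := S) fun y hy => by
    simpa using hS y hy) (fun y hy => by
      have h3 := hv.neg_one_le_iterate_lmap hc hp.1 (k - 1) (hS y hy).1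
      have h4 := iterate_lmap_nonpos hk p v c (-s * y)
      simp only [add_zero, neg_one_mul]
      constructor <;> linarith)
  simp only [add_zero, neg_one_mul, neg_neg] at h2
  have e : (fun y => s / prim v c * wdens p r k v c s y) = fun x =>
      v (-(lmap p v c)^[k - 1] (-s * x)) / prim v c *
      (s * ∏ j ∈ Finset.range (k - 1), ldens p r v c ((lmap p v c)^[j] (-s * x))) := by
    funext y; rw [wdens]; ring
  rw [e]
  exact h2

lemma residual_nonneg_of_small {k : ℕ} (hk : 2 ≤ k) (hα : 1 < α) (hv : Adm b m v) (hb : 1 < b)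
    (hm : 0 < m) (hc : c ∈ Set.Ioc (0 : ℝ) 1) (h : c ^ α ≤ slo b m * c) {z : ℝ} (hz : z ≤ 0) :
    c ≤ -(lmap α⁻¹ v c)^[k - 1] z := by
  have hα0 : 0 < α := by linarith
  obtain ⟨n, rfl⟩ := Nat.exists_eq_add_of_le hk
  have e : 2 + n - 1 = n + 1 := by omega
  rw [e, Function.iterate_succ_apply']
  have h0 : (lmap α⁻¹ v c)^[n] z ≤ 0 := by
    rcases n with _ | n
    · exact hz
    · rw [Function.iterate_succ_apply']; exact lmap_nonpos _ _ _ _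
  have h1 := hv.monotone_lmap hc.1 (inv_pos.2 hα0) h0
  refine le_trans ?_ (neg_le_neg h1)
  have h2 := (hv.nrm_sub_bounds hb hm hc (by norm_num) hc.1.le hc.2).1
  rw [hv.nrm_self hc.1] at h2
  rw [lmap, neg_neg, Real.le_rpow_inv_iff_of_pos hc.1.le (le_max_right _ _) hα0]
  exact le_max_of_le_left (by linarith)

lemma residual_le (hv : Adm b m v) (hc : 0 < c) (hp : 0 < p) (n : ℕ) {z : ℝ} (hz : -1 ≤ z) :
    -(lmap p v c)^[n] z ≤ 1 := by
  have := hv.neg_one_le_iterate_lmap hc hp n hz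
  linarith

lemma rpow_le_of_small {k : ℕ} (hv : Adm b m v) (hb : 1 < b)
    (hm : 0 < m) (hc : c ∈ Set.Ioc (0 : ℝ) 1) (hp : p ∈ Set.Ioo (0 : ℝ) 1) {s c' q : ℝ}
    (hs : 0 < s) (hsc : s ≤ c) (hc' : c' ∈ Set.Ioc (0 : ℝ) 1)
    (h1 : q ≤ slo b m * (c - s)) (h2 : q ≤ slo b m * ((p * slo b m) ^ (k - 1) * s))
    (he : -(lmap p v c)^[k - 1] (-s * c') = c) :
    q ≤ -nrm v c (max s (-(lmap p v c)^[k - 1] s)) := by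
  have hκ := slo_pos hb hm
  have key : ∀ x, 0 ≤ x → x ≤ c → slo b m * (c - x) ≤ -nrm v c x := fun x hx hxc => by
    have h3 := (hv.nrm_sub_bounds hb hm hc (by linarith) hxc hc.2).1
    rw [hv.nrm_self hc.1] at h3
    linarith
  rcases max_cases s (-(lmap p v c)^[k - 1] s) with ⟨e, _⟩ | ⟨e, hlt⟩
  · rw [e]; exact h1.trans (key s hs.le hsc)
  · rw [e]
    have hsc' : 0 < s * c' := mul_pos hs hc'.1
    have hsc1 : s * c' ≤ 1 := mul_le_one₀ (hsc.trans hc.2) hc'.1.le hc'.2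
    have h3 := hv.lmap_iterate_sub_ge hb hm hc hp (k - 1) (x := -s * c') (y := s)
      (by linarith) (by linarith) hsc
    have h4 : (p * slo b m) ^ (k - 1) * s ≤ (p * slo b m) ^ (k - 1) * (s - -s * c') := by
      have : 0 ≤ (p * slo b m) ^ (k - 1) := (pow_pos (mul_pos hp.1 hκ) _).le
      gcongr
      linarith
    have h5 : (p * slo b m) ^ (k - 1) * s ≤ c - -(lmap p v c)^[k - 1] s := by linarith
    have h6 : 0 ≤ (p * slo b m) ^ (k - 1) * s :=
      mul_nonneg (pow_pos (mul_pos hp.1 hκ) _).le hs.le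
    exact (h2.trans (mul_le_mul_of_nonneg_left h5 hκ.le)).trans
      (key _ (hs.le.trans hlt.le) (by linarith))

lemma nrm_ge_of_le (hv : Adm b m v) (hb : 1 < b) (hc : c ∈ Set.Ioc (0 : ℝ) 1) {s : ℝ}
    (hs : (b ^ 2)⁻¹ ≤ s) : -nrm v c s ≤ 2 / 3 := by
  have hs0 : 0 < s := lt_of_lt_of_le (by positivity) hs
  have hmono := hv.strictMono_nrm hc.1
  rcases le_or_gt c s with hcs | hsc
  · have := hmono.monotone hcs
    rw [hv.nrm_self hc.1] at this
    linarith
  have hPc := hv.prim_pos hc.1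
  have hvs := hv.pos s
  have hbc : 0 < b - c := by linarith [hc.2]
  have hbs : 0 < b - s := by linarith
  have hpos : ∀ t ∈ Set.Icc (-1) c, 0 < b + -1 * t := fun t ht => by linarith [ht.2]
  set A := v s * (b - s) ^ 2 with hA
  have hA0 : 0 < A := by positivity
  have hI : ∀ x y, -1 ≤ x → x ≤ y → y ≤ c →
      IntervalIntegrable (fun t => A * ((b + -1 * t) ^ 2)⁻¹) MeasureTheory.volume x y := by
    intro x y hx hxy hy
    refine ContinuousOn.intervalIntegrable ?_
    rw [Set.uIcc_of_le hxy]
    exact continuousOn_const.mul (ContinuousOn.inv₀ (by fun_prop) fun t ht =>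
      (pow_pos (hpos t ⟨hx.trans ht.1, ht.2.trans hy⟩) 2).ne')
  have h1 : prim v c - prim v s ≤ A * ((c - s) * ((b - s)⁻¹ * (b - c)⁻¹)) := by
    have e := integral_inv_sq_affine (p := b) (q := -1) hsc.le
      fun t ht => hpos t ⟨by linarith [ht.1], ht.2⟩
    simp only [neg_one_mul, ← sub_eq_add_neg] at e
    rw [← e, ← intervalIntegral.integral_const_mul, ← hv.prim_sub]
    refine intervalIntegral.integral_mono_on hsc.le (hv.cont.intervalIntegrable _ _)
      (by simpa [← sub_eq_add_neg] using hI s c (by linarith) hsc.le le_rfl) fun t ht => ?_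
    have := hv.smooth_prim.mul_sq_right (by linarith) ht.1 (by linarith [ht.2, hc.2])
    have hbt : 0 < b - t := by linarith [ht.2]
    rw [← div_eq_mul_inv, le_div_iff₀ (by positivity)]
    exact this
  have h2 : A * ((s + 1) * ((b + 1)⁻¹ * (b - s)⁻¹)) ≤ prim v s := by
    have e := integral_inv_sq_affine (p := b) (q := -1) (by linarith : -1 ≤ s)
      fun t ht => hpos t ⟨ht.1, by linarith [ht.2]⟩
    simp only [neg_one_mul, ← sub_eq_add_neg, sub_neg_eq_add] at e
    have e2 := hv.prim_sub (-1) s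
    rw [prim_neg_one, sub_zero] at e2
    rw [← e, ← intervalIntegral.integral_const_mul, ← e2]
    refine intervalIntegral.integral_mono_on (by linarith)
      (by simpa [← sub_eq_add_neg] using hI (-1) s le_rfl (by linarith) hsc.le)
      (hv.cont.intervalIntegrable _ _) fun t ht => ?_
    have := hv.smooth_prim.mul_sq_right ht.1 ht.2 (by linarith)
    have hbt : 0 < b - t := by linarith [ht.2]
    rw [← div_eq_mul_inv, div_le_iff₀ (by positivity)]
    exact this
  have h3 : (c - s) * ((b - s)⁻¹ * (b - c)⁻¹) ≤ 2 * ((s + 1) * ((b + 1)⁻¹ * (b - s)⁻¹)) := by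
    have hsb : 1 ≤ s * b ^ 2 := by
      rwa [inv_le_iff_one_le_mul₀ (by positivity)] at hs
    have hb1 : 0 < b + 1 := by linarith
    have k1 : (c - s) * (b + 1) ≤ 2 * (s + 1) * (b - c) := by
      have hc1 := hc.2
      have q1 : (1 - s) * (b + 1) ≤ 2 * (s + 1) * (b - 1) := by
        have : 0 ≤ b ^ 2 * (2 * (s + 1) * (b - 1) - (1 - s) * (b + 1)) := by
          have q2 : b ^ 2 * (2 * (s + 1) * (b - 1) - (1 - s) * (b + 1)) =
            (s * b ^ 2 - 1) * (3 * b - 1) + (b - 1) ^ 3 := by ring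
          rw [q2]
          have : 0 ≤ b - 1 := by linarith
          have : 0 ≤ s * b ^ 2 - 1 := by linarith
          have : 0 ≤ 3 * b - 1 := by linarith
          positivity
        have := nonneg_of_mul_nonneg_right this (by positivity : 0 < b ^ 2)
        linarith
      nlinarith
    have e1 : (c - s) * ((b - s)⁻¹ * (b - c)⁻¹) = ((c - s) * (b + 1)) *
        ((b - s)⁻¹ * (b - c)⁻¹ * (b + 1)⁻¹) := by field_simp
    have e2 : 2 * ((s + 1) * ((b + 1)⁻¹ * (b - s)⁻¹)) = (2 * (s + 1) * (b - c)) *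
        ((b - s)⁻¹ * (b - c)⁻¹ * (b + 1)⁻¹) := by field_simp
    rw [e1, e2]
    exact mul_le_mul_of_nonneg_right k1 (by positivity)
  have h4 := mul_le_mul_of_nonneg_left h3 hA0.le
  have h5 : prim v c ≤ 3 * prim v s := by linarith
  rw [nrm, neg_sub, sub_le_comm]
  rw [le_div_iff₀ hPc]
  linarith

end Adm

/-- A density with small value at `0` has a small increment. -/
lemma SmoothPick.le_zero_of_le_sub {b m γ c : ℝ} {g v : ℝ → ℝ} (hb : 1 < b) (hm : 0 < m)
    (hg : SmoothPick (Set.Icc (-1) b) g v) (h1 : v (-1) = 1) (hc : c ∈ Set.Ioc (0 : ℝ) 1)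
    (hγ : √m + m * b ^ 2 / (b - 1) ^ 2 < γ) (h : γ ≤ g c - g (-1)) : m ≤ v 0 := by
  by_contra! hlt
  have m1 : (-1 : ℝ) ∈ Set.Icc (-1) b := ⟨le_rfl, by linarith⟩
  have m0 : (0 : ℝ) ∈ Set.Icc (-1) b := ⟨by norm_num, by linarith⟩
  have mc : c ∈ Set.Icc (-1) b := ⟨by linarith [hc.1], by linarith [hc.2]⟩
  have k1 := hg.pick.sub_le_mul_sqrt m1 m0 (by norm_num)
  have hv0 := hg.pos 0 m0
  rw [h1, one_mul, sub_neg_eq_add, zero_add, one_mul] at k1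
  have k2 : √(v 0) ≤ √m := Real.sqrt_le_sqrt hlt.le
  have hb1 : 0 < b - 1 := by linarith
  have k3 : g c - g 0 ≤ m * b ^ 2 / (b - 1) ^ 2 := by
    rw [← hg.integral_eq m0 mc]
    have hi : IntervalIntegrable v MeasureTheory.volume 0 c := by
      refine (hg.cont.mono ?_).intervalIntegrable
      exact Set.uIcc_subset_Icc m0 mc
    have := intervalIntegral.integral_mono_on (μ := MeasureTheory.volume)
      (g := fun _ => m * b ^ 2 / (b - 1) ^ 2) hc.1.le hi intervalIntegrable_const
      fun t ht => by
        have k4 := hg.mul_sq_right (by norm_num) ht.1 (by linarith [ht.2, hc.2])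
        have pt := hg.pos t ⟨by linarith [ht.1], by linarith [ht.2, hc.2]⟩
        rw [le_div_iff₀ (by positivity)]
        calc v t * (b - 1) ^ 2 ≤ v t * (b - t) ^ 2 := by
              have := ht.2.trans hc.2
              gcongr
          _ ≤ v 0 * (b - 0) ^ 2 := k4
          _ ≤ m * b ^ 2 := by rw [sub_zero]; gcongr
    refine this.trans ?_
    rw [intervalIntegral.integral_const, sub_zero, smul_eq_mul]
    exact mul_le_of_le_one_left (by positivity) hc.2
  linarith

/-- The equations relating a density, its critical value and its scale to the critical value of
its renormalization. -/
structure Sol (α b m : ℝ) (k : ℕ) (v : ℝ → ℝ) (c s c' : ℝ) : Prop where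
  adm : Adm b m v
  hc : c ∈ Set.Ioc (0 : ℝ) 1
  hs : s ∈ Set.Ioc (0 : ℝ) 1
  hc' : c' ∈ Set.Ioc (0 : ℝ) 1
  scale : -nrm v c (max s (-(lmap α⁻¹ v c)^[k - 1] s)) = s ^ α
  peak : -(lmap α⁻¹ v c)^[k - 1] (-s * c') = c

namespace Sol

variable {α b m c s c' : ℝ} {k : ℕ} {v : ℝ → ℝ}

lemma max_lt (h : Sol α b m k v c s c') : max s (-(lmap α⁻¹ v c)^[k - 1] s) < c := by
  by_contra! hle
  have h1 := (h.adm.strictMono_nrm h.hc.1).monotone hle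
  rw [h.adm.nrm_self h.hc.1] at h1
  have h2 := Real.rpow_pos_of_pos h.hs.1 α
  linarith [h.scale]

lemma lt (h : Sol α b m k v c s c') : s < c := (le_max_left _ _).trans_lt h.max_lt

lemma rpow_le (h : Sol α b m k v c s c') (hb : 1 < b) (hm : 0 < m) :
    s ^ α ≤ shi b m * (c - s) := by
  have h1 := (h.adm.nrm_sub_bounds hb hm h.hc (by linarith [h.hs.1]) h.lt.le h.hc.2).2
  rw [h.adm.nrm_self h.hc.1] at h1
  have h2 := (h.adm.strictMono_nrm h.hc.1).monotone (le_max_left s (-(lmap α⁻¹ v c)^[k - 1] s))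
  linarith [h.scale]

lemma lt_inv_sq (h : Sol α b m k v c s c') (hα : 1 < α) (hb : 1 < b)
    (hbα : 2 / 3 < ((b ^ 2)⁻¹) ^ α) : s < (b ^ 2)⁻¹ := by
  by_contra! hle
  have h1 := h.adm.nrm_ge_of_le hb h.hc hle
  have h2 := (h.adm.strictMono_nrm h.hc.1).monotone (le_max_left s (-(lmap α⁻¹ v c)^[k - 1] s))
  have h3 : ((b ^ 2)⁻¹) ^ α ≤ s ^ α := Real.rpow_le_rpow (by positivity) hle (by linarith)
  linarith [h.scale]

lemma le_preimage (h : Sol α b m k v c s c') (hα : 1 < α) (hk : 2 ≤ k) :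
    s ≤ -(lmap α⁻¹ v c)^[k - 1] s := by
  by_contra! hlt
  have h1 := h.scale
  rw [max_eq_left hlt.le] at h1
  have hs0 := h.hs.1
  have h2 : lmap α⁻¹ v c s = -s := by
    rw [lmap, h1, max_eq_left (by positivity), Real.rpow_rpow_inv hs0.le (by linarith)]
  obtain ⟨n, rfl⟩ := Nat.exists_eq_add_of_le hk
  have e : 2 + n - 1 = n + 1 := by omega
  rw [e, Function.iterate_succ_apply'] at hlt
  have h0 : (lmap α⁻¹ v c)^[n] s ≤ s := by
    rcases n with _ | n
    · exact le_rfl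
    · rw [Function.iterate_succ_apply']; exact (Adm.lmap_nonpos _ _ _ _).trans hs0.le
  have h3 := h.adm.monotone_lmap h.hc.1 (inv_pos.2 (by linarith : 0 < α)) h0
  linarith

lemma nrm_preimage (h : Sol α b m k v c s c') (hα : 1 < α) (hk : 2 ≤ k) :
    -nrm v c (-(lmap α⁻¹ v c)^[k - 1] s) = s ^ α := by
  have := h.scale
  rwa [max_eq_right (h.le_preimage hα hk)] at this

lemma lmap_preimage (h : Sol α b m k v c s c') (hα : 1 < α) (hk : 2 ≤ k) :
    lmap α⁻¹ v c (-(lmap α⁻¹ v c)^[k - 1] s) = -s := by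
  have hs0 := h.hs.1
  rw [lmap, h.nrm_preimage hα hk, max_eq_left (by positivity),
    Real.rpow_rpow_inv hs0.le (by linarith)]

lemma mul_le_one (h : Sol α b m k v c s c') : s * c' ≤ 1 :=
  mul_le_one₀ h.hs.2 h.hc'.1.le h.hc'.2

lemma preimage_zero_lt (h : Sol α b m k v c s c') (hα : 1 < α) (hb : 1 < b) (hm : 0 < m) :
    -(lmap α⁻¹ v c)^[k - 1] 0 < c := by
  have h2 := mul_pos h.hs.1 h.hc'.1
  have h1 := h.adm.lmap_lt (k := k - 1) hb hm h.hc
    ⟨inv_pos.2 (by linarith : 0 < α), inv_lt_one_of_one_lt₀ hα⟩ (x := -s * c') (y := 0)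
    (by linarith [h.mul_le_one]) (by linarith) h.hc.1.le
  linarith [h.peak]

lemma preimage_le (h : Sol α b m k v c s c') (hα : 1 < α) (hk : 2 ≤ k) {w : ℝ} (hw : 0 ≤ w) :
    -lmap α⁻¹ v c w ≤ c := by
  have h2 := mul_pos h.hs.1 h.hc'.1
  have h1 := h.peak
  obtain ⟨n, rfl⟩ := Nat.exists_eq_add_of_le hk
  have e : 2 + n - 1 = n + 1 := by omega
  rw [e, Function.iterate_succ_apply'] at h1
  have h0 : (lmap α⁻¹ v c)^[n] (-s * c') ≤ 0 := by
    rcases n with _ | n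
    · simp only [Function.iterate_zero, id]; linarith
    · rw [Function.iterate_succ_apply']; exact Adm.lmap_nonpos _ _ _ _
  have h3 := h.adm.monotone_lmap h.hc.1 (inv_pos.2 (by linarith : 0 < α)) (h0.trans hw)
  linarith

lemma ldens_eq {p r r' z : ℝ} (h : r ≤ -nrm v c z) (h' : r' ≤ -nrm v c z) :
    ldens p r v c z = ldens p r' v c z := by
  rw [ldens, ldens, max_eq_left h, max_eq_left h']

lemma wdens_le (h : Sol α b m k v c s c') (hα : 1 < α) (hk : 2 ≤ k) (hb : 1 < b) (hm : 0 < m)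
    {r : ℝ} (hr : r ≤ -nrm v c s) :
    s ^ (1 - α) * wdens α⁻¹ r k v c s (-1) / prim v c ≤ 2 * α := by
  have hα0 : 0 < α := by linarith
  have hp : α⁻¹ ∈ Set.Ioo (0 : ℝ) 1 := ⟨inv_pos.2 hα0, inv_lt_one_of_one_lt₀ hα⟩
  have hs0 := h.hs.1
  have hc0 := h.hc.1
  have hc1 := h.hc.2
  have hsc := h.lt
  set L := lmap α⁻¹ v c with hL
  have hLp : L (-L^[k - 1] s) = -s := h.lmap_preimage hα hk
  have hNp : -nrm v c (-L^[k - 1] s) = s ^ α := h.nrm_preimage hα hk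
  have hmono : ∀ n, Monotone (L^[n]) := fun n => h.adm.monotone_iterate_lmap hc0 hp.1 n
  have hnrm := h.adm.strictMono_nrm hc0
  set g := (c + s) / 2 with hg
  set d := max g (-L^[k - 1] 0) with hd
  have hdc : d < c := _root_.max_lt (by rw [hg]; linarith) (h.preimage_zero_lt hα hb hm)
  have hgd : g ≤ d := le_max_left _ _
  have hg0 : 0 < g := by rw [hg]; linarith
  set ρ := -nrm v c d with hρ
  have hρ0 : 0 < ρ := by
    have := hnrm hdc
    rw [h.adm.nrm_self hc0] at this
    linarith
  have S1 := h.adm.smooth_lmap hb hc0 hp (hdc.le.trans hc1) hρ0 le_rfl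
  have S2 := h.adm.smooth_iterate_lmap hb hc0 hp (hg0.le.trans hgd) (hdc.le.trans hc1) hρ0 le_rfl
    (k - 1)
  have S3 := (S1.affine (a := -1) (c := -1) 0 0 (by norm_num)).comp
    (S2.mono (T := Set.Icc 0 g) fun z hz => ⟨by linarith [hz.1], hz.2.trans hgd⟩) (fun z hz => by
      have h4 := Adm.iterate_lmap_nonpos hk α⁻¹ v c z
      have h5 := hmono (k - 1) hz.1
      have h6 : -L^[k - 1] 0 ≤ d := le_max_right _ _
      simp only [Set.mem_ofPred_eq, Set.mem_Icc]
      constructor <;> linarith)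
  have hcr := S3.cross_ratio_le hs0 (by rw [hg]; linarith : s < g)
  simp only [add_zero, neg_one_mul, neg_neg, sub_zero, one_mul] at hcr
  rw [← hL, hLp, neg_neg] at hcr
  have hx1 : -L^[k - 1] s ≤ d :=
    (neg_le_neg (hmono (k - 1) hs0.le)).trans (le_max_right _ _)
  have e1 : ldens α⁻¹ ρ v c (-L^[k - 1] s) =
      α⁻¹ * s ^ (1 - α) * (v (-L^[k - 1] s) / prim v c) := by
    rw [ldens, max_eq_left (neg_le_neg (hnrm.monotone hx1)), hNp,
      ← Real.rpow_mul hs0.le]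
    congr 3
    field_simp
  have e2 : ∏ j ∈ Finset.range (k - 1), ldens α⁻¹ ρ v c (L^[j] s) =
      ∏ j ∈ Finset.range (k - 1), ldens α⁻¹ r v c (L^[j] s) := by
    refine Finset.prod_congr rfl fun j _ => ?_
    have hj : L^[j] s ≤ s := by
      rcases j with _ | j
      · exact le_rfl
      · rw [Function.iterate_succ_apply']; exact (Adm.lmap_nonpos _ _ _ _).trans hs0.le
    have hsd : s ≤ d := by rw [hg] at hgd; linarith
    exact ldens_eq (neg_le_neg (hnrm.monotone (hj.trans hsd)))
      (hr.trans (neg_le_neg (hnrm.monotone hj)))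
  have e3 : ldens α⁻¹ ρ v c (-L^[k - 1] s) *
      ∏ j ∈ Finset.range (k - 1), ldens α⁻¹ ρ v c (L^[j] s) =
      α⁻¹ * (s ^ (1 - α) * wdens α⁻¹ r k v c s (-1) / prim v c) := by
    rw [e1, e2, wdens, neg_mul_neg, mul_one]
    ring
  rw [e3] at hcr
  set D := s ^ (1 - α) * wdens α⁻¹ r k v c s (-1) / prim v c
  set X := -L (-L^[k - 1] g) - s with hX
  set Y := s - -L (-L^[k - 1] 0) with hY
  have hQ0 : 0 ≤ -L (-L^[k - 1] 0) := neg_nonneg.2 (Adm.lmap_nonpos _ _ _ _)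
  have hQg : -L (-L^[k - 1] g) ≤ c :=
    h.preimage_le hα hk (neg_nonneg.2 (Adm.iterate_lmap_nonpos hk α⁻¹ v c g))
  have hXY : -L (-L^[k - 1] g) - -L (-L^[k - 1] 0) = X + Y := by rw [hX, hY]; ring
  rw [hXY] at hcr
  have m0 : (0 : ℝ) ∈ Set.Icc 0 g := ⟨le_rfl, hg0.le⟩
  have ms : s ∈ Set.Icc 0 g := ⟨hs0.le, by rw [hg]; linarith⟩
  have mg : g ∈ Set.Icc 0 g := ⟨hg0.le, le_rfl⟩
  have hX0 : 0 < X := by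
    have := S3.strictMonoOn ms mg (by rw [hg]; linarith)
    simp only [add_zero, neg_one_mul] at this
    rw [← hL, hLp] at this
    rw [hX]; linarith
  have hY0 : 0 < Y := by
    have := S3.strictMonoOn m0 ms hs0
    simp only [add_zero, neg_one_mul] at this
    rw [← hL, hLp] at this
    rw [hY]; linarith
  have hXU : X ≤ 2 * (g - s) := by rw [hX, hg]; linarith
  have hYs : Y ≤ s := by rw [hY]; linarith
  have hgs : 0 < g - s := by rw [hg]; linarith
  have k1 : X * Y * g ≤ 2 * ((g - s) * s * (X + Y)) := by
    calc X * Y * g ≤ X * Y * (2 * (g - s) + s) := by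
          have : g ≤ 2 * (g - s) + s := by linarith
          gcongr
      _ = X * (Y * (2 * (g - s))) + X * (Y * s) := by ring
      _ ≤ X * (s * (2 * (g - s))) + (2 * (g - s)) * (Y * s) := by gcongr
      _ = _ := by ring
  have k2 : α⁻¹ * D ≤ 2 := by
    refine le_of_mul_le_mul_right (hcr.trans k1) (by positivity)
  rwa [inv_mul_le_iff₀ hα0, mul_comm] at k2

/-- The density of the renormalization is bounded below at `0`. -/
lemma le_wdens_zero (h : Sol α b m k v c s c') (hα : 1 < α) (hk : 2 ≤ k) (hb : 1 < b) (hm : 0 < m)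
    (hγ : √m + m * b ^ 2 / (b - 1) ^ 2 < (2 * α)⁻¹) {d r : ℝ} (hd0 : 0 ≤ d) (hd : d ≤ 1)
    (hr : 0 < r) (hdr : r ≤ -nrm v c d) (hS : ∀ y ∈ Set.Icc (-1) b, -s * y ∈ Set.Icc (-1) d) :
    m ≤ wdens α⁻¹ r k v c s 0 / wdens α⁻¹ r k v c s (-1) := by
  have hα0 : 0 < α := by linarith
  have hp : α⁻¹ ∈ Set.Ioo (0 : ℝ) 1 := ⟨inv_pos.2 hα0, inv_lt_one_of_one_lt₀ hα⟩
  have hs0 := h.hs.1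
  have hP := h.adm.prim_pos h.hc.1
  have m1 : (-1 : ℝ) ∈ Set.Icc (-1) b := ⟨le_rfl, by linarith⟩
  have hS1 := h.adm.smooth_wdens hk hb h.hc.1 hp hd0 hd hr hdr hs0 hS
  set W := wdens α⁻¹ r k v c s with hW
  have hW1 : 0 < W (-1) := by
    have := hS1.pos _ m1
    exact pos_of_mul_pos_right this (by positivity)
  have S2 := hS1.affine (a := 1) (c := prim v c / s / W (-1)) 0 0 (by positivity)
  simp only [one_mul, add_zero, mul_one, Set.ofPred_mem_eq] at S2
  have S3 : SmoothPick (Set.Icc (-1) b) _ (fun y => W y / W (-1)) :=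
    S2.congr isOpen_univ (Set.subset_univ _) (fun _ _ => rfl) fun y _ => by field_simp
  refine S3.le_zero_of_le_sub hb hm (div_self hW1.ne') h.hc' hγ ?_
  have hsd : s ≤ d := by simpa using (hS _ m1).2
  have h1 := h.wdens_le hα hk hb hm (r := r)
    (hdr.trans (neg_le_neg ((h.adm.strictMono_nrm h.hc.1).monotone hsd)))
  have e2 := h.nrm_preimage hα hk
  rw [h.peak, h.adm.nrm_self h.hc.1, neg_mul_neg, mul_one, mul_zero, zero_sub, ← mul_neg, e2]
  rw [← hW, Real.rpow_sub hs0, Real.rpow_one] at h1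
  have hsα := Real.rpow_pos_of_pos hs0 α
  have hrw : prim v c / s / W (-1) * s ^ α = (s / s ^ α * W (-1) / prim v c)⁻¹ := by
    field_simp
  rw [hrw]
  gcongr

end Sol

/-- Constants independent of the period. -/
structure Base (α b m c₀ : ℝ) : Prop where
  one_lt_α : 1 < α
  one_lt_b : 1 < b
  hbα : 2 / 3 < ((b ^ 2)⁻¹) ^ α
  m_pos : 0 < m
  m_le : m ≤ 1 / 2
  hγ : √m + m * b ^ 2 / (b - 1) ^ 2 < (2 * α)⁻¹
  c₀_pos : 0 < c₀
  c₀_lt : c₀ < 1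
  small : c₀ ^ α ≤ slo b m * c₀

/-- Constants depending on the period. -/
structure Scale (α b m c₀ : ℝ) (k : ℕ) (s₀ θ : ℝ) : Prop extends Base α b m c₀ where
  two_le : 2 ≤ k
  s₀_pos : 0 < s₀
  s₀_lt : s₀ < c₀
  small₁ : s₀ ^ α ≤ slo b m * (c₀ - s₀)
  small₂ : s₀ ^ α ≤ slo b m * ((α⁻¹ * slo b m) ^ (k - 1) * s₀)
  θ_pos : 0 < θ
  θ_lt : θ < 1
  le_θ : 1 - s₀ ^ α / shi b m ≤ θ

section constants

open Filter Topology

lemma eventually_rpow_le {α q : ℝ} (hα : 1 < α) (hq : 0 < q) :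
    ∀ᶠ x : ℝ in 𝓝[>] 0, x ^ α ≤ q * x := by
  have h : Tendsto (fun x : ℝ => x ^ (α - 1)) (𝓝[>] 0) (𝓝 0) := by
    have h1 := (Real.continuousAt_rpow_const 0 (α - 1) (Or.inr (by linarith))).tendsto
    rw [Real.zero_rpow (by linarith)] at h1
    exact h1.mono_left nhdsWithin_le_nhds
  filter_upwards [h.eventually (gt_mem_nhds hq), self_mem_nhdsWithin] with x hx hx0
  have hx0' : 0 < x := hx0
  have e : x ^ α = x ^ (α - 1) * x := by
    rw [Real.rpow_sub_one hx0'.ne', div_mul_cancel₀ _ hx0'.ne']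
  rw [e]
  gcongr

lemma exists_base {α : ℝ} (hα : 1 < α) : ∃ b m c₀, Base α b m c₀ := by
  have hα0 : 0 < α := by linarith
  set b : ℝ := (5 / 4) ^ (α⁻¹ / 2) with hb
  have hb1 : 1 < b := Real.one_lt_rpow (by norm_num) (by positivity)
  have hbα : 2 / 3 < ((b ^ 2)⁻¹) ^ α := by
    have e : b ^ 2 = (5 / 4 : ℝ) ^ α⁻¹ := by
      rw [hb, ← Real.rpow_natCast, ← Real.rpow_mul (by norm_num)]
      congr 1
      push_cast
      ring
    rw [e, Real.inv_rpow (by positivity), Real.rpow_inv_rpow (by norm_num) hα0.ne']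
    norm_num
  have hm : ∀ᶠ m : ℝ in 𝓝[>] 0, √m + m * b ^ 2 / (b - 1) ^ 2 < (2 * α)⁻¹ := by
    have h : Continuous fun m : ℝ => √m + m * b ^ 2 / (b - 1) ^ 2 := by fun_prop
    have h0 := (h.tendsto 0).mono_left (nhdsWithin_le_nhds (s := Set.Ioi 0))
    refine h0.eventually (gt_mem_nhds ?_)
    simp only [Real.sqrt_zero, zero_mul, zero_div, add_zero]
    positivity
  have hm2 : ∀ᶠ m : ℝ in 𝓝[>] 0, m ≤ 1 / 2 :=
    (Filter.Eventually.filter_mono nhdsWithin_le_nhds (ge_mem_nhds (by norm_num : (0 : ℝ) < 1 / 2)))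
  obtain ⟨m, ⟨h1, h2⟩, hm0⟩ := ((hm.and hm2).and self_mem_nhdsWithin).exists
  have hc := eventually_rpow_le hα (slo_pos hb1 hm0)
  have hc2 : ∀ᶠ c : ℝ in 𝓝[>] 0, c < 1 :=
    (Filter.Eventually.filter_mono nhdsWithin_le_nhds (gt_mem_nhds (by norm_num)))
  obtain ⟨c, ⟨h3, h4⟩, hc0⟩ := ((hc.and hc2).and self_mem_nhdsWithin).exists
  exact ⟨b, m, c, hα, hb1, hbα, hm0, h2, h1, hc0, h4, h3⟩

lemma Base.exists_scale {α b m c₀ : ℝ} (h : Base α b m c₀) {k : ℕ} (hk : 2 ≤ k) :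
    ∃ s₀ θ, Scale α b m c₀ k s₀ θ := by
  have hκ := slo_pos h.one_lt_b h.m_pos
  have hα0 : 0 < α := by linarith [h.one_lt_α]
  have h1 := eventually_rpow_le h.one_lt_α
    (mul_pos hκ (pow_pos (mul_pos (inv_pos.2 hα0) hκ) (k - 1)))
  have h2 : ∀ᶠ s : ℝ in 𝓝[>] 0, s ^ α < slo b m * (c₀ - s) := by
    refine Filter.Eventually.filter_mono nhdsWithin_le_nhds ?_
    refine ContinuousAt.eventually_lt (Real.continuousAt_rpow_const 0 α (Or.inr hα0.le))
      (by fun_prop) ?_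
    rw [Real.zero_rpow hα0.ne', sub_zero]
    exact mul_pos hκ h.c₀_pos
  have h3 : ∀ᶠ s : ℝ in 𝓝[>] 0, s < c₀ :=
    (Filter.Eventually.filter_mono nhdsWithin_le_nhds (gt_mem_nhds h.c₀_pos))
  obtain ⟨s, ⟨⟨h1, h2⟩, h3⟩, hs0⟩ := (((h1.and h2).and h3).and self_mem_nhdsWithin).exists
  have hs0 : 0 < s := hs0
  have h4 : 0 < s ^ α / shi b m :=
    div_pos (Real.rpow_pos_of_pos hs0 α) (shi_pos h.one_lt_b h.m_pos)
  exact ⟨s, max (1 / 2) (1 - s ^ α / shi b m), h, hk, hs0, h3, h2.le, by rwa [← mul_assoc],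
    lt_max_of_lt_left (by norm_num), max_lt (by norm_num) (by linarith), le_max_right _ _⟩

end constants

/-- The scale, clipped so that the renormalized density extends beyond `[-1, b]`. -/
noncomputable def sclip (b θ c s : ℝ) : ℝ := min s (min (θ * c) (b ^ 2)⁻¹)

/-- The cut-off parameter. -/
noncomputable def cutoff (b m c₀ θ : ℝ) : ℝ := slo b m * ((1 - (1 + θ) / 2) * c₀)

/-- The normalized density of the renormalization. -/
noncomputable def rdens (p b m c₀ θ : ℝ) (k : ℕ) (v : ℝ → ℝ) (c s y : ℝ) : ℝ :=
  wdens p (cutoff b m c₀ θ) k v c (sclip b θ c s) y /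
    wdens p (cutoff b m c₀ θ) k v c (sclip b θ c s) (-1)

/-- The weight needed to push a positive value `x` above `m`. -/
noncomputable def weight (m x : ℝ) : ℝ := max 0 (1 - x / m)

/-- The density of the renormalization, averaged with the constant `1` if too small at `0`. -/
noncomputable def tdens (p b m c₀ θ : ℝ) (k : ℕ) (v : ℝ → ℝ) (c s y : ℝ) : ℝ :=
  (1 - weight m (rdens p b m c₀ θ k v c s 0)) * rdens p b m c₀ θ k v c s y +
    weight m (rdens p b m c₀ θ k v c s 0)

/-- Lower bound for `wdens`. -/
noncomputable def wlo (α b m : ℝ) (k : ℕ) : ℝ := vmin b m * (α⁻¹ * slo b m) ^ (k - 1)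

/-- Upper bound for `wdens`. -/
noncomputable def whi (α b m c₀ θ : ℝ) (k : ℕ) : ℝ :=
  vmax b * (α⁻¹ * cutoff b m c₀ θ ^ (α⁻¹ - 1) * shi b m) ^ (k - 1)

/-- The margin by which the renormalized density extends beyond `[-1, b]`. -/
noncomputable def margin (b θ : ℝ) : ℝ := min ((1 - θ) / 2) (b ^ 2 - b)

lemma weight_mem {m x : ℝ} (hm : 0 < m) (hx : 0 < x) : weight m x ∈ Set.Ico (0 : ℝ) 1 := by
  refine ⟨le_max_left _ _, max_lt one_pos ?_⟩
  have : 0 < x / m := by positivity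
  linarith

lemma le_weight_average {m x : ℝ} (hm : 0 < m) (hm2 : m ≤ 1 / 2) (hx : 0 < x) :
    m ≤ (1 - weight m x) * x + weight m x := by
  rcases le_or_gt m x with h | h
  · have : weight m x = 0 := max_eq_left (by rw [sub_nonpos, one_le_div hm]; exact h)
    rw [this]; linarith
  · have h1 : x / m < 1 := (div_lt_one hm).2 h
    have : weight m x = 1 - x / m := max_eq_right (by linarith)
    rw [this]
    set q := x / m with hq
    have hxq : x = q * m := by rw [hq]; field_simp
    have hq0 : 0 < q := by positivity
    rw [hxq]
    nlinarith [sq_nonneg (1 - q), mul_pos hq0 hm]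

namespace Scale

variable {α b m c₀ s₀ θ c s : ℝ} {k : ℕ} {v : ℝ → ℝ}

lemma p_mem (h : Scale α b m c₀ k s₀ θ) : α⁻¹ ∈ Set.Ioo (0 : ℝ) 1 :=
  ⟨inv_pos.2 (by linarith [h.one_lt_α]), inv_lt_one_of_one_lt₀ h.one_lt_α⟩

lemma cutoff_pos (h : Scale α b m c₀ k s₀ θ) : 0 < cutoff b m c₀ θ := by
  have := slo_pos h.one_lt_b h.m_pos
  have := h.c₀_pos
  have h1 : 0 < 1 - (1 + θ) / 2 := by linarith [h.θ_lt]
  unfold cutoff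
  positivity

lemma cutoff_le (h : Scale α b m c₀ k s₀ θ) (hv : Adm b m v) (hc : c ∈ Set.Icc c₀ 1) :
    cutoff b m c₀ θ ≤ -nrm v c ((1 + θ) / 2 * c) := by
  have hc0 := h.c₀_pos.trans_le hc.1
  have h1 : 0 < 1 - (1 + θ) / 2 := by linarith [h.θ_lt]
  have h2 := (hv.nrm_sub_bounds h.one_lt_b h.m_pos ⟨hc0, hc.2⟩ (x := (1 + θ) / 2 * c) (y := c)
    (by have := h.θ_pos
        have : 0 < (1 + θ) / 2 * c := by positivity
        linarith) (by nlinarith) hc.2).1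
  rw [hv.nrm_self hc0] at h2
  have hκ := slo_pos h.one_lt_b h.m_pos
  have h3 : cutoff b m c₀ θ ≤ slo b m * (c - (1 + θ) / 2 * c) := by
    have : c - (1 + θ) / 2 * c = (1 - (1 + θ) / 2) * c := by ring
    rw [this, cutoff]
    have := hc.1
    gcongr
  linarith

lemma margin_pos (h : Scale α b m c₀ k s₀ θ) : 0 < margin b θ := by
  have := h.one_lt_b
  refine lt_min (by linarith [h.θ_lt]) (by nlinarith)

lemma sclip_pos (h : Scale α b m c₀ k s₀ θ) (hc : 0 < c) (hs : 0 < s) : 0 < sclip b θ c s := by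
  have := h.one_lt_b
  have := h.θ_pos
  exact lt_min hs (lt_min (by positivity) (by positivity))

lemma sclip_mem (h : Scale α b m c₀ k s₀ θ) (hc : c ∈ Set.Ioc (0 : ℝ) 1) (hs : 0 < s) {y : ℝ}
    (hy : y ∈ Set.Icc (-1 - margin b θ) (b + margin b θ)) :
    -sclip b θ c s * y ∈ Set.Icc (-1) ((1 + θ) / 2 * c) := by
  have h0 := h.sclip_pos hc.1 hs
  have h1 : sclip b θ c s ≤ θ * c := (min_le_right _ _).trans (min_le_left _ _)
  have h2 : sclip b θ c s ≤ (b ^ 2)⁻¹ := (min_le_right _ _).trans (min_le_right _ _)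
  have hb := h.one_lt_b
  have e1 : margin b θ ≤ (1 - θ) / 2 := min_le_left _ _
  have e2 : margin b θ ≤ b ^ 2 - b := min_le_right _ _
  have e0 := h.margin_pos
  constructor
  · have : sclip b θ c s * y ≤ (b ^ 2)⁻¹ * b ^ 2 := by
      have : y ≤ b ^ 2 := by linarith [hy.2]
      calc sclip b θ c s * y ≤ sclip b θ c s * b ^ 2 := by gcongr
        _ ≤ _ := by gcongr
    rw [inv_mul_cancel₀ (by positivity)] at this
    linarith
  · have k1 : -sclip b θ c s * y ≤ sclip b θ c s * (1 + margin b θ) := by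
      have := hy.1
      have : sclip b θ c s * -y ≤ sclip b θ c s * (1 + margin b θ) := by
        gcongr; linarith
      linarith
    have k2 : sclip b θ c s * (1 + margin b θ) ≤ θ * c * (1 + (1 - θ) / 2) := by
      have := h.θ_pos
      have := hc.1
      gcongr
    have k3 : θ * c * (1 + (1 - θ) / 2) ≤ (1 + θ) / 2 * c := by
      have := hc.1
      have := h.θ_pos
      have := h.θ_lt
      nlinarith [mul_pos hc.1 h.θ_pos, sq_nonneg (1 - θ), mul_nonneg hc.1.le (sq_nonneg (1 - θ))]
    linarith

lemma cutoff_le_one (h : Scale α b m c₀ k s₀ θ) (hv : Adm b m v) (hc : c ∈ Set.Icc c₀ 1) :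
    cutoff b m c₀ θ ≤ 1 := by
  have hc0 := h.c₀_pos.trans_le hc.1
  have h1 := h.cutoff_le hv hc
  have h2 := (hv.strictMono_nrm hc0).monotone (a := -1) (b := (1 + θ) / 2 * c) (by
    have := h.θ_pos
    have : 0 < (1 + θ) / 2 * c := by positivity
    linarith)
  rw [Adm.nrm_neg_one] at h2
  linarith

lemma ldens_bounds (h : Scale α b m c₀ k s₀ θ) (hv : Adm b m v) (hc : c ∈ Set.Icc c₀ 1)
    {z : ℝ} (hz : z ∈ Set.Icc (-1) 1) :
    α⁻¹ * slo b m ≤ ldens α⁻¹ (cutoff b m c₀ θ) v c z ∧ ldens α⁻¹ (cutoff b m c₀ θ) v c z ≤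
      α⁻¹ * cutoff b m c₀ θ ^ (α⁻¹ - 1) * shi b m := by
  have hc0 := h.c₀_pos.trans_le hc.1
  have h0 := h.cutoff_pos
  have hp := h.p_mem
  have hd := hv.density_bounds h.one_lt_b h.m_pos ⟨hc0, hc.2⟩ hz
  have hκ := slo_pos h.one_lt_b h.m_pos
  set M := max (-nrm v c z) (cutoff b m c₀ θ) with hM
  have hM0 : cutoff b m c₀ θ ≤ M := le_max_right _ _
  have hM1 : M ≤ 1 := by
    refine max_le ?_ (h.cutoff_le_one hv hc)
    have := (hv.strictMono_nrm hc0).monotone hz.1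
    rw [Adm.nrm_neg_one] at this
    linarith
  have k1 : 1 ≤ M ^ (α⁻¹ - 1) :=
    Real.one_le_rpow_of_pos_of_le_one_of_nonpos (h0.trans_le hM0) hM1 (by linarith [hp.2])
  have k2 : M ^ (α⁻¹ - 1) ≤ cutoff b m c₀ θ ^ (α⁻¹ - 1) :=
    Real.rpow_le_rpow_of_nonpos h0 hM0 (by linarith [hp.2])
  have hp0 := hp.1
  have hd0 : 0 ≤ v z / prim v c := hκ.le.trans hd.1
  have hα' := hp.1.le
  constructor
  · rw [ldens, mul_assoc]
    gcongr
    calc slo b m ≤ 1 * (v z / prim v c) := by rw [one_mul]; exact hd.1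
      _ ≤ _ := by gcongr
  · rw [ldens]
    have := hd.2
    gcongr

lemma wlo_pos (h : Scale α b m c₀ k s₀ θ) : 0 < wlo α b m k :=
  mul_pos (vmin_pos h.one_lt_b h.m_pos)
    (pow_pos (mul_pos h.p_mem.1 (slo_pos h.one_lt_b h.m_pos)) _)

lemma wdens_bounds (h : Scale α b m c₀ k s₀ θ) (hv : Adm b m v) (hc : c ∈ Set.Icc c₀ 1)
    (hs : 0 < s) {y : ℝ} (hy : y ∈ Set.Icc (-1 - margin b θ) (b + margin b θ)) :
    wlo α b m k ≤ wdens α⁻¹ (cutoff b m c₀ θ) k v c (sclip b θ c s) y ∧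
      wdens α⁻¹ (cutoff b m c₀ θ) k v c (sclip b θ c s) y ≤ whi α b m c₀ θ k := by
  have hc0 := h.c₀_pos.trans_le hc.1
  have hp := h.p_mem
  have hz := h.sclip_mem ⟨hc0, hc.2⟩ hs hy
  have hz1 : (1 + θ) / 2 * c ≤ 1 := by
    have := h.θ_lt
    have := h.θ_pos
    have := hc.2
    exact mul_le_one₀ (by linarith) hc0.le this
  set z := -sclip b θ c s * y
  have hit : ∀ j, (lmap α⁻¹ v c)^[j] z ∈ Set.Icc (-1) 1 := fun j => by
    refine (hv.mapsTo_lmap hc0 hp.1 zero_le_one).iterate j ⟨hz.1, hz.2.trans hz1⟩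
  have hκ := mul_pos hp.1 (slo_pos h.one_lt_b h.m_pos)
  have hA : -(lmap α⁻¹ v c)^[k - 1] z ∈ Set.Icc (-1 : ℝ) 1 := by
    have := hit (k - 1)
    constructor <;> linarith [this.1, this.2]
  have hlo := hv.vmin_le h.one_lt_b hA
  have hhi := hv.le_vmax h.one_lt_b hA
  have hvm := vmin_pos h.one_lt_b h.m_pos
  have e1 := Finset.prod_le_prod (s := Finset.range (k - 1)) (f := fun _ => α⁻¹ * slo b m)
    (g := fun j => ldens α⁻¹ (cutoff b m c₀ θ) v c ((lmap α⁻¹ v c)^[j] z))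
    (fun _ _ => hκ.le) fun j _ => (h.ldens_bounds hv hc (hit j)).1
  have e2 := Finset.prod_le_prod (s := Finset.range (k - 1))
    (g := fun _ => α⁻¹ * cutoff b m c₀ θ ^ (α⁻¹ - 1) * shi b m)
    (f := fun j => ldens α⁻¹ (cutoff b m c₀ θ) v c ((lmap α⁻¹ v c)^[j] z))
    (fun j _ => hκ.le.trans (h.ldens_bounds hv hc (hit j)).1)
    fun j _ => (h.ldens_bounds hv hc (hit j)).2
  rw [Finset.prod_const, Finset.card_range] at e1 e2
  have hpk := pow_pos hκ (k - 1)
  constructor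
  · exact mul_le_mul hlo e1 hpk.le (hv.pos _).le
  · exact mul_le_mul hhi e2 (hpk.le.trans e1) (vmax_pos h.one_lt_b).le

end Scale

namespace Scale

variable {α b m c₀ s₀ θ c s : ℝ} {k : ℕ} {v : ℝ → ℝ}

lemma sub_margin_mem {b ε y : ℝ} (hε : 0 < ε) (hy : y ∈ Set.Icc (-1) b) :
    y ∈ Set.Icc (-1 - ε) (b + ε) := ⟨by linarith [hy.1], by linarith [hy.2]⟩

lemma smooth_rdens (h : Scale α b m c₀ k s₀ θ) (hv : Adm b m v) (hc : c ∈ Set.Icc c₀ 1)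
    (hs : 0 < s) : ∃ g, SmoothPick (Set.Icc (-1 - margin b θ) (b + margin b θ)) g
      (rdens α⁻¹ b m c₀ θ k v c s) := by
  have hc0 := h.c₀_pos.trans_le hc.1
  have h0 := h.sclip_pos hc0 hs
  have hP := hv.prim_pos hc0
  have hθ := h.θ_pos
  have hθ1 := h.θ_lt
  have hd0 : 0 ≤ (1 + θ) / 2 * c := by positivity
  have hd1 : (1 + θ) / 2 * c ≤ 1 := mul_le_one₀ (by linarith) hc0.le hc.2
  have h1 := hv.smooth_wdens h.two_le h.one_lt_b hc0 h.p_mem hd0 hd1 h.cutoff_pos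
    (h.cutoff_le hv hc) h0 fun y hy => h.sclip_mem ⟨hc0, hc.2⟩ hs hy
  have hW1 : 0 < wdens α⁻¹ (cutoff b m c₀ θ) k v c (sclip b θ c s) (-1) :=
    h.wlo_pos.trans_le (h.wdens_bounds hv hc hs
      ⟨by linarith [h.margin_pos], by linarith [h.margin_pos, h.one_lt_b]⟩).1
  have h2 := h1.affine (a := 1) (c := prim v c / sclip b θ c s /
    wdens α⁻¹ (cutoff b m c₀ θ) k v c (sclip b θ c s) (-1)) 0 0 (by positivity)
  simp only [one_mul, add_zero, mul_one, Set.ofPred_mem_eq] at h2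
  exact ⟨_, h2.congr isOpen_univ (Set.subset_univ _) (fun _ _ => rfl) fun y _ => by
    rw [rdens]; field_simp⟩

lemma wlo_le_whi (h : Scale α b m c₀ k s₀ θ) (hv : Adm b m v) (hc : c ∈ Set.Icc c₀ 1)
    (hs : 0 < s) : wlo α b m k ≤ whi α b m c₀ θ k := by
  have := h.wdens_bounds hv hc hs (y := 0)
    ⟨by linarith [h.margin_pos], by linarith [h.margin_pos, h.one_lt_b]⟩
  exact this.1.trans this.2

lemma rdens_bounds (h : Scale α b m c₀ k s₀ θ) (hv : Adm b m v) (hc : c ∈ Set.Icc c₀ 1)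
    (hs : 0 < s) {y : ℝ} (hy : y ∈ Set.Icc (-1 - margin b θ) (b + margin b θ)) :
    wlo α b m k / whi α b m c₀ θ k ≤ rdens α⁻¹ b m c₀ θ k v c s y ∧
      rdens α⁻¹ b m c₀ θ k v c s y ≤ whi α b m c₀ θ k / wlo α b m k := by
  have h1 := h.wdens_bounds hv hc hs hy
  have h2 := h.wdens_bounds hv hc hs (y := -1)
    ⟨by linarith [h.margin_pos], by linarith [h.margin_pos, h.one_lt_b]⟩
  have h3 := h.wlo_pos
  exact ⟨div_le_div₀ (h3.le.trans h1.1) h1.1 (h3.trans_le h2.1) h2.2,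
    div_le_div₀ (h3.le.trans (h1.1.trans h1.2)) h1.2 h3 h2.1⟩

lemma rdens_neg_one (h : Scale α b m c₀ k s₀ θ) (hv : Adm b m v) (hc : c ∈ Set.Icc c₀ 1)
    (hs : 0 < s) : rdens α⁻¹ b m c₀ θ k v c s (-1) = 1 :=
  div_self (h.wlo_pos.trans_le (h.wdens_bounds hv hc hs (y := -1)
    ⟨by linarith [h.margin_pos], by linarith [h.margin_pos, h.one_lt_b]⟩).1).ne'

lemma rdens_zero_pos (h : Scale α b m c₀ k s₀ θ) (hv : Adm b m v) (hc : c ∈ Set.Icc c₀ 1)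
    (hs : 0 < s) : 0 < rdens α⁻¹ b m c₀ θ k v c s 0 := by
  have h1 := h.wlo_le_whi hv hc hs
  have h3 := h.wlo_pos
  exact (div_pos h3 (h3.trans_le h1)).trans_le (h.rdens_bounds hv hc hs
    ⟨by linarith [h.margin_pos], by linarith [h.margin_pos, h.one_lt_b]⟩).1

lemma tdens_neg_one (h : Scale α b m c₀ k s₀ θ) (hv : Adm b m v) (hc : c ∈ Set.Icc c₀ 1)
    (hs : 0 < s) : tdens α⁻¹ b m c₀ θ k v c s (-1) = 1 := by
  rw [tdens, h.rdens_neg_one hv hc hs]; ring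

lemma le_tdens_zero (h : Scale α b m c₀ k s₀ θ) (hv : Adm b m v) (hc : c ∈ Set.Icc c₀ 1)
    (hs : 0 < s) : m ≤ tdens α⁻¹ b m c₀ θ k v c s 0 :=
  le_weight_average h.m_pos h.m_le (h.rdens_zero_pos hv hc hs)

lemma tdens_bounds (h : Scale α b m c₀ k s₀ θ) (hv : Adm b m v) (hc : c ∈ Set.Icc c₀ 1)
    (hs : 0 < s) {y : ℝ} (hy : y ∈ Set.Icc (-1 - margin b θ) (b + margin b θ)) :
    wlo α b m k / whi α b m c₀ θ k ≤ tdens α⁻¹ b m c₀ θ k v c s y ∧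
      tdens α⁻¹ b m c₀ θ k v c s y ≤ whi α b m c₀ θ k / wlo α b m k := by
  have h1 := h.rdens_bounds hv hc hs hy
  have h2 := h.wlo_le_whi hv hc hs
  have h3 := h.wlo_pos
  have h4 : wlo α b m k / whi α b m c₀ θ k ≤ 1 := (div_le_one (h3.trans_le h2)).2 h2
  have h5 : 1 ≤ whi α b m c₀ θ k / wlo α b m k := (one_le_div h3).2 h2
  have h6 := weight_mem h.m_pos (h.rdens_zero_pos hv hc hs)
  rw [tdens]
  set τ := weight m (rdens α⁻¹ b m c₀ θ k v c s 0)
  have h7 := h6.1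
  have h8 : 0 < 1 - τ := by linarith [h6.2]
  constructor
  · have := mul_le_mul_of_nonneg_left h1.1 h8.le
    have := mul_le_mul_of_nonneg_left h4 h7
    linarith
  · have := mul_le_mul_of_nonneg_left h1.2 h8.le
    have := mul_le_mul_of_nonneg_left h5 h7
    linarith

lemma smooth_tdens (h : Scale α b m c₀ k s₀ θ) (hv : Adm b m v) (hc : c ∈ Set.Icc c₀ 1)
    (hs : 0 < s) : ∃ g, SmoothPick (Set.Icc (-1 - margin b θ) (b + margin b θ)) g
      (tdens α⁻¹ b m c₀ θ k v c s) := by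
  obtain ⟨g, hg⟩ := h.smooth_rdens hv hc hs
  have h6 := weight_mem h.m_pos (h.rdens_zero_pos hv hc hs)
  set τ := weight m (rdens α⁻¹ b m c₀ θ k v c s 0) with hτ
  have h7 := h6.1
  have h8 : 0 < 1 - τ := by linarith [h6.2]
  have e1 := hg.affine (a := 1) (c := 1 - τ) 0 0 (by linarith)
  simp only [one_mul, add_zero, mul_one, Set.ofPred_mem_eq] at e1
  have e2 := (PickOn.id (Set.Icc (-1 - margin b θ) (b + margin b θ))).affine (a := 1) (c := τ) 0 0
    (by linarith)
  simp only [one_mul, add_zero, mul_one, Set.ofPred_mem_eq] at e2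
  refine ⟨fun y => (1 - τ) * g y + τ * y, e1.pick.add e2, ?_, fun y hy => ?_, fun y hy => ?_⟩
  · exact e1.cont.add continuousOn_const
  · have e3 := (e1.deriv y hy).add ((hasDerivAt_id y).const_mul τ)
    rw [mul_one] at e3
    exact e3
  · have := e1.pos y hy
    rw [tdens, ← hτ]
    linarith

end Scale

/-- Compactness of a set of uniformly bounded and uniformly Lipschitz functions. -/
lemma isCompact_lipschitz_bounded {a b : ℝ} (lo hi C : ℝ) :
    IsCompact {u : C(Set.Icc a b, ℝ) | (∀ x, u x ∈ Set.Icc lo hi) ∧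
      ∀ x y, |u x - u y| ≤ C * |(x : ℝ) - y|} := by
  refine ArzelaAscoli.isCompact_of_equicontinuous _ ?_ ?_
  · have h1 : IsCompact (Set.univ.pi fun _ : Set.Icc a b => Set.Icc lo hi) :=
      isCompact_univ_pi fun _ => isCompact_Icc
    have h2 : IsClosed {f : Set.Icc a b → ℝ | ∀ x y, |f x - f y| ≤ C * |(x : ℝ) - y|} := by
      simp only [Set.ofPred_forall]
      exact isClosed_iInter fun x => isClosed_iInter fun y =>
        isClosed_le (by fun_prop) continuous_const
    convert h1.inter_right h2 using 1
    ext f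
    constructor
    · rintro ⟨u, hu, rfl⟩
      exact ⟨fun x _ => hu.1 x, hu.2⟩
    · rintro ⟨hf1, hf2⟩
      have hf : Continuous f := by
        refine (LipschitzWith.of_dist_le_mul (K := C.toNNReal) fun x y => ?_).continuous
        rw [Real.dist_eq, Subtype.dist_eq, Real.dist_eq]
        exact (hf2 x y).trans (mul_le_mul_of_nonneg_right (Real.le_coe_toNNReal C) (abs_nonneg _))
      exact ⟨⟨f, hf⟩, ⟨fun x => hf1 x trivial, hf2⟩, rfl⟩
  · have h : ∀ u : {u : C(Set.Icc a b, ℝ) | (∀ x, u x ∈ Set.Icc lo hi) ∧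
      ∀ x y, |u x - u y| ≤ C * |(x : ℝ) - y|}, LipschitzWith C.toNNReal (u : Set.Icc a b → ℝ) := by
      intro u
      refine LipschitzWith.of_dist_le_mul fun x y => ?_
      rw [Real.dist_eq, Subtype.dist_eq, Real.dist_eq]
      exact (u.2.2 x y).trans
        (mul_le_mul_of_nonneg_right (Real.le_coe_toNNReal C) (abs_nonneg _))
    exact (LipschitzWith.uniformEquicontinuous _ _ h).equicontinuous

/-- A continuous function on `[-1, b]`, extended to the real line by constants. -/
noncomputable def extend {b : ℝ} (hb : -1 ≤ b) (u : C(Set.Icc (-1) b, ℝ)) : ℝ → ℝ :=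
  Set.IccExtend hb u

/-- The set of densities on which the renormalization operator acts. -/
def densSet {b : ℝ} (hb : -1 ≤ b) (m lo hi C : ℝ) : Set C(Set.Icc (-1) b, ℝ) :=
  {u | ((∀ x, u x ∈ Set.Icc lo hi) ∧ ∀ x y, |u x - u y| ≤ C * |(x : ℝ) - y|) ∧
    extend hb u (-1) = 1 ∧ m ≤ extend hb u 0 ∧
    PickOn (Set.Icc (-1) b) (prim (extend hb u)) (extend hb u)}

section joint

variable {X : Type*} [TopologicalSpace X]

lemma continuous_extend {b : ℝ} (hb : -1 ≤ b) :
    Continuous fun q : C(Set.Icc (-1) b, ℝ) × ℝ => extend hb q.1 q.2 := by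
  have h : Continuous fun q : C(Set.Icc (-1) b, ℝ) × ℝ => q.1 (Set.projIcc _ _ hb q.2) :=
    continuous_eval.comp (continuous_fst.prodMk ((continuous_projIcc (h := hb)).comp continuous_snd))
  exact h

variable {V : X → ℝ → ℝ} {z c : X → ℝ} {p r : ℝ}

lemma continuous_prim_joint (hV : Continuous (Function.uncurry V)) (hz : Continuous z) :
    Continuous fun x => prim (V x) (z x) :=
  intervalIntegral.continuous_parametric_intervalIntegral_of_continuous hV hz

lemma continuous_nrm_joint (hV : Continuous (Function.uncurry V)) (hc : Continuous c)
    (h0 : ∀ x, prim (V x) (c x) ≠ 0) (hz : Continuous z) :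
    Continuous fun x => nrm (V x) (c x) (z x) :=
  ((continuous_prim_joint hV hz).div (continuous_prim_joint hV hc) h0).sub continuous_const

lemma continuous_lmap_joint (hp : 0 < p) (hV : Continuous (Function.uncurry V))
    (hc : Continuous c) (h0 : ∀ x, prim (V x) (c x) ≠ 0) (hz : Continuous z) :
    Continuous fun x => lmap p (V x) (c x) (z x) :=
  (((continuous_nrm_joint hV hc h0 hz).neg.max continuous_const).rpow_const
    fun _ => Or.inr hp.le).neg

lemma continuous_iterate_lmap_joint (hp : 0 < p) (hV : Continuous (Function.uncurry V))
    (hc : Continuous c) (h0 : ∀ x, prim (V x) (c x) ≠ 0) (hz : Continuous z) (n : ℕ) :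
    Continuous fun x => (lmap p (V x) (c x))^[n] (z x) := by
  induction n with
  | zero => exact hz
  | succ n ih =>
    simp only [Function.iterate_succ_apply']
    exact continuous_lmap_joint hp hV hc h0 ih

lemma continuous_ldens_joint (hr : 0 < r) (hV : Continuous (Function.uncurry V))
    (hc : Continuous c) (h0 : ∀ x, prim (V x) (c x) ≠ 0) (hz : Continuous z) :
    Continuous fun x => ldens p r (V x) (c x) (z x) := by
  refine (continuous_const.mul (((continuous_nrm_joint hV hc h0 hz).neg.max
    continuous_const).rpow_const fun x => Or.inl ?_)).mul
    ((hV.comp (continuous_id.prodMk hz)).div (continuous_prim_joint hV hc) h0)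
  exact (hr.trans_le (le_max_right _ _)).ne'

lemma continuous_wdens_joint {s y : X → ℝ} (hp : 0 < p) (hr : 0 < r) (k : ℕ)
    (hV : Continuous (Function.uncurry V))
    (hc : Continuous c) (h0 : ∀ x, prim (V x) (c x) ≠ 0) (hs : Continuous s) (hy : Continuous y) :
    Continuous fun x => wdens p r k (V x) (c x) (s x) (y x) := by
  have hz : Continuous fun x => -(s x) * y x := hs.neg.mul hy
  have hit := continuous_iterate_lmap_joint hp hV hc h0 hz
  exact (hV.comp (continuous_id.prodMk (hit (k - 1)).neg)).mul
    (continuous_finsetProd _ fun j _ => continuous_ldens_joint hr hV hc h0 (hit j))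

end joint

section densSet

variable {b m lo hi C : ℝ}

lemma isCompact_densSet (hb : -1 ≤ b) : IsCompact (densSet hb m lo hi C) := by
  refine IsCompact.inter_right (isCompact_lipschitz_bounded lo hi C) ?_
  have hcont : ∀ x, Continuous fun u => extend hb u x := fun x =>
    (continuous_extend hb).comp (continuous_id.prodMk continuous_const)
  have hprim : ∀ x, Continuous fun u => prim (extend hb u) x := fun x =>
    continuous_prim_joint (continuous_extend hb) continuous_const
  refine (isClosed_eq (hcont (-1)) continuous_const).inter
    ((isClosed_le continuous_const (hcont 0)).inter ?_)
  refine isClosed_of_closure_subset fun u hu => ?_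
  have hne : (nhdsWithin u {w | PickOn (Set.Icc (-1) b) (prim (extend hb w))
    (extend hb w)}).NeBot := mem_closure_iff_nhdsWithin_neBot.1 hu
  exact PickOn.of_tendsto (G := fun w : C(Set.Icc (-1) b, ℝ) => prim (extend hb w))
    (V := fun w => extend hb w) (l := nhdsWithin u
      {w | PickOn (Set.Icc (-1) b) (prim (extend hb w)) (extend hb w)}) self_mem_nhdsWithin
    (fun x _ => ((hprim x).tendsto u).mono_left nhdsWithin_le_nhds)
    (fun x _ => ((hcont x).tendsto u).mono_left nhdsWithin_le_nhds)

lemma continuous_extend_apply (hb : -1 ≤ b) (u : C(Set.Icc (-1) b, ℝ)) :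
    Continuous (extend hb u) := u.continuous.Icc_extend'

lemma convex_densSet (hb : -1 ≤ b) : Convex ℝ (densSet hb m lo hi C) := by
  rintro u hu w hw q r hq hr hqr
  have e : ∀ x, extend hb (q • u + r • w) x = q * extend hb u x + r * extend hb w x :=
    fun _ => rfl
  have e2 : ∀ x, (q • u + r • w) x = q * u x + r * w x := fun _ => rfl
  refine ⟨⟨fun x => ?_, fun x y => ?_⟩, ?_, ?_, ?_⟩
  · exact convex_Icc lo hi (hu.1.1 x) (hw.1.1 x) hq hr hqr
  · rw [e2, e2]
    calc |q * u x + r * w x - (q * u y + r * w y)| = |q * (u x - u y) + r * (w x - w y)| := by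
          ring_nf
      _ ≤ q * |u x - u y| + r * |w x - w y| := by
          refine (abs_add_le _ _).trans ?_
          rw [abs_mul, abs_mul, abs_of_nonneg hq, abs_of_nonneg hr]
      _ ≤ q * (C * |(x : ℝ) - y|) + r * (C * |(x : ℝ) - y|) :=
          add_le_add (mul_le_mul_of_nonneg_left (hu.1.2 x y) hq)
            (mul_le_mul_of_nonneg_left (hw.1.2 x y) hr)
      _ = _ := by rw [← add_mul, hqr, one_mul]
  · rw [e, hu.2.1, hw.2.1, mul_one, mul_one, hqr]
  · rw [e]
    have h1 := mul_le_mul_of_nonneg_left hu.2.2.1 hq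
    have h2 := mul_le_mul_of_nonneg_left hw.2.2.1 hr
    have h3 : q * m + r * m = m := by rw [← add_mul, hqr, one_mul]
    linarith
  · have k1 := (hu.2.2.2.affine (a := 1) (c := q) 0 0 (by linarith)).add
      (hw.2.2.2.affine (a := 1) (c := r) 0 0 (by linarith))
    simp only [one_mul, add_zero, mul_one, Set.ofPred_mem_eq] at k1
    refine k1.congr (fun x _ => ?_) fun x _ => e x
    simp only [prim, e]
    rw [intervalIntegral.integral_add, intervalIntegral.integral_const_mul,
      intervalIntegral.integral_const_mul]
    · exact ((continuous_extend_apply hb u).const_mul q).intervalIntegrable _ _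
    · exact ((continuous_extend_apply hb w).const_mul r).intervalIntegrable _ _

lemma adm_of_mem_densSet (hb : -1 ≤ b) (hlo : 0 < lo) {u : C(Set.Icc (-1) b, ℝ)}
    (hu : u ∈ densSet hb m lo hi C) : Adm b m (extend hb u) :=
  ⟨continuous_extend_apply hb u, fun x => hlo.trans_le (hu.1.1 (Set.projIcc _ _ hb x)).1, hu.2.1,
    hu.2.2.1, hu.2.2.2⟩

lemma extend_apply (hb : -1 ≤ b) (u : C(Set.Icc (-1) b, ℝ)) {x : ℝ} (hx : x ∈ Set.Icc (-1) b) :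
    extend hb u x = u ⟨x, hx⟩ := Set.IccExtend_of_mem hb u hx

/-- The restriction of a smooth Pick density belongs to `densSet`. -/
lemma mem_densSet (hb : 0 ≤ b) {ε : ℝ} (hε : 0 < ε) (hlo : 0 < lo) {g v : ℝ → ℝ}
    (hg : SmoothPick (Set.Icc (-1 - ε) (b + ε)) g v)
    (hbd : ∀ x ∈ Set.Icc (-1 - ε) (b + ε), lo ≤ v x ∧ v x ≤ hi) (h1 : v (-1) = 1) (h0 : m ≤ v 0)
    {u : C(Set.Icc (-1) b, ℝ)} (hu : ∀ x, u x = v x) :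
    u ∈ densSet (by linarith) m lo hi (2 * hi ^ 2 / (lo * ε)) := by
  have hb' : -1 ≤ b := by linarith
  have hsub : Set.Icc (-1) b ⊆ Set.Icc (-1 - ε) (b + ε) :=
    Set.Icc_subset_Icc (by linarith) (by linarith)
  have hg' := hg.mono hsub
  have hev : ∀ x ∈ Set.Icc (-1) b, extend hb' u x = v x := fun x hx => by
    rw [extend_apply hb' u hx, hu]
  have m1 : (-1 : ℝ) ∈ Set.Icc (-1) b := ⟨le_rfl, hb'⟩
  refine ⟨⟨fun x => ?_, fun x y => ?_⟩, ?_, ?_, ?_⟩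
  · rw [hu]; exact hbd x (hsub x.2)
  · rw [hu, hu]; exact hg.abs_sub_le hε hlo hbd x.2 y.2
  · exact (hev _ m1).trans h1
  · rw [hev 0 ⟨by norm_num, hb⟩]; exact h0
  · have k1 := hg'.pick.affine (a := 1) (c := 1) 0 (-g (-1)) (by norm_num)
    simp only [one_mul, add_zero, Set.ofPred_mem_eq] at k1
    refine k1.congr (fun x hx => ?_) fun x hx => hev x hx
    show _ = g x + -g (-1)
    rw [← sub_eq_add_neg, ← hg'.integral_eq m1 hx]
    refine intervalIntegral.integral_congr fun t ht => ?_
    exact hev t (Set.uIcc_subset_Icc m1 hx ht)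

end densSet

/-- A fixed point of a clipped displacement that points inwards at the ends has no displacement. -/
lemma eq_zero_of_clip_eq {lo hi x r : ℝ} (hx : x ∈ Set.Icc lo hi)
    (h : max lo (min hi (x + r)) = x) (hlo : x = lo → 0 ≤ r) (hhi : x = hi → r ≤ 0) : r = 0 := by
  rcases lt_trichotomy r 0 with hr | hr | hr
  · rcases hx.1.eq_or_lt with e | hlt
    · exact absurd (hlo e.symm) (by linarith)
    · have h1 : max lo (min hi (x + r)) < x := max_lt hlt (lt_of_le_of_lt (min_le_right _ _)
        (by linarith))
      linarith
  · exact hr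
  · rcases hx.2.eq_or_lt with e | hlt
    · exact absurd (hhi e) (by linarith)
    · have h1 : x < max lo (min hi (x + r)) := lt_max_of_lt_right (lt_min hlt (by linarith))
      linarith

namespace Scale

variable {α b m c₀ s₀ θ c s c' : ℝ} {k : ℕ} {v v' : ℝ → ℝ}

lemma sclip_eq (h : Scale α b m c₀ k s₀ θ) (hsol : Sol α b m k v c s c') (hs : s₀ ≤ s) :
    sclip b θ c s = s := by
  have h1 := hsol.rpow_le h.one_lt_b h.m_pos
  have h2 := hsol.lt_inv_sq h.one_lt_α h.one_lt_b h.hbα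
  have h3 : s₀ ^ α ≤ s ^ α := Real.rpow_le_rpow h.s₀_pos.le hs (by linarith [h.one_lt_α])
  have hK := shi_pos h.one_lt_b h.m_pos
  have h4 : s₀ ^ α / shi b m ≤ c - s := by
    rw [div_le_iff₀ hK, mul_comm]; exact h3.trans h1
  have h5 : 0 ≤ s₀ ^ α / shi b m := by
    have := Real.rpow_pos_of_pos h.s₀_pos α
    positivity
  have h6 : s ≤ θ * c := by
    have h7 := mul_le_mul_of_nonneg_right h.le_θ hsol.hc.1.le
    have h8 := mul_le_of_le_one_right h5 hsol.hc.2
    linarith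
  exact min_eq_left (le_min h6 h2.le)

lemma tdens_eq (h : Scale α b m c₀ k s₀ θ) (hsol : Sol α b m k v c s c') (hc : c₀ ≤ c)
    (hs : s₀ ≤ s) (y : ℝ) : tdens α⁻¹ b m c₀ θ k v c s y =
      wdens α⁻¹ (cutoff b m c₀ θ) k v c s y / wdens α⁻¹ (cutoff b m c₀ θ) k v c s (-1) := by
  have hθ := h.θ_pos
  have hθ1 := h.θ_lt
  have hc0 := hsol.hc.1
  have e := h.sclip_eq hsol hs
  have h1 := hsol.le_wdens_zero h.one_lt_α h.two_le h.one_lt_b h.m_pos h.hγ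
    (d := (1 + θ) / 2 * c) (by positivity) (mul_le_one₀ (by linarith) hc0.le hsol.hc.2)
    h.cutoff_pos (h.cutoff_le hsol.adm ⟨hc, hsol.hc.2⟩) (fun y hy => by
      have := h.sclip_mem hsol.hc hsol.hs.1 (sub_margin_mem h.margin_pos hy)
      rwa [e] at this)
  have h2 : ∀ y, rdens α⁻¹ b m c₀ θ k v c s y = wdens α⁻¹ (cutoff b m c₀ θ) k v c s y /
      wdens α⁻¹ (cutoff b m c₀ θ) k v c s (-1) := fun y => by rw [rdens, e]
  have h3 : weight m (rdens α⁻¹ b m c₀ θ k v c s 0) = 0 := by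
    rw [h2]
    exact max_eq_left (by rw [sub_nonpos, one_le_div h.m_pos]; exact h1)
  rw [tdens, h3, h2]
  ring

/-- The functional equation satisfied by a fixed point of the renormalization operator. -/
lemma nrm_eq (h : Scale α b m c₀ k s₀ θ) (hsol : Sol α b m k v c s c') (hc : c₀ ≤ c)
    (hs : s₀ ≤ s) (hv' : Adm b m v')
    (he : ∀ y ∈ Set.Icc (-1) b, v' y = tdens α⁻¹ b m c₀ θ k v c s y) {y : ℝ}
    (hy : y ∈ Set.Icc (-1) b) :
    nrm v c (-(lmap α⁻¹ v c)^[k - 1] (-s * y)) = s ^ α * nrm v' c' y := by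
  have hθ := h.θ_pos
  have hθ1 := h.θ_lt
  have hc0 := hsol.hc.1
  have hb := h.one_lt_b
  have e := h.sclip_eq hsol hs
  have h1 := hsol.adm.smooth_wdens h.two_le h.one_lt_b hc0 h.p_mem
    (d := (1 + θ) / 2 * c) (by positivity) (mul_le_one₀ (by linarith) hc0.le hsol.hc.2)
    h.cutoff_pos (h.cutoff_le hsol.adm ⟨hc, hsol.hc.2⟩) hsol.hs.1 (S := Set.Icc (-1) b)
    (fun y hy => by
      have := h.sclip_mem hsol.hc hsol.hs.1 (sub_margin_mem h.margin_pos hy)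
      rwa [e] at this)
  set W := wdens α⁻¹ (cutoff b m c₀ θ) k v c s with hW
  have m1 : (-1 : ℝ) ∈ Set.Icc (-1) b := ⟨le_rfl, by linarith⟩
  have mc : c' ∈ Set.Icc (-1) b := ⟨by linarith [hsol.hc'.1], by linarith [hsol.hc'.2]⟩
  have hs0 := hsol.hs.1
  have hP := hsol.adm.prim_pos hc0
  have hW1 : 0 < W (-1) := by
    have := h1.pos _ m1
    exact pos_of_mul_pos_right this (by positivity)
  have key : ∀ y ∈ Set.Icc (-1) b, nrm v c (-(lmap α⁻¹ v c)^[k - 1] (-s * y)) =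
      -s ^ α + s / prim v c * W (-1) * prim v' y := fun y hy => by
    have h2 := h1.integral_eq m1 hy
    have h3 := hsol.nrm_preimage h.one_lt_α h.two_le
    rw [neg_mul_neg, mul_one] at h2
    have h4 : ∫ t in (-1)..y, s / prim v c * W t = s / prim v c * W (-1) * prim v' y := by
      rw [show prim v' y = ∫ t in (-1)..y, v' t from rfl, ← intervalIntegral.integral_const_mul]
      refine intervalIntegral.integral_congr fun t ht => ?_
      have ht' := Set.uIcc_subset_Icc m1 hy ht
      show _ = s / prim v c * W (-1) * v' t
      rw [he t ht', h.tdens_eq hsol hc hs, ← hW]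
      field_simp
    linarith
  have h5 := key c' mc
  rw [hsol.peak, hsol.adm.nrm_self hc0] at h5
  have hP' := hv'.prim_pos hsol.hc'.1
  rw [key y hy, nrm, mul_sub, mul_one, ← mul_div_assoc, eq_sub_iff_add_eq, neg_add_cancel_comm,
    eq_div_iff hP'.ne']
  have h6 : s / prim v c * W (-1) * prim v' c' = s ^ α := by linarith
  rw [← h6]
  ring

lemma hasDerivWithinAt (h : Scale α b m c₀ k s₀ θ) (hv : Adm b m v) (hc : c ∈ Set.Icc c₀ 1)
    (hs : 0 < s) (he : ∀ y ∈ Set.Icc (-1) b, v' y = tdens α⁻¹ b m c₀ θ k v c s y) :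
    ∃ w, ContinuousOn w (Set.Icc (-1) 1) ∧
      ∀ x ∈ Set.Icc (-1 : ℝ) 1, HasDerivWithinAt v' (w x) (Set.Icc (-1) 1) x := by
  obtain ⟨g, hg⟩ := h.smooth_tdens hv hc hs
  obtain ⟨w, hw, hd⟩ := hg.pick.exists_continuousOn_hasDerivAt hg.cont hg.pos
    fun _ hx _ hy => hg.integral_eq hx hy
  have hε := h.margin_pos
  have hb := h.one_lt_b
  have hsub : Set.Icc (-1 : ℝ) 1 ⊆ Set.Ioo (-1 - margin b θ) (b + margin b θ) := fun x hx =>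
    ⟨by linarith [hx.1], by linarith [hx.2]⟩
  have hsub2 : Set.Icc (-1 : ℝ) 1 ⊆ Set.Icc (-1) b := Set.Icc_subset_Icc_right hb.le
  exact ⟨w, hw.mono hsub, fun x hx => (hd x (hsub hx)).hasDerivWithinAt.congr
    (fun y hy => he y (hsub2 hy)) (he x (hsub2 hx))⟩

lemma whi_pos (h : Scale α b m c₀ k s₀ θ) : 0 < whi α b m c₀ θ k := by
  have := vmax_pos h.one_lt_b
  have := h.p_mem.1
  have := h.cutoff_pos
  have := shi_pos h.one_lt_b h.m_pos
  unfold whi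
  positivity

lemma wlo_div_whi_pos (h : Scale α b m c₀ k s₀ θ) : 0 < wlo α b m k / whi α b m c₀ θ k :=
  div_pos h.wlo_pos h.whi_pos

lemma adm_one (h : Scale α b m c₀ k s₀ θ) : Adm b m (fun _ => 1) := by
  refine ⟨continuous_const, fun _ => one_pos, rfl, by linarith [h.m_le], ?_⟩
  have := (PickOn.id (Set.Icc (-1) b)).affine (a := 1) (c := 1) 0 1 (by norm_num)
  simp only [one_mul, add_zero, Set.ofPred_mem_eq] at this
  refine this.congr (fun x _ => ?_) fun _ _ => rfl
  simp [prim]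

lemma const_mem_densSet (h : Scale α b m c₀ k s₀ θ) {b' : -1 ≤ b} :
    ContinuousMap.const _ 1 ∈ densSet b' m (wlo α b m k / whi α b m c₀ θ k)
      (whi α b m c₀ θ k / wlo α b m k) (2 * (whi α b m c₀ θ k / wlo α b m k) ^ 2 /
        (wlo α b m k / whi α b m c₀ θ k * margin b θ)) := by
  have h1 := h.wlo_le_whi h.adm_one ⟨h.c₀_lt.le, le_rfl⟩ one_pos
  refine mem_densSet (by linarith [h.one_lt_b]) h.margin_pos h.wlo_div_whi_pos
    (SmoothPick.id _) (fun x _ => ⟨?_, ?_⟩) rfl (by linarith [h.m_le]) fun _ => rfl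
  · exact (div_le_one h.whi_pos).2 h1
  · exact (one_le_div h.wlo_pos).2 h1

lemma tdens_mem_densSet (h : Scale α b m c₀ k s₀ θ) {b' : -1 ≤ b} (hv : Adm b m v)
    (hc : c ∈ Set.Icc c₀ 1) (hs : 0 < s) {u : C(Set.Icc (-1) b, ℝ)}
    (hu : ∀ x, u x = tdens α⁻¹ b m c₀ θ k v c s x) :
    u ∈ densSet b' m (wlo α b m k / whi α b m c₀ θ k)
      (whi α b m c₀ θ k / wlo α b m k) (2 * (whi α b m c₀ θ k / wlo α b m k) ^ 2 /
        (wlo α b m k / whi α b m c₀ θ k * margin b θ)) := by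
  obtain ⟨g, hg⟩ := h.smooth_tdens hv hc hs
  exact mem_densSet (by linarith [h.one_lt_b]) h.margin_pos h.wlo_div_whi_pos hg
    (fun x hx => h.tdens_bounds hv hc hs hx) (h.tdens_neg_one hv hc hs) (h.le_tdens_zero hv hc hs)
    hu

lemma continuous_tdens_joint {X : Type*} [TopologicalSpace X] (h : Scale α b m c₀ k s₀ θ)
    {V : X → ℝ → ℝ} {c s y : X → ℝ} (hV : Continuous (Function.uncurry V)) (hc : Continuous c)
    (hs : Continuous s) (hy : Continuous y) (hadm : ∀ x, Adm b m (V x))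
    (hcm : ∀ x, c x ∈ Set.Icc c₀ 1) (hsp : ∀ x, 0 < s x) :
    Continuous fun x => tdens α⁻¹ b m c₀ θ k (V x) (c x) (s x) (y x) := by
  have hP : ∀ x, prim (V x) (c x) ≠ 0 := fun x =>
    ((hadm x).prim_pos (h.c₀_pos.trans_le (hcm x).1)).ne'
  have hsc : Continuous fun x => sclip b θ (c x) (s x) :=
    hs.min ((continuous_const.mul hc).min continuous_const)
  have hr : ∀ y : X → ℝ, Continuous y →
      Continuous fun x => rdens α⁻¹ b m c₀ θ k (V x) (c x) (s x) (y x) := fun y hy =>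
    (continuous_wdens_joint h.p_mem.1 h.cutoff_pos k hV hc hP hsc hy).div
      (continuous_wdens_joint h.p_mem.1 h.cutoff_pos k hV hc hP hsc continuous_const) fun x =>
      (h.wlo_pos.trans_le (h.wdens_bounds (hadm x) (hcm x) (hsp x) (y := -1)
        ⟨by linarith [h.margin_pos], by linarith [h.margin_pos, h.one_lt_b]⟩).1).ne'
  have hw : Continuous fun x => weight m (rdens α⁻¹ b m c₀ θ k (V x) (c x) (s x) 0) :=
    continuous_const.max (continuous_const.sub ((hr _ continuous_const).div_const m))
  exact ((continuous_const.sub hw).mul (hr y hy)).add hw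

/-- The equations hold at a fixed point of the clipped displacements. -/
lemma sol_of_clip (h : Scale α b m c₀ k s₀ θ) (hv : Adm b m v) (hc : c ∈ Set.Icc c₀ 1)
    (hs : s ∈ Set.Icc s₀ 1) (hc' : c' ∈ Set.Icc c₀ 1)
    (h1 : max c₀ (min 1 (c + (-(lmap α⁻¹ v c)^[k - 1] (-s * c') - c))) = c)
    (h2 : max s₀ (min 1 (s + (-nrm v c (max s (-(lmap α⁻¹ v c)^[k - 1] s)) - s ^ α))) = s) :
    Sol α b m k v c s c' := by
  have hc0 := h.c₀_pos.trans_le hc.1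
  have hs0 := h.s₀_pos.trans_le hs.1
  have hc'0 := h.c₀_pos.trans_le hc'.1
  have hsc : s * c' ≤ 1 := mul_le_one₀ hs.2 hc'0.le hc'.2
  have hsc0 : 0 < s * c' := by positivity
  have hp := h.p_mem
  have e1 := eq_zero_of_clip_eq hc h1 (fun e => by
      have hsm := h.small
      rw [← e] at hsm
      have := hv.residual_nonneg_of_small h.two_le h.one_lt_α h.one_lt_b h.m_pos ⟨hc0, hc.2⟩ hsm
        (z := -s * c') (by linarith)
      linarith)
    (fun e => by
      have := hv.residual_le hc0 hp.1 (k - 1) (z := -s * c') (by linarith)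
      linarith)
  have hpk : -(lmap α⁻¹ v c)^[k - 1] (-s * c') = c := by linarith
  have e2 := eq_zero_of_clip_eq hs h2 (fun e => by
      have := hv.rpow_le_of_small (k := k) (q := s ^ α) h.one_lt_b h.m_pos ⟨hc0, hc.2⟩ hp hs0
        (by rw [e]; linarith [h.s₀_lt, hc.1]) ⟨hc'0, hc'.2⟩ (by
          rw [e]
          refine h.small₁.trans ?_
          have := hc.1
          have := slo_pos h.one_lt_b h.m_pos
          gcongr) (by rw [e]; exact h.small₂) hpk
      linarith)
    (fun e => by
      have h3 := (hv.strictMono_nrm hc0).monotone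
        (hc.2.trans (e.symm.le.trans (le_max_left s (-(lmap α⁻¹ v c)^[k - 1] s))))
      rw [hv.nrm_self hc0] at h3
      have : 0 < s ^ α := by positivity
      linarith)
  exact ⟨hv, ⟨hc0, hc.2⟩, ⟨hs0, hs.2⟩, ⟨hc'0, hc'.2⟩, by linarith, hpk⟩

end Scale

/-- A continuous self-map of a nonempty compact convex set has a fixed point. -/
lemma schauder_subtype {E : Type*} [NormedAddCommGroup E] [NormedSpace ℝ E] {K : Set E}
    (hK : IsCompact K) (hconv : Convex ℝ K) (hne : K.Nonempty) {f : K → K} (hf : Continuous f) :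
    ∃ x, f x = x := by
  classical
  let T : E → E := fun x => if h : x ∈ K then f ⟨x, h⟩ else x
  have hT : ∀ x : K, T x = f x := fun x => dif_pos x.2
  have hTc : ContinuousOn T K := by
    rw [continuousOn_iff_continuous_domRestrict]
    have : K.domRestrict T = fun x => (f x : E) := funext hT
    rw [this]
    exact continuous_subtype_val.comp hf
  have hTm : Set.MapsTo T K K := fun x hx => by
    have := hT ⟨x, hx⟩
    rw [this]
    exact (f ⟨x, hx⟩).2
  obtain ⟨x, hx, he⟩ := schauder hK hconv hne hTc hTm
  exact ⟨⟨x, hx⟩, Subtype.ext ((hT ⟨x, hx⟩).symm.trans he)⟩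

/-- The periodic orbit of the renormalization operator, in terms of densities. -/
theorem exists_sol {α : ℝ} (hα : 1 < α) {ι : Type*} [Fintype ι] (σ : Equiv.Perm ι) (k : ι → ℕ)
    (hk : ∀ i, 2 ≤ k i) : ∃ (b m : ℝ) (v : ι → ℝ → ℝ) (c s : ι → ℝ), 1 < b ∧
      ∀ i, Sol α b m (k i) (v i) (c i) (s i) (c (σ i)) ∧
        (∀ y ∈ Set.Icc (-1) b, nrm (v i) (c i) (-(lmap α⁻¹ (v i) (c i))^[k i - 1] (-(s i) * y)) =
          s i ^ α * nrm (v (σ i)) (c (σ i)) y) ∧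
        ∃ w, ContinuousOn w (Set.Icc (-1) 1) ∧
          ∀ x ∈ Set.Icc (-1 : ℝ) 1, HasDerivWithinAt (v i) (w x) (Set.Icc (-1) 1) x := by
  classical
  obtain ⟨b, m, c₀, h⟩ := exists_base hα
  choose s₀ θ hS using fun i => h.exists_scale (hk i)
  have hb := h.one_lt_b
  have hb' : -1 ≤ b := by linarith
  let D : ι → Set C(Set.Icc (-1) b, ℝ) := fun i => densSet hb' m
    (wlo α b m (k i) / whi α b m c₀ (θ i) (k i)) (whi α b m c₀ (θ i) (k i) / wlo α b m (k i))
    (2 * (whi α b m c₀ (θ i) (k i) / wlo α b m (k i)) ^ 2 /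
        (wlo α b m (k i) / whi α b m c₀ (θ i) (k i) * margin b (θ i)))
  let S : ι → Set (C(Set.Icc (-1) b, ℝ) × ℝ × ℝ) := fun j =>
    D (σ.symm j) ×ˢ Set.Icc c₀ 1 ×ˢ Set.Icc (s₀ j) 1
  let K : Set (ι → C(Set.Icc (-1) b, ℝ) × ℝ × ℝ) := Set.pi Set.univ S
  have hK : IsCompact K := isCompact_univ_pi fun j =>
    (isCompact_densSet hb').prod (isCompact_Icc.prod isCompact_Icc)
  have hconv : Convex ℝ K := convex_pi fun j _ =>
    (convex_densSet hb').prod ((convex_Icc _ _).prod (convex_Icc _ _))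
  have hs1 : ∀ j, s₀ j ≤ 1 := fun j => ((hS j).s₀_lt.trans h.c₀_lt).le
  have hne : K.Nonempty := ⟨fun j => (ContinuousMap.const _ 1, 1, 1), fun j _ =>
    ⟨(hS (σ.symm j)).const_mem_densSet, ⟨h.c₀_lt.le, le_rfl⟩, ⟨hs1 j, le_rfl⟩⟩⟩
  let V : ι → K → ℝ → ℝ := fun j x => extend hb' (x.1 j).1
  let c : ι → K → ℝ := fun j x => (x.1 j).2.1
  let s : ι → K → ℝ := fun j x => (x.1 j).2.2
  have hxj : ∀ j, Continuous fun x : K => x.1 j := fun j =>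
    (continuous_apply j).comp continuous_subtype_val
  have hV : ∀ j, Continuous (Function.uncurry (V j)) := fun j =>
    (continuous_extend hb').comp (((hxj j).fst.comp continuous_fst).prodMk continuous_snd)
  have hcc : ∀ j, Continuous (c j) := fun j => (hxj j).snd.fst
  have hsc : ∀ j, Continuous (s j) := fun j => (hxj j).snd.snd
  have hmem : ∀ j (x : K), x.1 j ∈ S j := fun j x => x.2 j (Set.mem_univ j)
  have hadm : ∀ j x, Adm b m (V j x) := fun j x =>
    adm_of_mem_densSet hb' (hS (σ.symm j)).wlo_div_whi_pos (hmem j x).1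
  have hcm : ∀ j x, c j x ∈ Set.Icc c₀ 1 := fun j x => (hmem j x).2.1
  have hsm : ∀ j x, s j x ∈ Set.Icc (s₀ j) 1 := fun j x => (hmem j x).2.2
  have hsp : ∀ j x, 0 < s j x := fun j x => (hS j).s₀_pos.trans_le (hsm j x).1
  have hP : ∀ j x, prim (V j x) (c j x) ≠ 0 := fun j x =>
    ((hadm j x).prim_pos (h.c₀_pos.trans_le (hcm j x).1)).ne'
  have hp : 0 < α⁻¹ := by positivity
  let U : ι → C(K, C(Set.Icc (-1) b, ℝ)) := fun i => ContinuousMap.curry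
    ⟨fun q => tdens α⁻¹ b m c₀ (θ i) (k i) (V i q.1) (c i q.1) (s i q.1) q.2,
      (hS i).continuous_tdens_joint
        ((hV i).comp ((continuous_fst.comp continuous_fst).prodMk continuous_snd))
        ((hcc i).comp continuous_fst) ((hsc i).comp continuous_fst)
        (continuous_subtype_val.comp continuous_snd) (fun q => hadm i q.1) (fun q => hcm i q.1)
        fun q => hsp i q.1⟩
  have hU : ∀ i x y, U i x y = tdens α⁻¹ b m c₀ (θ i) (k i) (V i x) (c i x) (s i x) y :=
    fun _ _ _ => rfl
  let C : ι → K → ℝ := fun j x => max c₀ (min 1 (c j x +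
    (-(lmap α⁻¹ (V j x) (c j x))^[k j - 1] (-s j x * c (σ j) x) - c j x)))
  let R : ι → K → ℝ := fun j x => max (s₀ j) (min 1 (s j x +
    (-nrm (V j x) (c j x) (max (s j x) (-(lmap α⁻¹ (V j x) (c j x))^[k j - 1] (s j x))) -
      s j x ^ α)))
  have hC : ∀ j, Continuous (C j) := fun j => by
    have := continuous_iterate_lmap_joint hp (hV j) (hcc j) (hP j)
      ((hsc j).neg.mul (hcc (σ j))) (k j - 1)
    exact continuous_const.max (continuous_const.min ((hcc j).add (this.neg.sub (hcc j))))
  have hR : ∀ j, Continuous (R j) := fun j => by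
    have h1 := continuous_iterate_lmap_joint hp (hV j) (hcc j) (hP j) (hsc j) (k j - 1)
    have h2 := continuous_nrm_joint (hV j) (hcc j) (hP j) ((hsc j).max h1.neg)
    exact continuous_const.max (continuous_const.min ((hsc j).add
      (h2.neg.sub ((hsc j).rpow_const fun x => Or.inl (hsp j x).ne'))))
  let F : K → K := fun x => ⟨fun j => (U (σ.symm j) x, C j x, R j x), fun j _ =>
    ⟨(hS (σ.symm j)).tdens_mem_densSet (hadm _ x) (hcm _ x) (hsp _ x) (hU _ x),
      ⟨le_max_left _ _, max_le h.c₀_lt.le (min_le_left _ _)⟩,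
      ⟨le_max_left _ _, max_le (hs1 j) (min_le_left _ _)⟩⟩⟩
  have hF : Continuous F := Continuous.subtype_mk (continuous_pi fun j =>
    (U (σ.symm j)).continuous.prodMk ((hC j).prodMk (hR j))) _
  obtain ⟨x, hx⟩ := schauder_subtype hK hconv hne hF
  have hx' : ∀ j, (U (σ.symm j) x, C j x, R j x) = x.1 j := fun j =>
    congrFun (congrArg Subtype.val hx) j
  have hC' : ∀ j, C j x = c j x := fun j => congrArg (fun q => q.2.1) (hx' j)
  have hR' : ∀ j, R j x = s j x := fun j => congrArg (fun q => q.2.2) (hx' j)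
  have hsol : ∀ i, Sol α b m (k i) (V i x) (c i x) (s i x) (c (σ i) x) := fun i =>
    (hS i).sol_of_clip (hadm i x) (hcm i x) (hsm i x) (hcm (σ i) x) (hC' i) (hR' i)
  have he : ∀ i, ∀ y ∈ Set.Icc (-1) b, V (σ i) x y =
      tdens α⁻¹ b m c₀ (θ i) (k i) (V i x) (c i x) (s i x) y := fun i y hy => by
    have h1 : U i x = (x.1 (σ i)).1 := by
      have := congrArg Prod.fst (hx' (σ i))
      rwa [Equiv.symm_apply_apply] at this
    have h2 : V (σ i) x y = (x.1 (σ i)).1 ⟨y, hy⟩ := extend_apply hb' _ hy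
    rw [h2, ← h1, hU]
  refine ⟨b, m, fun j => V j x, fun j => c j x, fun j => s j x, hb, fun i =>
    ⟨hsol i, fun y hy => (hS i).nrm_eq (hsol i) (hcm i x).1 (hsm i x).1 (hadm _ x) (he i) hy, ?_⟩⟩
  have := (hS (σ.symm i)).hasDerivWithinAt (hadm _ x) (hcm _ x) (hsp _ x) (he (σ.symm i))
  rwa [Equiv.apply_symm_apply] at this

/-- The unimodal map whose right inverse branches are determined by the density `v`. -/
lemma Adm.exists_isUnimodal {α b m c : ℝ} {v w : ℝ → ℝ} (hv : Adm b m v) (hα : 0 < α)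
    (hc : c ∈ Set.Ioc (0 : ℝ) 1) (hw : ContinuousOn w (Set.Icc (-1) 1))
    (hd : ∀ x ∈ Set.Icc (-1 : ℝ) 1, HasDerivWithinAt v (w x) (Set.Icc (-1) 1) x) :
    ∃ f, IsUnimodal α f ∧
      ∀ x ∈ Set.Icc (-1 : ℝ) 1, f x ∈ Set.Icc (-1 : ℝ) 1 ∧ nrm v c (f x) = -|x| ^ α := by
  have hP := hv.prim_pos hc.1
  have hN1 : 0 ≤ nrm v c 1 := by
    rw [← hv.nrm_self hc.1]
    exact (hv.strictMono_nrm hc.1).monotone hc.2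
  obtain ⟨t, ht⟩ : ∃ t, t = 1 / (1 + nrm v c 1) := ⟨_, rfl⟩
  have ht0 : 0 < t := by rw [ht]; positivity
  have ht1 : t ≤ 1 := by rw [ht, div_le_one (by positivity)]; linarith
  let H : ℝ → ℝ := fun y => 2 * t - 1 + 2 * t * nrm v c y
  have hH : StrictMono H := fun x y hxy =>
    add_lt_add_right (mul_lt_mul_of_pos_left (hv.strictMono_nrm hc.1 hxy) (by positivity)) _
  have hHm : H (-1) = -1 := by
    show 2 * t - 1 + 2 * t * nrm v c (-1) = -1
    rw [Adm.nrm_neg_one]; ring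
  have hHp : H 1 = 1 := by
    have : t * (1 + nrm v c 1) = 1 := by rw [ht, one_div_mul_cancel (by positivity)]
    show 2 * t - 1 + 2 * t * nrm v c 1 = 1
    linarith
  have hH' : ∀ y, HasDerivAt H (2 * t * (v y / prim v c)) y := fun y =>
    ((hv.hasDerivAt_nrm y).const_mul (2 * t)).const_add _
  have hH0 : ∀ y, 0 < 2 * t * (v y / prim v c) := fun y => by
    have := hv.pos y
    positivity
  let φ : ℝ → ℝ := Function.invFun H
  have hφ : Function.LeftInverse φ H := Function.leftInverse_invFun hH.injective
  have hmaps : Set.MapsTo H (Set.Icc (-1) 1) (Set.Icc (-1) 1) := fun y hy =>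
    ⟨hHm ▸ hH.monotone hy.1, (hH.monotone hy.2).trans hHp.le⟩
  have hsurj : Set.SurjOn H (Set.Icc (-1) 1) (Set.Icc (-1) 1) := by
    have := intermediate_value_Icc (f := H) (show (-1 : ℝ) ≤ 1 by norm_num)
      fun y _ => (hH' y).continuousAt.continuousWithinAt
    rwa [hHm, hHp] at this
  have hbijH : Set.BijOn H (Set.Icc (-1) 1) (Set.Icc (-1) 1) := ⟨hmaps, hH.injective.injOn, hsurj⟩
  have hinv : ∀ z ∈ Set.Icc (-1 : ℝ) 1, φ z ∈ Set.Icc (-1 : ℝ) 1 ∧ H (φ z) = z := fun z hz => by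
    obtain ⟨y, hy, rfl⟩ := hsurj hz
    rw [hφ y]
    exact ⟨hy, rfl⟩
  have hbij : Set.BijOn φ (Set.Icc (-1) 1) (Set.Icc (-1) 1) :=
    hbijH.symm ⟨fun z hz => (hinv z hz).2, fun y _ => hφ y⟩
  let κ : ℝ := prim v c / (2 * t)
  have hκ : 0 < κ := by positivity
  have hφ' : ∀ z ∈ Set.Icc (-1 : ℝ) 1,
      HasDerivWithinAt φ (κ / v (φ z)) (Set.Icc (-1) 1) z := fun z hz => by
    have hst : HasStrictDerivAt H (2 * t * (v (φ z) / prim v c)) (φ z) :=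
      hasStrictDerivAt_of_hasDerivAt_of_continuousAt (Filter.Eventually.of_forall hH')
        (by
          have := hv.cont
          fun_prop)
    have h1 := (hst.to_local_left_inverse (hH0 _).ne'
      (Filter.Eventually.of_forall fun y => hφ y)).hasDerivAt.hasDerivWithinAt (s := Set.Icc (-1) 1)
    rw [(hinv z hz).2] at h1
    refine h1.congr_deriv ?_
    have := (hv.pos (φ z)).ne'
    show _ = prim v c / (2 * t) / v (φ z)
    field_simp
  have hφc : ContinuousOn φ (Set.Icc (-1) 1) := fun z hz => (hφ' z hz).continuousWithinAt
  refine ⟨fun x => φ (foldMap α t x), ⟨φ, fun z => κ / v (φ z),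
    fun z => -(κ * (w (φ z) * (κ / v (φ z)))) / v (φ z) ^ 2, t, ⟨ht0.le, ht1⟩,
    ⟨hbij, ?_, ?_, hφ', fun z hz => ?_, ?_, fun z hz => div_pos hκ (hv.pos _)⟩, fun x => rfl⟩,
    fun x hx => ?_⟩
  · have := hφ (-1); rwa [hHm] at this
  · have := hφ 1; rwa [hHp] at this
  · have h1 := (hd (φ z) (hinv z hz).1).comp z (hφ' z hz) hbij.mapsTo
    refine ((hasDerivWithinAt_const z (Set.Icc (-1) 1) κ).div h1 (hv.pos (φ z)).ne').congr_deriv ?_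
    show (0 * v (φ z) - κ * (w (φ z) * (κ / v (φ z)))) / v (φ z) ^ 2 = _
    ring
  · have h1 : ContinuousOn (fun z => v (φ z)) (Set.Icc (-1) 1) := hv.cont.comp_continuousOn hφc
    have h2 : ContinuousOn (fun z => w (φ z)) (Set.Icc (-1) 1) := hw.comp hφc hbij.mapsTo
    exact (continuousOn_const.mul (h2.mul (continuousOn_const.div h1
      fun z _ => (hv.pos _).ne'))).neg.div (h1.pow 2) fun z _ => (pow_pos (hv.pos _) 2).ne'
  · have hx1 : |x| ^ α ≤ 1 := Real.rpow_le_one (abs_nonneg x) (abs_le.2 hx) hα.le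
    have hx0 : 0 ≤ |x| ^ α := by positivity
    have h1 : t * |x| ^ α ≤ t := mul_le_of_le_one_right ht0.le hx1
    have h2 : 0 ≤ t * |x| ^ α := by positivity
    obtain ⟨h3, h4⟩ := hinv (foldMap α t x) ⟨by unfold foldMap; linarith, by
      unfold foldMap; linarith⟩
    refine ⟨h3, mul_left_cancel₀ ht0.ne' ?_⟩
    have h5 : 2 * t - 1 + 2 * t * nrm v c (φ (foldMap α t x)) = -2 * t * |x| ^ α + 2 * t - 1 := h4
    show t * nrm v c (φ (foldMap α t x)) = _
    linarith

lemma disjoint_interior_of_le {A B : Set ℝ} {r : ℝ} (hA : ∀ x ∈ A, x ≤ r) (hB : ∀ x ∈ B, r ≤ x) :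
    Disjoint (interior A) (interior B) := by
  refine Set.disjoint_left.2 fun x hx hx' => ?_
  have h1 := interior_mono (show A ⊆ Set.Iic r from hA) hx
  have h2 := interior_mono (show B ⊆ Set.Ici r from hB) hx'
  rw [interior_Iic] at h1
  rw [interior_Ici] at h2
  exact lt_asymm (Set.mem_Iio.1 h1) (Set.mem_Ioi.1 h2)

namespace Sol

variable {α b m c s c' : ℝ} {k : ℕ} {v v' f f' : ℝ → ℝ}

lemma lmap_mem (h : Sol α b m k v c s c') (hα : 1 < α) {z : ℝ} (hz : z ∈ Set.Icc (-1) c) :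
    lmap α⁻¹ v c z ∈ Set.Icc (-1) 0 :=
  ⟨h.adm.neg_one_le_lmap h.hc.1 (by positivity) hz.1, Adm.lmap_nonpos _ _ _ _⟩

lemma iterate_lmap_mem (h : Sol α b m k v c s c') (hα : 1 < α) {z : ℝ} (hz : z ∈ Set.Icc (-1) c)
    (n : ℕ) : (lmap α⁻¹ v c)^[n] z ∈ Set.Icc (-1) c := by
  induction n with
  | zero => exact hz
  | succ n ih =>
    rw [Function.iterate_succ_apply']
    exact Set.Icc_subset_Icc_right h.hc.1.le (h.lmap_mem hα ih)

lemma map_lmap (h : Sol α b m k v c s c') (hα : 1 < α)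
    (hf : ∀ x ∈ Set.Icc (-1 : ℝ) 1, nrm v c (f x) = -|x| ^ α) {z : ℝ} (hz : z ∈ Set.Icc (-1) c) :
    f (lmap α⁻¹ v c z) = z := by
  have hN := h.adm.strictMono_nrm h.hc.1
  have h1 : nrm v c z ≤ 0 := h.adm.nrm_self h.hc.1 ▸ hN.monotone hz.2
  have h2 := h.lmap_mem hα hz
  refine hN.injective ?_
  rw [hf _ ⟨h2.1, h2.2.trans zero_le_one⟩, lmap, abs_neg, max_eq_left (by linarith),
    abs_of_nonneg (Real.rpow_nonneg (by linarith) _), ← Real.rpow_mul (by linarith),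
    inv_mul_cancel₀ (by linarith), Real.rpow_one, neg_neg]

lemma iterate_map_lmap (h : Sol α b m k v c s c') (hα : 1 < α)
    (hf : ∀ x ∈ Set.Icc (-1 : ℝ) 1, nrm v c (f x) = -|x| ^ α) {z : ℝ} (hz : z ∈ Set.Icc (-1) c)
    (n j : ℕ) : f^[j] ((lmap α⁻¹ v c)^[n + j] z) = (lmap α⁻¹ v c)^[n] z := by
  induction j with
  | zero => rfl
  | succ j ih =>
    rw [Function.iterate_succ_apply, ← add_assoc, Function.iterate_succ_apply',
      h.map_lmap hα hf (h.iterate_lmap_mem hα hz _), ih]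

lemma map_neg (h : Sol α b m k v c s c')
    (hf : ∀ x ∈ Set.Icc (-1 : ℝ) 1, nrm v c (f x) = -|x| ^ α) {x : ℝ} (hx : x ∈ Set.Icc (-1 : ℝ) 1) :
    f (-x) = f x :=
  (h.adm.strictMono_nrm h.hc.1).injective <| by
    rw [hf x hx, hf (-x) ⟨by linarith [hx.2], by linarith [hx.1]⟩, abs_neg]

lemma iterate_lmap_le (h : Sol α b m k v c s c') (hα : 1 < α) (hk : 2 ≤ k) (n : ℕ) :
    (lmap α⁻¹ v c)^[n + 1] s ≤ -s := by
  have hL := h.adm.monotone_lmap h.hc.1 (show 0 < α⁻¹ by positivity)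
  have h1 : lmap α⁻¹ v c s ≤ -s :=
    (hL (h.le_preimage hα hk)).trans (h.lmap_preimage hα hk).le
  induction n with
  | zero => exact h1
  | succ n ih =>
    rw [Function.iterate_succ_apply']
    exact (hL (ih.trans (by linarith [h.hs.1]))).trans h1

/-- The first image of the renormalization interval. -/
lemma map_mul (h : Sol α b m k v c s c') (hb : 1 < b)
    (hN : ∀ y ∈ Set.Icc (-1) b, nrm v c (-(lmap α⁻¹ v c)^[k - 1] (-s * y)) = s ^ α * nrm v' c' y)
    (hf : ∀ x ∈ Set.Icc (-1 : ℝ) 1, nrm v c (f x) = -|x| ^ α)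
    (hf' : ∀ x ∈ Set.Icc (-1 : ℝ) 1, f' x ∈ Set.Icc (-1 : ℝ) 1 ∧ nrm v' c' (f' x) = -|x| ^ α)
    {x : ℝ} (hx : x ∈ Set.Icc (-1 : ℝ) 1) : f (s * x) = -(lmap α⁻¹ v c)^[k - 1] (-s * f' x) := by
  have hs := h.hs
  obtain ⟨h1, h2⟩ := hf' x hx
  refine (h.adm.strictMono_nrm h.hc.1).injective ?_
  rw [hN _ ⟨h1.1, h1.2.trans hb.le⟩, h2, hf, abs_mul, abs_of_pos hs.1,
    Real.mul_rpow hs.1.le (abs_nonneg x), mul_neg]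
  exact abs_le.1 (by
    rw [abs_mul, abs_of_pos hs.1]
    exact mul_le_one₀ hs.2 (abs_nonneg x) (abs_le.2 hx))

/-- The later images of the renormalization interval. -/
lemma iterate_map_mul (h : Sol α b m k v c s c') (hα : 1 < α) (hb : 1 < b)
    (hN : ∀ y ∈ Set.Icc (-1) b, nrm v c (-(lmap α⁻¹ v c)^[k - 1] (-s * y)) = s ^ α * nrm v' c' y)
    (hf : ∀ x ∈ Set.Icc (-1 : ℝ) 1, nrm v c (f x) = -|x| ^ α)
    (hf' : ∀ x ∈ Set.Icc (-1 : ℝ) 1, f' x ∈ Set.Icc (-1 : ℝ) 1 ∧ nrm v' c' (f' x) = -|x| ^ α)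
    {x : ℝ} (hx : x ∈ Set.Icc (-1 : ℝ) 1) {a : ℕ} (ha : 2 ≤ a) (hak : a ≤ k) :
    f^[a] (s * x) = (lmap α⁻¹ v c)^[k - a] (-s * f' x) := by
  obtain ⟨j, rfl⟩ := Nat.exists_eq_add_of_le' ha
  obtain ⟨n, rfl⟩ := Nat.exists_eq_add_of_le' hak
  have hz : -s * f' x ∈ Set.Icc (-1) c := by
    have h1 := abs_le.2 (hf' x hx).1
    have h2 : |-s * f' x| ≤ s := by
      rw [abs_mul, abs_neg, abs_of_pos h.hs.1]
      exact mul_le_of_le_one_right h.hs.1.le h1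
    have h3 := abs_le.1 h2
    exact ⟨by linarith [h.hs.2], by linarith [h.lt]⟩
  have e : n + (j + 2) - 1 = n + (j + 1) := by omega
  have h1 := h.iterate_lmap_mem hα hz (n + (j + 1))
  rw [Function.iterate_succ_apply, h.map_mul hb hN hf hf' hx, e, Function.iterate_succ_apply,
    h.map_neg hf ⟨h1.1, h1.2.trans h.hc.2⟩, ← Function.iterate_succ_apply,
    h.iterate_map_lmap hα hf hz, Nat.add_sub_cancel]

/-- The map determined by the renormalized density is the renormalization of `f`. -/
theorem renormalization (h : Sol α b m k v c s c') (h_adm : Adm b m v') (hα : 1 < α)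
    (hb : 1 < b) (hk : 2 ≤ k)
    (hN : ∀ y ∈ Set.Icc (-1) b, nrm v c (-(lmap α⁻¹ v c)^[k - 1] (-s * y)) = s ^ α * nrm v' c' y)
    (hf : ∀ x ∈ Set.Icc (-1 : ℝ) 1, nrm v c (f x) = -|x| ^ α)
    (hf' : ∀ x ∈ Set.Icc (-1 : ℝ) 1, f' x ∈ Set.Icc (-1 : ℝ) 1 ∧ nrm v' c' (f' x) = -|x| ^ α) :
    (∀ a b, a ≤ k - 1 → b ≤ k - 1 → a ≠ b →
      Disjoint (interior (f^[a] '' Set.Icc (-s) s)) (interior (f^[b] '' Set.Icc (-s) s))) ∧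
    f^[k] '' Set.Icc (-s) s ⊆ Set.Icc (-s) s ∧
    ∀ x ∈ Set.Icc (-1 : ℝ) 1, -1 * f^[k] (-1 * s * x) / s = f' x := by
  have hs := h.hs.1
  have hmem : ∀ x ∈ Set.Icc (-1 : ℝ) 1, -s * f' x ∈ Set.Icc (-s) s := fun x hx => by
    have h1 := abs_le.2 (hf' x hx).1
    rw [Set.mem_Icc, ← abs_le, abs_mul, abs_neg, abs_of_pos hs]
    exact mul_le_of_le_one_right hs.le h1
  have hL := fun n => h.adm.monotone_iterate_lmap h.hc.1 (show 0 < α⁻¹ by positivity) n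
  have himg : ∀ {a : ℕ} {u : ℝ}, u ∈ f^[a] '' Set.Icc (-s) s →
      ∃ x ∈ Set.Icc (-1 : ℝ) 1, u = f^[a] (s * x) := by
    rintro a _ ⟨u, hu, rfl⟩
    refine ⟨u / s, ⟨?_, ?_⟩, by rw [mul_div_cancel₀ _ hs.ne']⟩
    · rw [le_div_iff₀ hs]; linarith [hu.1]
    · rw [div_le_one hs]; exact hu.2
  have hone : ∀ u ∈ f^[1] '' Set.Icc (-s) s, s ≤ u := fun u hu => by
    obtain ⟨x, hx, rfl⟩ := himg hu
    rw [Function.iterate_one, h.map_mul hb hN hf hf' hx]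
    have h1 := hL (k - 1) (hmem x hx).2
    have h2 := h.iterate_lmap_le hα hk (k - 2)
    rw [show k - 2 + 1 = k - 1 by omega] at h2
    linarith
  have hge : ∀ a, 2 ≤ a → a ≤ k → ∀ u ∈ f^[a] '' Set.Icc (-s) s,
      (lmap α⁻¹ v c)^[k - a] (-s) ≤ u ∧ u ≤ (lmap α⁻¹ v c)^[k - a] s := fun a ha hak u hu => by
    obtain ⟨x, hx, rfl⟩ := himg hu
    rw [h.iterate_map_mul hα hb hN hf hf' hx ha hak]
    exact ⟨hL _ (hmem x hx).1, hL _ (hmem x hx).2⟩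
  have hle : ∀ a, 2 ≤ a → a ≤ k - 1 → ∀ u ∈ f^[a] '' Set.Icc (-s) s, u ≤ -s :=
    fun a ha hak u hu => by
    have h1 := h.iterate_lmap_le hα hk (k - a - 1)
    rw [show k - a - 1 + 1 = k - a by omega] at h1
    exact (hge a ha (by omega) u hu).2.trans h1
  have hlt : ∀ a b, a < b → b ≤ k - 1 →
      Disjoint (interior (f^[a] '' Set.Icc (-s) s)) (interior (f^[b] '' Set.Icc (-s) s)) := by
    intro a b hab hbk
    obtain rfl | rfl | ha : a = 0 ∨ a = 1 ∨ 2 ≤ a := by omega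
    · obtain rfl | hb2 : b = 1 ∨ 2 ≤ b := by omega
      · refine disjoint_interior_of_le (r := s) (fun x hx => ?_) hone
        rw [Function.iterate_zero, Set.image_id] at hx
        exact hx.2
      · refine (disjoint_interior_of_le (r := -s) (hle b hb2 hbk) fun x hx => ?_).symm
        rw [Function.iterate_zero, Set.image_id] at hx
        exact hx.1
    · exact (disjoint_interior_of_le (r := -s) (hle b hab hbk) fun x hx => by
        linarith [hone x hx]).symm
    · refine disjoint_interior_of_le (r := (lmap α⁻¹ v c)^[k - b] (-s))
        (fun x hx => ((hge a ha (by omega) x hx).2).trans ?_)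
        fun x hx => (hge b (by omega) (by omega) x hx).1
      rw [show k - a = k - b + (b - a - 1 + 1) by omega, Function.iterate_add_apply]
      exact hL _ (h.iterate_lmap_le hα hk _)
  refine ⟨fun a b ha hb hab => ?_, fun u hu => ?_, fun x hx => ?_⟩
  · rcases lt_or_gt_of_ne hab with hlt' | hlt'
    · exact hlt a b hlt' hb
    · exact (hlt b a hlt' ha).symm
  · have := hge k hk le_rfl u hu
    rwa [Nat.sub_self, Function.iterate_zero] at this
  · have hx' : -x ∈ Set.Icc (-1 : ℝ) 1 := ⟨by linarith [hx.2], by linarith [hx.1]⟩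
    have e : f' (-x) = f' x := (h_adm.strictMono_nrm h.hc'.1).injective <| by
      rw [(hf' x hx).2, (hf' _ hx').2, abs_neg]
    rw [show -1 * s * x = s * -x by ring, h.iterate_map_mul hα hb hN hf hf' hx' hk le_rfl,
      Nat.sub_self, Function.iterate_zero, id, e]
    field_simp

end Sol

/-- For every critical exponent `α > 1`, every `n ≥ 1` and every sequence of periods
`k 0, …, k (n-1)` with `k i ≥ 2`, the renormalization operator has a periodic orbit
realizing these periods: there are unimodal maps `f i`, scales `s i ∈ (0,1)` and signs
`ε i ∈ {-1,1}` such that for each `i` the intervals `(f i)^j([-s i, s i])`,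
`0 ≤ j ≤ k i - 1`, have pairwise disjoint interiors,
`(f i)^{k i}([-s i, s i]) ⊆ [-s i, s i]`, and
`ε i (f i)^{k i}(ε i · s i · x)/s i = f ((i+1) mod n) x` on `[-1,1]`. -/
theorem renormalization_periodic_orbit (α : ℝ) (hα : 1 < α) (n : ℕ) (hn : 1 ≤ n)
    (k : Fin n → ℕ) (hk : ∀ i, 2 ≤ k i) :
    ∃ f : Fin n → ℝ → ℝ, ∃ s : Fin n → ℝ, ∃ ε : Fin n → ℝ,
      ∀ i : Fin n,
        IsUnimodal α (f i) ∧
        s i ∈ Set.Ioo (0 : ℝ) 1 ∧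
        (ε i = -1 ∨ ε i = 1) ∧
        (∀ a b, a ≤ k i - 1 → b ≤ k i - 1 → a ≠ b →
          Disjoint (interior ((f i)^[a] '' Set.Icc (-(s i)) (s i)))
                   (interior ((f i)^[b] '' Set.Icc (-(s i)) (s i)))) ∧
        (f i)^[k i] '' Set.Icc (-(s i)) (s i) ⊆ Set.Icc (-(s i)) (s i) ∧
        ∀ x ∈ Set.Icc (-1 : ℝ) 1,
          ε i * (f i)^[k i] (ε i * s i * x) / s i =
            f ⟨(i.val + 1) % n, Nat.mod_lt _ (Nat.lt_of_lt_of_le Nat.zero_lt_one hn)⟩ x := by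
  let σ : Equiv.Perm (Fin n) := Equiv.ofBijective
    (fun i => ⟨(i.val + 1) % n, Nat.mod_lt _ (Nat.lt_of_lt_of_le Nat.zero_lt_one hn)⟩)
    (Finite.injective_iff_bijective.1 fun i j hij => Fin.ext <|
      (Nat.ModEq.add_right_cancel' 1 (Fin.mk.inj_iff.1 hij)).eq_of_lt_of_lt i.2 j.2)
  obtain ⟨b, m, v, c, s, hb, h⟩ := exists_sol hα σ k hk
  have hf : ∀ i, ∃ f, IsUnimodal α f ∧ ∀ x ∈ Set.Icc (-1 : ℝ) 1,
      f x ∈ Set.Icc (-1 : ℝ) 1 ∧ nrm (v i) (c i) (f x) = -|x| ^ α := fun i => by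
    obtain ⟨hsol, _, w, hw, hd⟩ := h i
    exact hsol.adm.exists_isUnimodal (by linarith) hsol.hc hw hd
  choose f hu hf using hf
  refine ⟨f, s, fun _ => -1, fun i => ?_⟩
  obtain ⟨hsol, hN, _⟩ := h i
  exact ⟨hu i, ⟨hsol.hs.1, hsol.lt.trans_le hsol.hc.2⟩, Or.inl rfl,
    hsol.renormalization (h (σ i)).1.adm hα hb (hk i) hN (fun x hx => (hf i x hx).2) (hf (σ i))⟩
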